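/- arXiv:1010.5393 — 3 statements merged into one kernel-verified Lean document; each statement's English description precedes it below -/
import Mathlib

section
/- Let ℓ be a prime number, let F be a finite extension of the field ℚ_ℓ of ℓ-adic numbers, and let n be a positive integer. Then there exists a positive integer m, depending only on n and F, with the following property: for any two semisimple elements σ₁ and σ₂ of GL_n(F) (i.e. invertible n×n matrices over F that are diagonalizable over an algebraic closure of F), if there exists a non-zero integer k such that σ₁^k and σ₂^k are conjugate in GL_n(F), then σ₁^m and σ₂^m are conjugate in GL_n(F). -/
/-- An element of `GL n F` is semisimple if, viewed over an algebraic closure of `F`,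
it is diagonalizable, i.e. conjugate to a diagonal matrix. -/
def Matrix.GeneralLinearGroup.IsSemisimpleElt {n : ℕ} {F : Type*} [Field F]
    (σ : GL (Fin n) F) : Prop :=
  ∃ (u : (Matrix (Fin n) (Fin n) (AlgebraicClosure F))ˣ)
    (d : Fin n → AlgebraicClosure F),
    (σ : Matrix (Fin n) (Fin n) F).map (algebraMap F (AlgebraicClosure F)) =
      (u : Matrix (Fin n) (Fin n) (AlgebraicClosure F)) * Matrix.diagonal d *
        ((u⁻¹ : (Matrix (Fin n) (Fin n) (AlgebraicClosure F))ˣ) :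
          Matrix (Fin n) (Fin n) (AlgebraicClosure F))

open scoped IntermediateField

/-- In a domain where the prime `ℓ` is neither zero nor a unit, a root of unity congruent to `1`
modulo `ℓ ^ 2` is equal to `1`. -/
theorem eq_one_of_pow_eq_one_of_sq_dvd_sub_one {R : Type*} [CommRing R] [IsDomain R] {ℓ : ℕ}
    (hℓ : ℓ.Prime) (h0 : (ℓ : R) ≠ 0) (hu : ¬ IsUnit (ℓ : R)) {N : ℕ} (hN : N ≠ 0) :
    ∀ {z : R}, z ^ N = 1 → (ℓ : R) ^ 2 ∣ z - 1 → z = 1 := by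
  induction N using Nat.recOnMul with
  | zero => exact absurd rfl hN
  | one => intro z hz _; simpa using hz
  | mul a b iha ihb =>
    intro z hz hd
    rw [pow_mul] at hz
    refine iha (left_ne_zero_of_mul hN) (ihb (right_ne_zero_of_mul hN) hz ?_) hd
    exact hd.trans (sub_one_dvd_pow_sub_one z a)
  | prime p hp =>
    intro z hz hd
    by_contra hz1
    have hsum : ∑ i ∈ Finset.range p, z ^ i = 0 := by
      have := geom_sum_mul z p
      rw [hz, sub_self] at this
      exact (mul_eq_zero.mp this).resolve_right (sub_ne_zero.mpr hz1)
    have hp' : (ℓ : R) ^ 2 ∣ (p : R) := by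
      have h1 : (ℓ : R) ^ 2 ∣ ∑ i ∈ Finset.range p, (z ^ i - 1) :=
        Finset.dvd_sum fun i _ => hd.trans (sub_one_dvd_pow_sub_one z i)
      rw [Finset.sum_sub_distrib, hsum] at h1
      simpa using h1
    by_cases hpl : p = ℓ
    · subst hpl
      obtain ⟨c, hc⟩ := hp'
      refine hu (IsUnit.of_mul_eq_one c ?_)
      apply mul_left_cancel₀ h0
      rw [mul_one]
      conv_rhs => rw [hc]
      ring
    · have hco : IsCoprime (ℓ : R) (p : R) := by
        have := ((Nat.coprime_primes hℓ hp).mpr (Ne.symm hpl)).isCoprime.map (Int.castRingHom R)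
        simpa using this
      exact hu (hco.isUnit_of_dvd' dvd_rfl ((dvd_pow_self _ two_ne_zero).trans hp'))

/-- The order of a root of unity in an extension of `ℚ_[ℓ]` of degree at most `D` divides
`(ℓ ^ (2 * D))!`. -/
theorem Padic.pow_factorial_eq_one_of_finrank_le (ℓ : ℕ) [Fact ℓ.Prime] {K : Type*} [Field K]
    [Algebra ℚ_[ℓ] K] [FiniteDimensional ℚ_[ℓ] K] {D : ℕ} (hD : Module.finrank ℚ_[ℓ] K ≤ D)
    {z : K} {N : ℕ} (hN : N ≠ 0) (hz : z ^ N = 1) :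
    z ^ (ℓ ^ (2 * D)).factorial = 1 := by
  have hℓ : ℓ.Prime := Fact.out
  let _ : Algebra ℤ_[ℓ] K := ((algebraMap ℚ_[ℓ] K).comp (algebraMap ℤ_[ℓ] ℚ_[ℓ])).toAlgebra
  have : IsScalarTower ℤ_[ℓ] ℚ_[ℓ] K := IsScalarTower.of_algebraMap_eq fun _ => rfl
  have : CharZero K := charZero_of_injective_algebraMap (algebraMap ℚ_[ℓ] K).injective
  have hinj : Function.Injective (algebraMap ℤ_[ℓ] K) :=
    (algebraMap ℚ_[ℓ] K).injective.comp (IsFractionRing.injective ℤ_[ℓ] ℚ_[ℓ])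
  have : Module.IsTorsionFree ℤ_[ℓ] K := Module.isTorsionFree_iff_algebraMap_injective.mpr hinj
  let R := integralClosure ℤ_[ℓ] K
  have : Module.Free ℤ_[ℓ] R := IsIntegralClosure.module_free ℤ_[ℓ] ℚ_[ℓ] K R
  have : Module.Finite ℤ_[ℓ] R := IsIntegralClosure.finite ℤ_[ℓ] ℚ_[ℓ] K R
  have hrank : Module.finrank ℤ_[ℓ] R = Module.finrank ℚ_[ℓ] K :=
    IsIntegralClosure.rank ℤ_[ℓ] ℚ_[ℓ] K R
  have hzint : IsIntegral ℤ_[ℓ] z :=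
    IsIntegral.of_pow (Nat.pos_of_ne_zero hN) (hz ▸ isIntegral_one)
  let w : R := ⟨z, hzint⟩
  have hw : w ^ N = 1 := Subtype.ext hz
  have h0 : (ℓ : R) ≠ 0 := fun h => by
    have := congrArg (algebraMap R K) h
    simp [hℓ.ne_zero] at this
  have hu : ¬ IsUnit (ℓ : R) := fun h => by
    have h1 : IsUnit (algebraMap ℤ_[ℓ] R ℓ) := by simpa using h
    have h2 := isUnit_of_map_unit (algebraMap ℤ_[ℓ] R) _ h1
    exact PadicInt.prime_p.not_isUnit h2
  let b := Module.finBasis ℤ_[ℓ] R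
  have hcong : ∀ x y : R,
      (∀ i, PadicInt.toZModPow 2 (b.repr x i) = PadicInt.toZModPow 2 (b.repr y i)) →
      (ℓ : R) ^ 2 ∣ x - y := fun x y h => by
    rw [← b.sum_repr (x - y)]
    refine Finset.dvd_sum fun i _ => ?_
    have h1 : b.repr (x - y) i ∈ RingHom.ker (PadicInt.toZModPow (p := ℓ) 2) := by
      rw [RingHom.mem_ker, map_sub, Finsupp.sub_apply, map_sub, h i, sub_self]
    rw [PadicInt.ker_toZModPow, Ideal.mem_span_singleton] at h1
    obtain ⟨c, hc⟩ := h1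
    rw [hc, Algebra.smul_def]
    simp only [map_mul, map_pow, map_natCast, mul_assoc]
    exact dvd_mul_right _ _
  have : NeZero (ℓ ^ 2) := ⟨pow_ne_zero _ hℓ.ne_zero⟩
  let f : Fin (ℓ ^ (2 * D) + 1) → (Fin (Module.finrank ℤ_[ℓ] R) → ZMod (ℓ ^ 2)) :=
    fun i j => PadicInt.toZModPow 2 (b.repr (w ^ (i : ℕ)) j)
  obtain ⟨i, j, hij, hf⟩ := Fintype.exists_ne_map_eq_of_card_lt f (by
    rw [Fintype.card_fun, ZMod.card, Fintype.card_fin, Fintype.card_fin, hrank, ← pow_mul]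
    exact Nat.lt_succ_of_le (Nat.pow_le_pow_right hℓ.pos (Nat.mul_le_mul_left 2 hD)))
  wlog hlt : i < j generalizing i j
  · exact this j i hij.symm hf.symm (lt_of_le_of_ne (not_lt.mp hlt) hij.symm)
  have hlt' : (i : ℕ) < j := hlt
  have hwu : IsUnit w := IsUnit.of_pow_eq_one hw hN
  have hdvd : (ℓ : R) ^ 2 ∣ w ^ ((j : ℕ) - i) - 1 := by
    have h1 := hcong _ _ fun k => (congrFun hf k).symm
    have h2 : w ^ (j : ℕ) - w ^ (i : ℕ) = w ^ (i : ℕ) * (w ^ ((j : ℕ) - i) - 1) := by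
      rw [mul_sub, ← pow_add, Nat.add_sub_cancel' hlt'.le, mul_one]
    rwa [h2, (hwu.pow _).dvd_mul_left] at h1
  have hone : w ^ ((j : ℕ) - i) = 1 :=
    eq_one_of_pow_eq_one_of_sq_dvd_sub_one hℓ h0 hu hN
      (by rw [← pow_mul, mul_comm, pow_mul, hw, one_pow]) hdvd
  obtain ⟨c, hc⟩ : (j : ℕ) - i ∣ (ℓ ^ (2 * D)).factorial :=
    Nat.dvd_factorial (Nat.sub_pos_of_lt hlt') (by have := j.isLt; omega)
  have : w ^ (ℓ ^ (2 * D)).factorial = 1 := by rw [hc, pow_mul, hone, one_pow]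
  exact congrArg Subtype.val this

/-- Two families indexed by a finite type with the same multiset of values differ by a
permutation of the index type. -/
theorem exists_perm_of_multiset_map_eq {ι α : Type*} [Fintype ι] {s t : ι → α}
    (h : Finset.univ.val.map s = Finset.univ.val.map t) :
    ∃ π : Equiv.Perm ι, ∀ i, t (π i) = s i := by
  classical
  have hcard (c : α) : Fintype.card {i // s i = c} = Fintype.card {i // t i = c} := by
    have := congrArg (Multiset.count c) h
    rw [Multiset.count_map, Multiset.count_map] at this
    rw [Fintype.card_subtype, Fintype.card_subtype]
    simpa [Finset.card, Finset.filter, eq_comm] using this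
  exact ⟨Equiv.ofFiberEquiv fun c => Fintype.equivOfCardEq (hcard c),
    fun i => Equiv.ofFiberEquiv_map _ i⟩

/-- Square matrices over an infinite field which become conjugate over a field extension are
already conjugate. -/
theorem Matrix.exists_mul_eq_mul_of_map {ι K L : Type*} [Fintype ι] [DecidableEq ι] [Field K]
    [Infinite K] [Field L] [Algebra K L] {A B : Matrix ι ι K} {U : Matrix ι ι L}
    (hU : U.det ≠ 0)
    (h : U * A.map (algebraMap K L) = B.map (algebraMap K L) * U) :
    ∃ V : Matrix ι ι K, V.det ≠ 0 ∧ V * A = B * V := by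
  classical
  let b := Module.Basis.ofVectorSpace K L
  let s : Finset (Module.Basis.ofVectorSpaceIndex K L) :=
    Finset.univ.biUnion fun i => Finset.univ.biUnion fun j => (b.repr (U i j)).support
  let W (e) : Matrix ι ι K := Matrix.of fun i j => b.repr (U i j) e
  have hW (e) : W e * A = B * W e := by
    ext i j
    have h1 := congrArg (fun x => b.repr x e) (congrFun (congrFun h i) j)
    simp only [Matrix.mul_apply, Matrix.map_apply, map_sum, Finsupp.finsetSum_apply] at h1
    simp only [Matrix.mul_apply, W, Matrix.of_apply]
    convert h1 using 2 with k _ k _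
    · rw [mul_comm (U i k), ← Algebra.smul_def, map_smul, Finsupp.smul_apply, smul_eq_mul,
        mul_comm]
    · rw [← Algebra.smul_def, map_smul, Finsupp.smul_apply, smul_eq_mul]
  let M : Matrix ι ι (MvPolynomial (Module.Basis.ofVectorSpaceIndex K L) K) :=
    ∑ e ∈ s, (MvPolynomial.X e : MvPolynomial (Module.Basis.ofVectorSpaceIndex K L) K) •
      (W e).map MvPolynomial.C
  have hMU : M.map (MvPolynomial.aeval b) = U := by
    ext i j
    have hs : (b.repr (U i j)).support ⊆ s := fun e he => by
      simp only [s, Finset.mem_biUnion, Finset.mem_univ, true_and]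
      exact ⟨i, j, he⟩
    conv_rhs => rw [← b.linearCombination_repr (U i j)]
    rw [Finsupp.linearCombination_apply, Finsupp.sum_of_support_subset _ hs _ (by simp)]
    simp only [M, W, Matrix.map_apply, Matrix.sum_apply, Matrix.smul_apply, map_sum, smul_eq_mul,
      map_mul, MvPolynomial.aeval_X, MvPolynomial.aeval_C, Matrix.of_apply]
    exact Finset.sum_congr rfl fun e _ => by rw [Algebra.smul_def, mul_comm]
  have hM : M.det ≠ 0 := fun h0 => hU <| by
    have := (MvPolynomial.aeval (R := K) b).map_det M
    rw [h0, map_zero] at this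
    rw [← hMU]
    exact this.symm
  obtain ⟨x, hx⟩ : ∃ x, MvPolynomial.eval x M.det ≠ 0 := by
    by_contra! hall
    exact hM (MvPolynomial.funext fun x => by rw [hall x, map_zero])
  have hMx : M.map (MvPolynomial.eval x) = ∑ e ∈ s, x e • W e := by
    ext i j
    simp [M, Matrix.sum_apply]
  refine ⟨∑ e ∈ s, x e • W e, ?_, ?_⟩
  · rw [RingHom.map_det] at hx
    rwa [← hMx]
  · rw [Finset.sum_mul, Finset.mul_sum]
    exact Finset.sum_congr rfl fun e _ => by rw [Matrix.smul_mul, Matrix.mul_smul, hW]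

/-- If `a` and `b` have degree at most `n` over a finite extension `F` of `ℚ_[ℓ]` and
`a ^ k = b ^ k` for some `k ≠ 0`, then this holds for an explicit exponent which depends only
on `n` and `F`. -/
theorem Padic.pow_eq_pow_of_natDegree_minpoly_le (ℓ : ℕ) [Fact ℓ.Prime]
    {F L : Type*} [Field F] [Algebra ℚ_[ℓ] F] [FiniteDimensional ℚ_[ℓ] F] [Field L] [Algebra F L]
    {n : ℕ} {a b : L} (ha : IsIntegral F a) (hb : IsIntegral F b)
    (hna : (minpoly F a).natDegree ≤ n) (hnb : (minpoly F b).natDegree ≤ n)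
    {k : ℕ} (hk : k ≠ 0) (hab : a ^ k = b ^ k) :
    a ^ (ℓ ^ (2 * (Module.finrank ℚ_[ℓ] F * (n * n)))).factorial =
      b ^ (ℓ ^ (2 * (Module.finrank ℚ_[ℓ] F * (n * n)))).factorial := by
  rcases eq_or_ne b 0 with rfl | hb0
  · rw [zero_pow hk] at hab
    rw [eq_zero_of_pow_eq_zero hab]
  let E : IntermediateField F L := F⟮a⟯ ⊔ F⟮b⟯
  have : FiniteDimensional F F⟮a⟯ := IntermediateField.adjoin.finiteDimensional ha
  have : FiniteDimensional F F⟮b⟯ := IntermediateField.adjoin.finiteDimensional hb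
  have : FiniteDimensional F E := IntermediateField.finiteDimensional_sup _ _
  let _ : Algebra ℚ_[ℓ] E := ((algebraMap F E).comp (algebraMap ℚ_[ℓ] F)).toAlgebra
  have : IsScalarTower ℚ_[ℓ] F E := IsScalarTower.of_algebraMap_eq fun _ => rfl
  have : FiniteDimensional ℚ_[ℓ] E := FiniteDimensional.trans ℚ_[ℓ] F E
  have hdeg : Module.finrank ℚ_[ℓ] E ≤ Module.finrank ℚ_[ℓ] F * (n * n) := by
    rw [← Module.finrank_mul_finrank ℚ_[ℓ] F E]
    refine Nat.mul_le_mul_left _ ((IntermediateField.finrank_sup_le _ _).trans ?_)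
    rw [IntermediateField.adjoin.finrank ha, IntermediateField.adjoin.finrank hb]
    exact Nat.mul_le_mul hna hnb
  have haE : a ∈ E := (le_sup_left : F⟮a⟯ ≤ E) (IntermediateField.mem_adjoin_simple_self F a)
  have hbE : b ∈ E := (le_sup_right : F⟮b⟯ ≤ E) (IntermediateField.mem_adjoin_simple_self F b)
  let z : E := ⟨a / b, div_mem haE hbE⟩
  have hz : z ^ k = 1 := Subtype.ext <| by
    simp [z, div_pow, hab, div_self (pow_ne_zero k hb0)]
  have h1 := congrArg Subtype.val (Padic.pow_factorial_eq_one_of_finrank_le ℓ hdeg hk hz)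
  have h2 : (a / b) ^ (ℓ ^ (2 * (Module.finrank ℚ_[ℓ] F * (n * n)))).factorial = 1 := h1
  rwa [div_pow, div_eq_one_iff_eq (pow_ne_zero _ hb0)] at h2

section Diagonalization

variable {ι R : Type*} [Fintype ι] [DecidableEq ι]

theorem Matrix.units_mul_diagonal_mul_inv_pow [CommRing R] (u : (Matrix ι ι R)ˣ) (d : ι → R)
    (k : ℕ) :
    ((u : Matrix ι ι R) * Matrix.diagonal d * ((u⁻¹ : (Matrix ι ι R)ˣ) : Matrix ι ι R)) ^ k =
      u * Matrix.diagonal (fun i => d i ^ k) * ((u⁻¹ : (Matrix ι ι R)ˣ) : Matrix ι ι R) := by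
  rw [Units.conj_pow, Matrix.diagonal_pow]
  rfl

theorem Matrix.charpoly_units_mul_diagonal_mul_inv [CommRing R] (u : (Matrix ι ι R)ˣ)
    (d : ι → R) :
    ((u : Matrix ι ι R) * Matrix.diagonal d * ((u⁻¹ : (Matrix ι ι R)ˣ) : Matrix ι ι R)).charpoly =
      ∏ i, (Polynomial.X - Polynomial.C (d i)) := by
  rw [Matrix.coe_units_inv, Matrix.charpoly_units_conj, Matrix.charpoly_diagonal]

/-- The diagonal entries of a diagonalization of a matrix over an extension field have degree
at most the size of the matrix. -/
theorem Matrix.natDegree_minpoly_le_of_map_eq {K L : Type*} [Field K] [Field L] [Algebra K L]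
    {A : Matrix ι ι K} {u : (Matrix ι ι L)ˣ} {d : ι → L}
    (h : A.map (algebraMap K L) =
      (u : Matrix ι ι L) * Matrix.diagonal d * ((u⁻¹ : (Matrix ι ι L)ˣ) : Matrix ι ι L)) (i : ι) :
    IsIntegral K (d i) ∧ (minpoly K (d i)).natDegree ≤ Fintype.card ι := by
  have hroot : Polynomial.aeval (d i) A.charpoly = 0 := by
    rw [← Polynomial.eval_map_algebraMap, ← Matrix.charpoly_map, h,
      Matrix.charpoly_units_mul_diagonal_mul_inv, Polynomial.eval_prod]
    exact Finset.prod_eq_zero (Finset.mem_univ i) (by simp)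
  refine ⟨⟨A.charpoly, A.charpoly_monic, hroot⟩, ?_⟩
  rw [← A.charpoly_natDegree_eq_dim]
  exact Polynomial.natDegree_le_of_dvd (minpoly.dvd K _ hroot) A.charpoly_monic.ne_zero

end Diagonalization

theorem IsConj.exists_pow_of_zpow {G : Type*} [Group G] {a b : G} {k : ℤ} (hk : k ≠ 0)
    (h : IsConj (a ^ k) (b ^ k)) : ∃ j : ℕ, j ≠ 0 ∧ IsConj (a ^ j) (b ^ j) := by
  refine ⟨k.natAbs, Int.natAbs_ne_zero.mpr hk, ?_⟩
  rcases Int.natAbs_eq k with h' | h' <;> rw [h'] at h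
  · rwa [zpow_natCast, zpow_natCast] at h
  · obtain ⟨c, hc⟩ := isConj_iff.mp h
    refine isConj_iff.mpr ⟨c, inv_injective ?_⟩
    rw [zpow_neg, zpow_neg, zpow_natCast, zpow_natCast] at hc
    rw [← hc, mul_inv_rev, mul_inv_rev, inv_inv, mul_assoc]

/-- Let `F` be a finite extension of `ℚ_ℓ` and `n` a positive integer. There is a positive
integer `m`, depending only on `n` and `F`, such that for any two semisimple elements
`σ₁, σ₂` of `GL n F`: if `σ₁ ^ k` and `σ₂ ^ k` are conjugate for some non-zero integer `k`,
then `σ₁ ^ m` and `σ₂ ^ m` are conjugate. -/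
theorem exists_pow_isConj_of_isConj_pow (ℓ : ℕ) [Fact ℓ.Prime]
    (F : Type*) [Field F] [Algebra ℚ_[ℓ] F] [FiniteDimensional ℚ_[ℓ] F]
    (n : ℕ) (hn : 0 < n) :
    ∃ m : ℕ, 0 < m ∧ ∀ σ₁ σ₂ : GL (Fin n) F,
      σ₁.IsSemisimpleElt → σ₂.IsSemisimpleElt →
      (∃ k : ℤ, k ≠ 0 ∧ IsConj (σ₁ ^ k) (σ₂ ^ k)) →
      IsConj (σ₁ ^ m) (σ₂ ^ m) := by
  obtain ⟨d₀, hd₀⟩ : ∃ d₀ : ℕ, d₀ = Module.finrank ℚ_[ℓ] F * (n * n) := ⟨_, rfl⟩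
  refine ⟨(ℓ ^ (2 * d₀)).factorial, Nat.factorial_pos _, ?_⟩
  rintro σ₁ σ₂ ⟨u₁, d₁, h₁⟩ ⟨u₂, d₂, h₂⟩ ⟨k, hk, hconj⟩
  obtain ⟨j, hj, hconj⟩ := hconj.exists_pow_of_zpow hk
  have : CharZero F := charZero_of_injective_algebraMap (algebraMap ℚ_[ℓ] F).injective
  set φ := algebraMap F (AlgebraicClosure F)
  have hpow₁ (r : ℕ) : ((σ₁ : Matrix (Fin n) (Fin n) F) ^ r).map φ = _ :=
    (Matrix.map_pow _ φ r).trans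
      ((congrArg (· ^ r) h₁).trans (Matrix.units_mul_diagonal_mul_inv_pow u₁ d₁ r))
  have hpow₂ (r : ℕ) : ((σ₂ : Matrix (Fin n) (Fin n) F) ^ r).map φ = _ :=
    (Matrix.map_pow _ φ r).trans
      ((congrArg (· ^ r) h₂).trans (Matrix.units_mul_diagonal_mul_inv_pow u₂ d₂ r))
  have hchar : ((σ₁ : Matrix (Fin n) (Fin n) F) ^ j).charpoly =
      ((σ₂ : Matrix (Fin n) (Fin n) F) ^ j).charpoly := by
    obtain ⟨c, hc⟩ := isConj_iff.mp hconj
    have hc' := congrArg (Units.val) hc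
    simp only [Units.val_mul, Units.val_pow_eq_pow_val, Matrix.coe_units_inv] at hc'
    rw [← hc', Matrix.charpoly_units_conj]
  have hprod := congrArg (Polynomial.map φ) hchar
  rw [← Matrix.charpoly_map, ← Matrix.charpoly_map, hpow₁, hpow₂,
    Matrix.charpoly_units_mul_diagonal_mul_inv, Matrix.charpoly_units_mul_diagonal_mul_inv] at hprod
  have hroots := congrArg Polynomial.roots hprod
  have hroots_prod (d : Fin n → AlgebraicClosure F) :
      (∏ i, (Polynomial.X - Polynomial.C (d i))).roots = Finset.univ.val.map d := by
    rw [← Polynomial.roots_multiset_prod_X_sub_C (Finset.univ.val.map d), Multiset.map_map]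
    rfl
  rw [hroots_prod, hroots_prod] at hroots
  obtain ⟨π, hπ⟩ := exists_perm_of_multiset_map_eq hroots
  have hm (i : Fin n) : d₂ (π i) ^ (ℓ ^ (2 * d₀)).factorial = d₁ i ^ (ℓ ^ (2 * d₀)).factorial := by
    obtain ⟨hi₁, hn₁⟩ := Matrix.natDegree_minpoly_le_of_map_eq h₁ i
    obtain ⟨hi₂, hn₂⟩ := Matrix.natDegree_minpoly_le_of_map_eq h₂ (π i)
    rw [Fintype.card_fin] at hn₁ hn₂
    rw [hd₀]
    exact Padic.pow_eq_pow_of_natDegree_minpoly_le ℓ hi₂ hi₁ hn₂ hn₁ hj (hπ i)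
  generalize (ℓ ^ (2 * d₀)).factorial = m at hm ⊢
  let P : Matrix (Fin n) (Fin n) (AlgebraicClosure F) := π.permMatrix _
  have hP : P * Matrix.diagonal (fun i => d₂ i ^ m) = Matrix.diagonal (fun i => d₁ i ^ m) * P := by
    ext i k
    rw [Matrix.mul_diagonal, Matrix.diagonal_mul, ← hm]
    by_cases hik : π i = k <;> simp [P, Equiv.Perm.permMatrix, hik, mul_comm]
  have hPdet : P.det ≠ 0 := by
    rw [Matrix.det_permutation]
    rcases Int.units_eq_one_or (Equiv.Perm.sign π) with h | h <;> simp [h]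
  obtain ⟨V, hV, hVeq⟩ := Matrix.exists_mul_eq_mul_of_map
    (A := (σ₂ : Matrix (Fin n) (Fin n) F) ^ m) (B := (σ₁ : Matrix (Fin n) (Fin n) F) ^ m)
    (U := (u₁ : Matrix (Fin n) (Fin n) (AlgebraicClosure F)) * P *
      ((u₂⁻¹ : (Matrix (Fin n) (Fin n) (AlgebraicClosure F))ˣ) : Matrix _ _ _))
    (by
      rw [Matrix.det_mul, Matrix.det_mul]
      exact mul_ne_zero (mul_ne_zero ((Matrix.isUnit_iff_isUnit_det _).mp u₁.isUnit).ne_zero hPdet)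
        ((Matrix.isUnit_iff_isUnit_det _).mp (u₂⁻¹).isUnit).ne_zero)
    (by
      rw [hpow₁, hpow₂]
      simp only [mul_assoc, Units.inv_mul_cancel_left]
      rw [← mul_assoc P, hP, mul_assoc])
  refine IsConj.symm (isConj_iff.mpr ⟨Matrix.GeneralLinearGroup.mkOfDetNeZero V hV, ?_⟩)
  rw [mul_inv_eq_iff_eq_mul]
  exact Units.ext (by simpa using hVeq)
end

section
/- Let F be a field, E a field extension of F, and n a positive integer. Two elements of GL_n(F) are conjugate in GL_n(E) (after applying the inclusion GL_n(F) → GL_n(E) induced by F ⊆ E) if and only if they are conjugate in GL_n(F). -/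
section

open Polynomial Module

/-- A polynomial functional whose kernel contains an ideal of `K[X]` but no larger ideal. -/
theorem exists_dual_polynomial_mem_iff {K : Type*} [Field K] (I : Ideal K[X]) (hI : I ≠ ⊥) :
    ∃ l : Dual K K[X], ∀ p, p ∈ I ↔ ∀ q, l (q * p) = 0 := by
  classical
  obtain ⟨m, hm, rfl⟩ : ∃ m : K[X], m.Monic ∧ I = Ideal.span {m} := by
    obtain ⟨g, rfl⟩ := (IsPrincipalIdealRing.principal I).principal
    have hg : g ≠ 0 := by rintro rfl; simp at hI
    refine ⟨normalize g, Polynomial.monic_normalize hg, ?_⟩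
    exact (Ideal.span_singleton_eq_span_singleton.2 (normalize_associated g)).symm
  refine ⟨(lcoeff K (m.natDegree - 1)).comp (modByMonicHom m), fun p => ?_⟩
  rw [Ideal.mem_span_singleton]
  refine ⟨fun h q => ?_, fun h => ?_⟩
  · simp [modByMonicHom, (modByMonic_eq_zero_iff_dvd hm).2 (h.mul_left q)]
  · by_contra hp
    have hr : p %ₘ m ≠ 0 := fun h0 => hp ((modByMonic_eq_zero_iff_dvd hm).1 h0)
    have hdeg : (p %ₘ m).degree < m.degree := degree_modByMonic_lt p hm
    have hnat : (p %ₘ m).natDegree < m.natDegree := natDegree_lt_natDegree hr hdeg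
    set k := m.natDegree - 1 - (p %ₘ m).natDegree with hk
    have hX : (X ^ k * p) %ₘ m = X ^ k * (p %ₘ m) := by
      rw [modByMonic_eq_of_dvd_sub hm (p₂ := X ^ k * (p %ₘ m)), modByMonic_eq_self_iff hm]
      · apply degree_lt_degree
        rw [natDegree_X_pow_mul _ hr]
        omega
      · rw [← mul_sub]
        refine Dvd.dvd.mul_left ⟨p /ₘ m, ?_⟩ _
        rw [sub_eq_iff_eq_add', modByMonic_add_div]
    have h' := h (X ^ k)
    simp only [LinearMap.comp_apply, modByMonicHom, LinearMap.coe_mk, AddHom.coe_mk,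
      lcoeff_apply, hX] at h'
    rw [show m.natDegree - 1 = (p %ₘ m).natDegree + k by omega, coeff_X_pow_mul] at h'
    exact hr (leadingCoeff_eq_zero.1 h')

section

variable {K M : Type*} [Field K] [AddCommGroup M] [Module K M] [Module K[X] M]
  [IsScalarTower K K[X] M] [Module.Finite K M]

theorem mem_annihilator_iff_finrank_ker_lsmul (p : K[X]) :
    p ∈ annihilator K[X] M ↔ finrank K (Algebra.lsmul K K M p).ker = finrank K M := by
  rw [mem_annihilator]
  refine ⟨fun h => ?_, fun h x => ?_⟩
  · rw [show (Algebra.lsmul K K M p).ker = ⊤ from eq_top_iff.2 fun x _ => h x, finrank_top]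
  · have : x ∈ (Algebra.lsmul K K M p).ker := by
      rw [Submodule.eq_top_of_finrank_eq h]; trivial
    exact this

theorem annihilator_polynomial_ne_bot : annihilator K[X] M ≠ ⊥ := by
  intro h
  have hinj : Function.Injective (Algebra.lsmul K K M : K[X] →ₐ[K] End K M) := by
    rw [injective_iff_map_eq_zero]
    intro p hp
    rw [← Ideal.mem_bot, ← h, mem_annihilator]
    exact fun x => LinearMap.congr_fun hp x
  have := Module.Finite.of_injective (Algebra.lsmul K K M : K[X] →ₐ[K] End K M).toLinearMap hinj
  exact Polynomial.not_finite this

/-- An element whose annihilator is that of the whole module spans a direct summand. -/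
theorem exists_isCompl_span_singleton (x : M)
    (hx : (LinearMap.toSpanSingleton K[X] M x).ker = annihilator K[X] M) :
    ∃ W : Submodule K[X] M, IsCompl (K[X] ∙ x) W := by
  obtain ⟨l, hl⟩ := exists_dual_polynomial_mem_iff (annihilator K[X] M)
    annihilator_polynomial_ne_bot
  set f : K[X] →ₗ[K] M := (LinearMap.toSpanSingleton K[X] M x).restrictScalars K with hf
  have hker : ∀ p, p ∈ f.ker ↔ p ∈ annihilator K[X] M := fun p => by rw [← hx]; rfl
  obtain ⟨φ, hφ⟩ : l ∈ f.dualMap.range := by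
    rw [LinearMap.range_dualMap_eq_dualAnnihilator_ker, Submodule.mem_dualAnnihilator]
    intro p hp
    simpa using (hl p).1 ((hker p).1 hp) 1
  have hφ' : ∀ p, φ (p • x) = l p := fun p => LinearMap.congr_fun hφ p
  let ψ : M →ₗ[K] Dual K K[X] :=
    { toFun := fun y => φ ∘ₗ (LinearMap.toSpanSingleton K[X] M y).restrictScalars K
      map_add' := fun y z => by ext; simp
      map_smul' := fun c y => by ext; simp [smul_comm _ c] }
  have hψ : ∀ y p, ψ y p = φ (p • y) := fun _ _ => rfl
  let W : Submodule K[X] M :=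
    { carrier := {y | ψ y = 0}
      add_mem' := fun {a b} ha hb => by
        simp only [Set.mem_ofPred_eq] at *; rw [map_add, ha, hb, add_zero]
      zero_mem' := map_zero ψ
      smul_mem' := fun p y hy => LinearMap.ext fun q => by
        rw [hψ, smul_smul, ← hψ, show ψ y = 0 from hy]; rfl }
  have hW : ∀ y, y ∈ W ↔ ψ y = 0 := fun _ => Iff.rfl
  have hdis : ∀ y ∈ K[X] ∙ x, ψ y = 0 → y = 0 := by
    intro y hy h0
    obtain ⟨p, rfl⟩ := Submodule.mem_span_singleton.1 hy
    refine mem_annihilator.1 ((hl p).2 fun q => ?_) x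
    rw [← hφ', ← smul_smul, ← hψ, h0]; rfl
  have hle : ψ.range ≤ f.dualMap.range := by
    rintro _ ⟨y, rfl⟩
    rw [LinearMap.range_dualMap_eq_dualAnnihilator_ker, Submodule.mem_dualAnnihilator]
    intro p hp
    rw [hψ, mem_annihilator.1 ((hker p).1 hp) y, map_zero]
  have hS : f.range = (K[X] ∙ x).restrictScalars K := by
    rw [← LinearMap.range_toSpanSingleton]; rfl
  have hmap : ((K[X] ∙ x).restrictScalars K).map ψ = ψ.range := by
    apply Submodule.eq_of_le_of_finrank_le LinearMap.map_le_range
    have h1 : finrank K (((K[X] ∙ x).restrictScalars K).map ψ) =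
        finrank K ((K[X] ∙ x).restrictScalars K) := by
      rw [← LinearMap.range_domRestrict]
      apply LinearMap.finrank_range_of_inj
      rw [injective_iff_map_eq_zero]
      exact fun y hy => Subtype.ext (hdis y y.2 hy)
    have : FiniteDimensional K f.dualMap.range := by
      infer_instance
    rw [h1, ← hS, ← LinearMap.finrank_range_dualMap_eq_finrank_range f]
    exact Submodule.finrank_mono hle
  refine ⟨W, Submodule.disjoint_def.2 hdis, ?_⟩
  rw [codisjoint_iff, eq_top_iff]
  intro y _
  obtain ⟨s, hs, hsy⟩ : ψ y ∈ ((K[X] ∙ x).restrictScalars K).map ψ := hmap ▸ ⟨y, rfl⟩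
  rw [← add_sub_cancel s y]
  exact Submodule.add_mem_sup hs ((hW _).2 (by rw [map_sub, hsy, sub_self]))

end

theorem Matrix.rank_map_field {n F E : Type*} [Fintype n] [DecidableEq n] [Field F] [Field E]
    (f : F →+* E) (A : Matrix n n F) : (A.map f).rank = A.rank := by
  classical
  obtain ⟨L, L', D, hA⟩ := Matrix.Pivot.exists_list_transvec_mul_diagonal_mul_list_transvec A
  set P := (L.map Matrix.TransvectionStruct.toMatrix).prod with hP
  set Q := (L'.map Matrix.TransvectionStruct.toMatrix).prod with hQ
  have hPd : P.det = 1 := by simp [hP]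
  have hQd : Q.det = 1 := by simp [hQ]
  have hd : ∀ B : Matrix n n F, B.det = 1 → IsUnit (B.map f).det := fun B hB => by
    rw [← RingHom.mapMatrix_apply, ← RingHom.map_det, hB, map_one]; exact isUnit_one
  rw [hA, Matrix.map_mul, Matrix.map_mul, rank_mul_eq_left_of_isUnit_det _ _ (hd Q hQd),
    rank_mul_eq_right_of_isUnit_det _ _ (hd P hPd),
    rank_mul_eq_left_of_isUnit_det _ _ (hQd ▸ isUnit_one),
    rank_mul_eq_right_of_isUnit_det _ _ (hPd ▸ isUnit_one),
    Matrix.diagonal_map (map_zero f), rank_diagonal, rank_diagonal]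
  simp

theorem LinearEquiv.finrank_ker_lsmul_eq {K A M N : Type*} [Field K] [Ring A] [Algebra K A]
    [AddCommGroup M] [Module K M] [Module A M] [IsScalarTower K A M]
    [AddCommGroup N] [Module K N] [Module A N] [IsScalarTower K A N]
    (e : M ≃ₗ[A] N) (a : A) :
    finrank K (Algebra.lsmul K K M a).ker = finrank K (Algebra.lsmul K K N a).ker := by
  rw [← LinearEquiv.finrank_map_eq (e.restrictScalars K) (Algebra.lsmul K K M a).ker]
  suffices h : (Algebra.lsmul K K M a).ker.map (e.restrictScalars K).toLinearMap =
      (Algebra.lsmul K K N a).ker from congrArg (fun S : Submodule K N => finrank K S) h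
  ext y
  simp only [Submodule.mem_map, LinearMap.mem_ker, Algebra.lsmul_coe]
  constructor
  · rintro ⟨x, hx, rfl⟩
    change a • e x = 0
    rw [← map_smul, hx, map_zero]
  · intro hy
    refine ⟨e.symm y, ?_, e.apply_symm_apply y⟩
    rw [← map_smul, hy, map_zero]

theorem finrank_ker_lsmul_prod {K A M N : Type*} [Field K] [Ring A] [Algebra K A]
    [AddCommGroup M] [Module K M] [Module A M] [IsScalarTower K A M] [Module.Finite K M]
    [AddCommGroup N] [Module K N] [Module A N] [IsScalarTower K A N] [Module.Finite K N] (a : A) :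
    finrank K (Algebra.lsmul K K (M × N) a).ker =
      finrank K (Algebra.lsmul K K M a).ker + finrank K (Algebra.lsmul K K N a).ker := by
  have h : (Algebra.lsmul K K (M × N) a).ker =
      (Algebra.lsmul K K M a).ker.prod (Algebra.lsmul K K N a).ker := by
    ext ⟨x, y⟩
    simp [Submodule.mem_prod]
  rw [h, ← Module.finrank_prod]
  exact LinearEquiv.finrank_eq
    { Equiv.Set.prod _ _ with
      map_add' := fun _ _ => rfl
      map_smul' := fun _ _ => rfl }

/-- A finite-dimensional `K[X]`-module is determined by the dimensions of the kernels of all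
polynomials acting on it. -/
theorem nonempty_linearEquiv_of_finrank_ker_lsmul_eq {K : Type*} {M : Type*} {N : Type*} [Field K]
    [AddCommGroup M] [Module K M] [Module K[X] M] [IsScalarTower K K[X] M] [Module.Finite K M]
    [AddCommGroup N] [Module K N] [Module K[X] N] [IsScalarTower K K[X] N] [Module.Finite K N]
    (h : ∀ p : K[X], finrank K (Algebra.lsmul K K M p).ker =
      finrank K (Algebra.lsmul K K N p).ker) :
    Nonempty (M ≃ₗ[K[X]] N) := by
  induction hn : finrank K M using Nat.strong_induction_on generalizing M N with
  | _ n ih =>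
  subst hn
  have hdim : finrank K M = finrank K N := by
    rw [← (mem_annihilator_iff_finrank_ker_lsmul (M := M) 0).1 (zero_mem _),
      ← (mem_annihilator_iff_finrank_ker_lsmul (M := N) 0).1 (zero_mem _), h]
  have hann : annihilator K[X] M = annihilator K[X] N := by
    ext p
    rw [mem_annihilator_iff_finrank_ker_lsmul, mem_annihilator_iff_finrank_ker_lsmul, h, hdim]
  rcases subsingleton_or_nontrivial M with hM | hM
  · have : Subsingleton N := finrank_zero_iff.1 (hdim ▸ finrank_zero_of_subsingleton)
    exact ⟨0⟩
  have : Module.Finite K[X] M := Module.Finite.of_restrictScalars_finite K _ _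
  have : Module.Finite K[X] N := Module.Finite.of_restrictScalars_finite K _ _
  obtain ⟨x, hx⟩ := exists_ker_toSpanSingleton_eq_annihilator (R := K[X]) (M := M)
  obtain ⟨y, hy⟩ := exists_ker_toSpanSingleton_eq_annihilator (R := K[X]) (M := N)
  obtain ⟨V, hV⟩ := exists_isCompl_span_singleton x hx
  obtain ⟨W, hW⟩ := exists_isCompl_span_singleton y hy
  have : Module.Finite K (K[X] ∙ x) :=
    inferInstanceAs (Module.Finite K ((K[X] ∙ x).restrictScalars K))
  have : Module.Finite K (K[X] ∙ y) :=
    inferInstanceAs (Module.Finite K ((K[X] ∙ y).restrictScalars K))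
  have : Module.Finite K V := inferInstanceAs (Module.Finite K (V.restrictScalars K))
  have : Module.Finite K W := inferInstanceAs (Module.Finite K (W.restrictScalars K))
  let e : (K[X] ∙ x) ≃ₗ[K[X]] (K[X] ∙ y) :=
    (LinearEquiv.ofEq _ _ (LinearMap.range_toSpanSingleton x)).symm ≪≫ₗ
      (LinearMap.toSpanSingleton K[X] M x).quotKerEquivRange.symm ≪≫ₗ
      Submodule.quotEquivOfEq _ _ (hx.trans (hann.trans hy.symm)) ≪≫ₗ
      (LinearMap.toSpanSingleton K[X] N y).quotKerEquivRange ≪≫ₗ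
      LinearEquiv.ofEq _ _ (LinearMap.range_toSpanSingleton y)
  have hx0 : x ≠ 0 := by
    rintro rfl
    have h1 : (1 : K[X]) ∈ annihilator K[X] M := by rw [← hx]; simp
    obtain ⟨z, hz⟩ := exists_ne (0 : M)
    exact hz (by simpa using mem_annihilator.1 h1 z)
  have hlt : finrank K V < finrank K M := by
    have h1 := ((Submodule.prodEquivOfIsCompl _ _ hV).restrictScalars K).finrank_eq
    rw [finrank_prod] at h1
    have : Nontrivial (K[X] ∙ x) :=
      ⟨⟨x, Submodule.mem_span_singleton_self x⟩, 0, fun h0 => hx0 (congrArg Subtype.val h0)⟩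
    have := finrank_pos (R := K) (M := (K[X] ∙ x))
    omega
  obtain ⟨e'⟩ := ih _ hlt (M := V) (N := W) (fun p => by
    have h1 := h p
    rw [← (Submodule.prodEquivOfIsCompl _ _ hV).finrank_ker_lsmul_eq,
      ← (Submodule.prodEquivOfIsCompl _ _ hW).finrank_ker_lsmul_eq, finrank_ker_lsmul_prod,
      finrank_ker_lsmul_prod, e.finrank_ker_lsmul_eq] at h1
    exact Nat.add_left_cancel h1) rfl
  exact ⟨(Submodule.prodEquivOfIsCompl _ _ hV).symm ≪≫ₗ e.prodCongr e' ≪≫ₗ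
    Submodule.prodEquivOfIsCompl _ _ hW⟩

theorem Matrix.finrank_ker_lsmul_aeval {n F : Type*} [Fintype n] [DecidableEq n] [Field F]
    (A : Matrix n n F) (p : F[X]) :
    finrank F (Algebra.lsmul F F (AEval' (Matrix.toLin' A)) p).ker =
      Fintype.card n - (aeval A p).rank := by
  have h1 := LinearMap.finrank_range_add_finrank_ker (Matrix.toLin' (aeval A p))
  have h2 : (Algebra.lsmul F F (AEval' (Matrix.toLin' A)) p).ker =
      (Matrix.toLin' (aeval A p)).ker.map (AEval'.of (Matrix.toLin' A)).toLinearMap := by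
    ext y
    obtain ⟨x, rfl⟩ := (AEval'.of (Matrix.toLin' A)).surjective y
    simp only [LinearMap.mem_ker, Algebra.lsmul_coe, ← AEval.of_aeval_smul]
    rw [Submodule.mem_map_equiv]
    have : aeval (Matrix.toLin' A) p = Matrix.toLin' (aeval A p) :=
      aeval_algHom_apply (Matrix.toLinAlgEquiv' : Matrix n n F ≃ₐ[F] _).toAlgHom A p
    simp [this]
  rw [h2, LinearEquiv.finrank_map_eq]
  rw [Module.finrank_fintype_fun_eq_card] at h1
  rw [Matrix.rank, ← Matrix.toLin'_apply']
  omega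

theorem Matrix.isConj_of_rank_aeval_eq {n F : Type*} [Fintype n] [DecidableEq n] [Field F]
    (g h : GL n F)
    (H : ∀ p : F[X], (aeval (g : Matrix n n F) p).rank = (aeval (h : Matrix n n F) p).rank) :
    IsConj g h := by
  obtain ⟨e⟩ := nonempty_linearEquiv_of_finrank_ker_lsmul_eq (K := F)
    (M := AEval' (Matrix.toLin' (g : Matrix n n F)))
    (N := AEval' (Matrix.toLin' (h : Matrix n n F))) (fun p => by
      rw [Matrix.finrank_ker_lsmul_aeval, Matrix.finrank_ker_lsmul_aeval, H])
  let u : (n → F) ≃ₗ[F] (n → F) := AEval'.of (Matrix.toLin' (g : Matrix n n F)) ≪≫ₗ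
    e.restrictScalars F ≪≫ₗ (AEval'.of (Matrix.toLin' (h : Matrix n n F))).symm
  have hu : ∀ v, u (Matrix.toLin' (g : Matrix n n F) v) =
      Matrix.toLin' (h : Matrix n n F) (u v) := fun v => by
    apply (AEval'.of (Matrix.toLin' (h : Matrix n n F))).injective
    rw [← AEval'.X_smul_of]
    simp only [u, LinearEquiv.trans_apply, LinearEquiv.apply_symm_apply, ← AEval'.X_smul_of]
    exact e.map_smul X _
  let c : GL n F := ⟨LinearMap.toMatrix' u, LinearMap.toMatrix' u.symm,
    by rw [← LinearMap.toMatrix'_comp]; simp, by rw [← LinearMap.toMatrix'_comp]; simp⟩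
  refine isConj_iff.2 ⟨c, mul_inv_eq_iff_eq_mul.2 (Units.ext ?_)⟩
  apply Matrix.toLin'.injective
  refine LinearMap.ext fun v => ?_
  simpa [c, Matrix.toLin'_mul] using hu v

theorem SemiconjBy.polynomial_aeval {R A : Type*} [CommSemiring R] [Semiring A] [Algebra R A]
    {c a b : A} (h : SemiconjBy c a b) (p : R[X]) : SemiconjBy c (aeval a p) (aeval b p) := by
  induction p using Polynomial.induction_on' with
  | add p q hp hq => simpa using hp.add_right hq
  | monomial k r =>
    rw [aeval_monomial, aeval_monomial]
    exact SemiconjBy.mul_right (Algebra.commutes r c).symm (h.pow_right k)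

theorem Matrix.rank_aeval_eq_of_isConj_map {n F E : Type*} [Fintype n] [DecidableEq n] [Field F]
    [Field E] [Algebra F E] (g h : GL n F)
    (H : IsConj (Units.map ((algebraMap F E).mapMatrix.toMonoidHom) g)
      (Units.map ((algebraMap F E).mapMatrix.toMonoidHom) h)) (p : F[X]) :
    (aeval (g : Matrix n n F) p).rank = (aeval (h : Matrix n n F) p).rank := by
  obtain ⟨c, hc⟩ := isConj_iff.1 H
  have hmap : ∀ A : Matrix n n F, (aeval A p).map (algebraMap F E) =
      aeval (A.map (algebraMap F E)) p := fun A =>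
    (aeval_algHom_apply (Algebra.ofId F E).mapMatrix A p).symm
  have hs : SemiconjBy (c : Matrix n n E) ((g : Matrix n n F).map (algebraMap F E))
      ((h : Matrix n n F).map (algebraMap F E)) :=
    congrArg Units.val (mul_inv_eq_iff_eq_mul.1 hc)
  have hp := hs.polynomial_aeval p
  have hcd := (Matrix.isUnit_iff_isUnit_det _).1 c.isUnit
  rw [← Matrix.rank_map_field (algebraMap F E), ← Matrix.rank_map_field (algebraMap F E)
      (aeval _ p), hmap, hmap, ← Matrix.rank_mul_eq_right_of_isUnit_det _ _ hcd, hp.eq,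
    Matrix.rank_mul_eq_left_of_isUnit_det _ _ hcd]

end

/-- Two elements of `GL n F` are conjugate in `GL n E`, for a field extension `E / F`,
if and only if they are conjugate in `GL n F`. -/
theorem isConj_map_iff_isConj (F E : Type*) [Field F] [Field E] [Algebra F E]
    (n : ℕ) (g h : GL (Fin n) F) :
    IsConj (Units.map ((algebraMap F E).mapMatrix.toMonoidHom) g)
        (Units.map ((algebraMap F E).mapMatrix.toMonoidHom) h) ↔
      IsConj g h := by
  exact ⟨fun H => Matrix.isConj_of_rank_aeval_eq g h (Matrix.rank_aeval_eq_of_isConj_map g h H),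
    MonoidHom.map_isConj _⟩
end

section
/- Let K be a number field and L/K a Galois extension of number fields of degree d. Suppose T is a set of finite places (nonzero prime ideals of the ring of integers) of K whose upper density δ satisfies δ > 1 − 1/d. Then the set T' of finite places of L lying above some place in T has positive upper density; more precisely, the upper density of T' is at least d·(δ − (1 − 1/d)) > 0. -/
open NumberField Filter

/-- A finite place of a number field `K`: a nonzero prime ideal of its ring of integers. -/
def FinitePlaceIdeal (K : Type*) [Field K] [NumberField K] : Type _ :=
  {p : Ideal (𝓞 K) // p.IsPrime ∧ p ≠ ⊥}

/-- The number of finite places in a set `S` of finite places of `K` of norm at most `x`. -/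
noncomputable def placesCount (K : Type*) [Field K] [NumberField K]
    (S : Set (FinitePlaceIdeal K)) (x : ℕ) : ℕ :=
  Nat.card {p : FinitePlaceIdeal K // p ∈ S ∧ Ideal.absNorm p.1 ≤ x}

/-- The upper density of a set `S` of finite places of a number field `K`:
`limsup_{x → ∞} #{𝔭 ∈ S : N𝔭 ≤ x} / #{𝔭 : N𝔭 ≤ x}`. -/
noncomputable def upperDensity (K : Type*) [Field K] [NumberField K]
    (S : Set (FinitePlaceIdeal K)) : ℝ :=
  limsup (fun x : ℕ =>
    (placesCount K S x : ℝ) / (placesCount K Set.univ x : ℝ)) atTop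

section

open Filter Topology MeasureTheory Set

/-- The Fejér kernel, as the Fourier transform of the triangle function on `[-1, 1]`. -/
noncomputable def fejer (v : ℝ) : ℝ := 2 * (1 - Real.cos v) / v ^ 2

theorem fejer_nonneg (v : ℝ) : 0 ≤ fejer v :=
  div_nonneg (by linarith [Real.cos_le_one v]) (sq_nonneg v)

theorem fejer_le (v : ℝ) : fejer v ≤ 5 * (1 + v ^ 2)⁻¹ := by
  unfold fejer
  rcases eq_or_ne v 0 with rfl | hv
  · norm_num
  · have h0 : 0 < v ^ 2 := by positivity
    rw [← div_eq_mul_inv, div_le_div_iff₀ h0 (by positivity)]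
    nlinarith [Real.one_sub_sq_div_two_le_cos (x := v), Real.neg_one_le_cos v]

theorem measurable_fejer : Measurable fejer := by
  unfold fejer
  fun_prop

theorem integrable_fejer : Integrable fejer := by
  refine (integrable_inv_one_add_sq.const_mul 5).mono' measurable_fejer.aestronglyMeasurable ?_
  filter_upwards with v
  rw [Real.norm_of_nonneg (fejer_nonneg v)]
  exact fejer_le v

theorem integral_fejer_interval_pos {δ : ℝ} (hδ : 0 < δ) : 0 < ∫ v in (-δ)..δ, fejer v := by
  have h1 : 0 < ∫ v in (0 : ℝ)..(min δ 1), fejer v := by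
    refine intervalIntegral.intervalIntegral_pos_of_pos_on integrable_fejer.intervalIntegrable
      (fun v hv => ?_) (by positivity)
    have hv1 : v < 1 := lt_of_lt_of_le hv.2 (min_le_right _ _)
    have : Real.cos v < 1 := by
      rw [← Real.cos_zero]
      exact Real.cos_lt_cos_of_nonneg_of_le_pi le_rfl (by linarith [Real.pi_gt_three]) hv.1
    exact div_pos (by linarith) (pow_pos hv.1 2)
  refine h1.trans_le (intervalIntegral.integral_mono_interval (by linarith) (by positivity)
    (min_le_left _ _) (ae_of_all _ fejer_nonneg) integrable_fejer.intervalIntegrable)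

theorem integral_fejer_interval_le (δ : ℝ) (hδ : 0 ≤ δ) :
    ∫ v in (-δ)..δ, fejer v ≤ ∫ v, fejer v := by
  rw [intervalIntegral.integral_of_le (by linarith)]
  exact setIntegral_le_integral integrable_fejer (ae_of_all _ fejer_nonneg)

theorem integral_fejer_pos : 0 < ∫ v, fejer v :=
  (integral_fejer_interval_pos one_pos).trans_le (integral_fejer_interval_le 1 zero_le_one)

theorem integral_one_sub_mul_cexp {z : ℂ} (hz : z ≠ 0) :
    ∫ τ in (0 : ℝ)..1, (1 - τ : ℂ) * Complex.exp (z * τ) =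
      (Complex.exp z - 1 - z) / z ^ 2 := by
  have hd : ∀ τ ∈ uIcc (0 : ℝ) 1, HasDerivAt
      (fun τ : ℝ => (1 - τ : ℂ) * (Complex.exp (z * τ) / z) + Complex.exp (z * τ) / z ^ 2)
      ((1 - τ : ℂ) * Complex.exp (z * τ)) τ := by
    intro τ _
    have h1 : HasDerivAt (fun τ : ℝ => (τ : ℂ)) 1 τ := Complex.ofRealCLM.hasDerivAt
    have h2 : HasDerivAt (fun τ : ℝ => Complex.exp (z * τ)) (Complex.exp (z * τ) * (z * 1)) τ :=
      (h1.const_mul z).cexp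
    convert! ((h1.const_sub 1).mul (h2.div_const z)).add (h2.div_const (z ^ 2)) using 1
    field_simp
    ring
  rw [intervalIntegral.integral_eq_sub_of_hasDerivAt hd
    (Continuous.intervalIntegrable (by fun_prop) _ _)]
  simp
  field_simp
  ring

theorem integral_triangle_mul_cexp {v : ℝ} (hv : v ≠ 0) :
    ∫ τ in (-1 : ℝ)..1, ((1 - |τ| : ℝ) : ℂ) * Complex.exp (v * Complex.I * τ) = fejer v := by
  have hz : (v * Complex.I : ℂ) ≠ 0 := by simp [hv]
  have hc : Continuous fun τ : ℝ =>
    ((1 - |τ| : ℝ) : ℂ) * Complex.exp (v * Complex.I * τ) := by fun_prop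
  rw [← intervalIntegral.integral_add_adjacent_intervals (b := 0) (hc.intervalIntegrable _ _)
    (hc.intervalIntegrable _ _)]
  have h1 : ∫ τ in (0 : ℝ)..1, ((1 - |τ| : ℝ) : ℂ) * Complex.exp (v * Complex.I * τ) =
      ∫ τ in (0 : ℝ)..1, (1 - τ : ℂ) * Complex.exp ((v * Complex.I) * τ) := by
    refine intervalIntegral.integral_congr fun τ hτ => ?_
    rw [uIcc_of_le zero_le_one] at hτ
    simp only [abs_of_nonneg hτ.1]
    push_cast
    ring
  have h2 : ∫ τ in (-1 : ℝ)..0, ((1 - |τ| : ℝ) : ℂ) * Complex.exp (v * Complex.I * τ) =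
      ∫ τ in (0 : ℝ)..1, (1 - τ : ℂ) * Complex.exp ((-(v * Complex.I)) * τ) := by
    rw [← neg_zero, ← intervalIntegral.integral_comp_neg]
    simp only [neg_zero]
    refine intervalIntegral.integral_congr fun τ hτ => ?_
    rw [uIcc_of_le zero_le_one] at hτ
    simp only [abs_neg, abs_of_nonneg hτ.1]
    push_cast
    ring_nf
  rw [h1, h2, integral_one_sub_mul_cexp hz, integral_one_sub_mul_cexp (neg_ne_zero.mpr hz)]
  have h3 : Complex.exp (v * Complex.I) + Complex.exp (-(v * Complex.I)) = 2 * Complex.cos v := by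
    rw [Complex.cos]; ring_nf
  unfold fejer
  push_cast
  have hv' : (v : ℂ) ≠ 0 := by simpa using hv
  have h4 : (v * Complex.I : ℂ) ^ 2 = - v ^ 2 := by rw [mul_pow, Complex.I_sq]; ring
  rw [neg_sq, h4, ← add_div, div_neg, ← neg_div]
  congr 1
  linear_combination (-1 : ℂ) * h3

end

section

open Filter Topology MeasureTheory Set

theorem integrable_fejer_comp {l : ℝ} (hl : 0 < l) (y : ℝ) :
    Integrable fun u => fejer (l * (y - u)) :=
  (integrable_fejer.comp_mul_left' hl.ne').comp_sub_left y

theorem integral_fejer_comp {l : ℝ} (hl : 0 < l) (y : ℝ) :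
    ∫ u, fejer (l * (y - u)) = l⁻¹ * ∫ v, fejer v := by
  rw [integral_sub_left_eq_self (fun v => fejer (l * v)) volume y,
    Measure.integral_comp_mul_left, abs_of_pos (inv_pos.mpr hl), smul_eq_mul]

theorem integral_fejer_comp_interval {l : ℝ} (hl : 0 < l) (y δ : ℝ) :
    ∫ u in y..(y + 2 * δ), fejer (l * (y + δ - u)) = l⁻¹ * ∫ v in (-(l * δ))..(l * δ), fejer v := by
  rw [intervalIntegral.integral_comp_sub_left (fun v => fejer (l * v)),
    intervalIntegral.integral_comp_mul_left _ hl.ne', smul_eq_mul]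
  congr 2 <;> ring

variable {B : ℝ → ℝ} {G : ℂ → ℂ}

/-- Pairing the Laplace transform with a triangle function yields a Fejér mean. -/
theorem integral_laplace_mul_triangle (hBm : Measurable B)
    (hBi : ∀ ε > 0, IntegrableOn (fun u => B u * Real.exp (-ε * u)) (Ioi 0))
    (hGe : ∀ z : ℂ, 0 < z.re →
      G z = ∫ u in Ioi (0 : ℝ), ((B u - 1 : ℝ) : ℂ) * Complex.exp (-z * u))
    {ε l : ℝ} (hε : 0 < ε) (hl : 0 < l) (y : ℝ) :
    ∫ τ in (-1 : ℝ)..1, G (ε + l * τ * Complex.I) *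
        (((1 - |τ| : ℝ) : ℂ) * Complex.exp (l * τ * y * Complex.I)) =
      ((∫ u in Ioi (0 : ℝ), (B u - 1) * Real.exp (-ε * u) * fejer (l * (y - u)) : ℝ) : ℂ) := by
  have hh : IntegrableOn (fun u => (B u - 1) * Real.exp (-ε * u)) (Ioi 0) := by
    simp_rw [sub_mul, one_mul]
    exact (hBi ε hε).sub (integrableOn_exp_mul_Ioi (neg_lt_zero.mpr hε) 0)
  have h1 : ∀ τ : ℝ, G (ε + l * τ * Complex.I) *
      (((1 - |τ| : ℝ) : ℂ) * Complex.exp (l * τ * y * Complex.I)) =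
      ∫ u in Ioi (0 : ℝ), (((B u - 1) * Real.exp (-ε * u) : ℝ) : ℂ) *
        (((1 - |τ| : ℝ) : ℂ) * Complex.exp ((l * (y - u) : ℝ) * Complex.I * τ)) := by
    intro τ
    rw [hGe _ (by simpa using hε), ← integral_mul_const]
    congr 1
    ext u
    have : Complex.exp (-(ε + l * τ * Complex.I) * u) * Complex.exp (l * τ * y * Complex.I) =
        Complex.exp ((-ε * u : ℝ) : ℂ) * Complex.exp ((l * (y - u) : ℝ) * Complex.I * τ) := by
      rw [← Complex.exp_add, ← Complex.exp_add]
      congr 1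
      push_cast
      ring
    push_cast at this ⊢
    linear_combination ((B u : ℂ) - 1) * (1 - ((|τ| : ℝ) : ℂ)) * this
  simp_rw [h1]
  rw [intervalIntegral.integral_of_le (by norm_num), integral_integral_swap, ← integral_complex_ofReal]
  · refine integral_congr_ae ?_
    have hne : ∀ᵐ u ∂(volume.restrict (Ioi (0 : ℝ))), u ≠ y :=
      ae_restrict_of_ae (Measure.ae_ne volume y)
    filter_upwards [hne] with u hu
    rw [integral_const_mul, ← intervalIntegral.integral_of_le (by norm_num),
      integral_triangle_mul_cexp (mul_ne_zero hl.ne' (sub_ne_zero.mpr hu.symm))]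
    push_cast
    ring
  · have hT : IntegrableOn (fun τ : ℝ => (1 : ℝ)) (Ioc (-1) 1) := by
      rw [integrableOn_const_iff]; simp
    have hp := hT.integrable.mul_prod hh.integrable
    refine hp.mono ?_ ?_
    · refine Measurable.aestronglyMeasurable ?_
      unfold Function.uncurry
      fun_prop
    · have : ∀ᵐ p ∂((volume.restrict (Ioc (-1 : ℝ) 1)).prod (volume.restrict (Ioi (0 : ℝ)))),
          p ∈ Ioc (-1 : ℝ) 1 ×ˢ Ioi (0 : ℝ) := by
        rw [Measure.prod_restrict]
        exact ae_restrict_mem (measurableSet_Ioc.prod measurableSet_Ioi)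
      filter_upwards [this] with p hp
      obtain ⟨⟨h1, h2⟩, -⟩ := hp
      have habs : |p.1| ≤ 1 := abs_le.mpr ⟨h1.le, h2⟩
      simp only [Function.uncurry, norm_mul, Complex.norm_real, one_mul]
      have e1 : ‖Complex.exp ((l * (y - p.2) : ℝ) * Complex.I * p.1)‖ = 1 := by
        rw [show ((l * (y - p.2) : ℝ) * Complex.I * p.1 : ℂ) =
          ((l * (y - p.2) * p.1 : ℝ) : ℂ) * Complex.I by push_cast; ring]
        exact Complex.norm_exp_ofReal_mul_I _
      rw [e1]
      have e2 : ‖1 - |p.1|‖ ≤ 1 := by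
        rw [Real.norm_of_nonneg (by linarith)]
        linarith [abs_nonneg p.1]
      have : 0 ≤ ‖B p.2 - 1‖ * ‖Real.exp (-ε * p.2)‖ := by positivity
      have e3 : ‖(1 : ℝ)‖ = 1 := by simp
      nlinarith

/-- A Fejér mean centred just to the right of `y` dominates the value at `y`. -/
theorem le_integral_mul_fejer (hB0 : ∀ u, 0 ≤ B u)
    (hmono : ∀ u v, 0 ≤ u → u ≤ v → B u * Real.exp u ≤ B v * Real.exp v)
    {ε l y δ : ℝ} (hε : 0 ≤ ε) (hl : 0 < l) (hy : 0 ≤ y) (hδ : 0 < δ)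
    (hi : IntegrableOn (fun u => B u * Real.exp (-ε * u) * fejer (l * (y + δ - u))) (Ioi 0)) :
    B y * Real.exp (-(2 * δ)) * Real.exp (-ε * (y + 2 * δ)) *
        (l⁻¹ * ∫ v in (-(l * δ))..(l * δ), fejer v) ≤
      ∫ u in Ioi (0 : ℝ), B u * Real.exp (-ε * u) * fejer (l * (y + δ - u)) := by
  have hsub : Ioc y (y + 2 * δ) ⊆ Ioi (0 : ℝ) := fun u hu => lt_of_le_of_lt hy hu.1
  rw [← integral_fejer_comp_interval hl y δ, ← intervalIntegral.integral_const_mul,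
    intervalIntegral.integral_of_le (by linarith)]
  refine le_trans ?_ (setIntegral_mono_set hi (ae_of_all _ fun u =>
    mul_nonneg (mul_nonneg (hB0 u) (Real.exp_nonneg _)) (fejer_nonneg _)) hsub.eventuallyLE)
  refine setIntegral_mono_on ((integrable_fejer_comp hl _).const_mul _).integrableOn
    (hi.mono_set hsub) measurableSet_Ioc fun u hu => ?_
  refine mul_le_mul_of_nonneg_right ?_ (fejer_nonneg _)
  refine mul_le_mul ?_ ?_ (Real.exp_nonneg _) (hB0 _)
  · have h1 := hmono y u hy hu.1.le
    have h2 : B u = B u * Real.exp u * Real.exp (-u) := by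
      rw [mul_assoc, ← Real.exp_add]; simp
    rw [h2]
    calc B y * Real.exp (-(2 * δ)) ≤ B y * Real.exp (y - u) :=
          mul_le_mul_of_nonneg_left (Real.exp_le_exp.mpr (by linarith [hu.2])) (hB0 y)
      _ = B y * Real.exp y * Real.exp (-u) := by
          rw [mul_assoc, ← Real.exp_add, sub_eq_add_neg]
      _ ≤ _ := mul_le_mul_of_nonneg_right h1 (Real.exp_nonneg _)
  · exact Real.exp_le_exp.mpr (by nlinarith [hu.2])

theorem exists_bound_on_segment (hG : ContinuousOn G {z | 0 ≤ z.re}) (l : ℝ) :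
    ∃ C, ∀ ε ∈ Icc (0 : ℝ) 1, ∀ τ ∈ Icc (-1 : ℝ) 1, ‖G (ε + l * τ * Complex.I)‖ ≤ C := by
  have hK : IsCompact ((fun p : ℝ × ℝ => (p.1 + l * p.2 * Complex.I : ℂ)) ''
      (Icc (0 : ℝ) 1 ×ˢ Icc (-1 : ℝ) 1)) :=
    (isCompact_Icc.prod isCompact_Icc).image (by fun_prop)
  obtain ⟨C, hC⟩ := hK.exists_bound_of_continuousOn (hG.mono (by
    rintro _ ⟨p, hp, rfl⟩
    simpa using hp.1.1))
  exact ⟨C, fun ε hε τ hτ => hC _ ⟨(ε, τ), ⟨hε, hτ⟩, rfl⟩⟩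

theorem norm_triangle_mul_cexp_le {l τ y : ℝ} (hτ : τ ∈ Icc (-1 : ℝ) 1) :
    ‖((1 - |τ| : ℝ) : ℂ) * Complex.exp (l * τ * y * Complex.I)‖ ≤ 1 := by
  have e1 : ‖Complex.exp (l * τ * y * Complex.I)‖ = 1 := by
    rw [show (l * τ * y * Complex.I : ℂ) = ((l * τ * y : ℝ) : ℂ) * Complex.I by push_cast; ring]
    exact Complex.norm_exp_ofReal_mul_I _
  have habs : |τ| ≤ 1 := abs_le.mpr ⟨hτ.1, hτ.2⟩
  rw [norm_mul, e1, mul_one, Complex.norm_real, Real.norm_of_nonneg (by linarith)]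
  linarith [abs_nonneg τ]

theorem exists_bound_of_laplace (hBm : Measurable B) (hB0 : ∀ u, 0 ≤ B u)
    (hmono : ∀ u v, 0 ≤ u → u ≤ v → B u * Real.exp u ≤ B v * Real.exp v)
    (hBi : ∀ ε > 0, IntegrableOn (fun u => B u * Real.exp (-ε * u)) (Ioi 0))
    (hG : ContinuousOn G {z | 0 ≤ z.re})
    (hGe : ∀ z : ℂ, 0 < z.re →
      G z = ∫ u in Ioi (0 : ℝ), ((B u - 1 : ℝ) : ℂ) * Complex.exp (-z * u)) :
    ∃ M, ∀ u, 0 ≤ u → B u ≤ M := by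
  obtain ⟨C, hC⟩ := exists_bound_on_segment hG 1
  set c := ∫ v, fejer v
  set w := ∫ v in (-(1 * (1 / 2)) : ℝ)..(1 * (1 / 2)), fejer v with hw
  have hw0 : 0 < w := integral_fejer_interval_pos (by norm_num)
  have key : ∀ y : ℝ, 0 ≤ y → ∀ ε ∈ Ioc (0 : ℝ) 1,
      B y * Real.exp (-(2 * (1 / 2))) * Real.exp (-ε * (y + 2 * (1 / 2))) * (1⁻¹ * w) ≤
        C * 2 + c := by
    intro y hy ε hε
    have hfb : ∀ v, fejer v ≤ 5 := fun v => (fejer_le v).trans (by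
      have : (1 + v ^ 2)⁻¹ ≤ 1 := inv_le_one_of_one_le₀ (by nlinarith)
      linarith)
    have hbd : ∀ᵐ u ∂(volume.restrict (Ioi (0:ℝ))), ‖fejer (1 * (y + 1 / 2 - u))‖ ≤ 5 :=
      ae_of_all _ fun u => by
        rw [Real.norm_of_nonneg (fejer_nonneg _)]; exact hfb _
    have hms : AEStronglyMeasurable (fun u => fejer (1 * (y + 1 / 2 - u)))
        (volume.restrict (Ioi (0:ℝ))) :=
      (measurable_fejer.comp (by fun_prop)).aestronglyMeasurable
    have hi : IntegrableOn (fun u => B u * Real.exp (-ε * u) * fejer (1 * (y + 1 / 2 - u)))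
        (Ioi 0) := (hBi ε hε.1).integrable.mul_bdd hms hbd
    have hi2 : IntegrableOn (fun u => Real.exp (-ε * u) * fejer (1 * (y + 1 / 2 - u)))
        (Ioi 0) :=
      (integrableOn_exp_mul_Ioi (neg_lt_zero.mpr hε.1) 0).integrable.mul_bdd hms hbd
    refine (le_integral_mul_fejer hB0 hmono hε.1.le one_pos hy (by norm_num : (0:ℝ) < 1 / 2)
      hi).trans ?_
    have hid := integral_laplace_mul_triangle hBm hBi hGe hε.1 one_pos (y + 1 / 2)
    have hn : ‖∫ τ in (-1 : ℝ)..1, G (ε + (1:ℝ) * τ * Complex.I) *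
        (((1 - |τ| : ℝ) : ℂ) * Complex.exp ((1:ℝ) * τ * (y + 1 / 2 : ℝ) * Complex.I))‖ ≤
        C * |1 - (-1)| := by
      refine intervalIntegral.norm_integral_le_of_norm_le_const fun τ hτ => ?_
      rw [uIoc_of_le (by norm_num)] at hτ
      have hτ' : τ ∈ Icc (-1 : ℝ) 1 := ⟨hτ.1.le, hτ.2⟩
      rw [norm_mul]
      have := hC ε ⟨hε.1.le, hε.2⟩ τ hτ'
      exact (mul_le_of_le_one_right (norm_nonneg _) (norm_triangle_mul_cexp_le hτ')).trans this
    rw [hid, Complex.norm_real] at hn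
    have h3 := (Real.le_norm_self _).trans hn
    have h4 : ∫ u in Ioi (0 : ℝ), (B u - 1) * Real.exp (-ε * u) * fejer (1 * (y + 1 / 2 - u)) =
        (∫ u in Ioi (0 : ℝ), B u * Real.exp (-ε * u) * fejer (1 * (y + 1 / 2 - u))) -
        ∫ u in Ioi (0 : ℝ), Real.exp (-ε * u) * fejer (1 * (y + 1 / 2 - u)) := by
      rw [← integral_sub hi hi2]
      congr 1; ext u; ring
    have h5 : ∫ u in Ioi (0 : ℝ), Real.exp (-ε * u) * fejer (1 * (y + 1 / 2 - u)) ≤ c := by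
      calc _ ≤ ∫ u in Ioi (0 : ℝ), fejer (1 * (y + 1 / 2 - u)) := by
            refine setIntegral_mono_on hi2 (integrable_fejer_comp one_pos _).integrableOn
              measurableSet_Ioi fun u hu => ?_
            have hu' : 0 < u := hu
            refine mul_le_of_le_one_left (fejer_nonneg _) (Real.exp_le_one_iff.mpr ?_)
            nlinarith [hε.1]
        _ ≤ ∫ u, fejer (1 * (y + 1 / 2 - u)) :=
            setIntegral_le_integral (integrable_fejer_comp one_pos _)
              (ae_of_all _ fun u => fejer_nonneg _)
        _ = c := by rw [integral_fejer_comp one_pos]; simp [c]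
    rw [h4] at h3
    norm_num at h3 h5 ⊢
    linarith
  refine ⟨(C * 2 + c) / (Real.exp (-1) * w), fun y hy => ?_⟩
  rw [le_div_iff₀ (by positivity)]
  have hlim : Tendsto (fun ε : ℝ => B y * Real.exp (-(2 * (1 / 2))) *
      Real.exp (-ε * (y + 2 * (1 / 2))) * (1⁻¹ * w)) (𝓝[>] 0)
      (𝓝 (B y * Real.exp (-(2 * (1 / 2))) * Real.exp (-0 * (y + 2 * (1 / 2))) * (1⁻¹ * w))) := by
    refine (Continuous.tendsto ?_ 0).mono_left nhdsWithin_le_nhds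
    fun_prop
  have := le_of_tendsto hlim (by
    filter_upwards [Ioc_mem_nhdsGT one_pos] with ε hε using key y hy ε hε)
  norm_num at this
  linarith

end

section

open Filter Topology MeasureTheory Set

variable {B : ℝ → ℝ} {G : ℂ → ℂ}

theorem integral_boundary_mul_triangle (hBm : Measurable B) (hB0 : ∀ u, 0 ≤ B u)
    {M : ℝ} (hM : ∀ u, 0 ≤ u → B u ≤ M)
    (hBi : ∀ ε > 0, IntegrableOn (fun u => B u * Real.exp (-ε * u)) (Ioi 0))
    (hG : ContinuousOn G {z | 0 ≤ z.re})
    (hGe : ∀ z : ℂ, 0 < z.re →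
      G z = ∫ u in Ioi (0 : ℝ), ((B u - 1 : ℝ) : ℂ) * Complex.exp (-z * u))
    {l : ℝ} (hl : 0 < l) (y : ℝ) :
    ∫ τ in (-1 : ℝ)..1, G (l * τ * Complex.I) *
        (((1 - |τ| : ℝ) : ℂ) * Complex.exp (l * τ * y * Complex.I)) =
      ((∫ u in Ioi (0 : ℝ), (B u - 1) * fejer (l * (y - u)) : ℝ) : ℂ) := by
  obtain ⟨C, hC⟩ := exists_bound_on_segment hG l
  have hIcc : ∀ᶠ ε : ℝ in 𝓝[>] 0, ε ∈ Ioc (0 : ℝ) 1 := Ioc_mem_nhdsGT one_pos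
  have hpath : ∀ ε : ℝ, 0 ≤ ε → ContinuousOn (fun τ : ℝ => G (ε + l * τ * Complex.I)) univ := by
    intro ε hε
    refine hG.comp (by fun_prop) fun τ _ => ?_
    simpa using hε
  have hL : Tendsto (fun ε : ℝ => ∫ τ in (-1 : ℝ)..1, G (ε + l * τ * Complex.I) *
      (((1 - |τ| : ℝ) : ℂ) * Complex.exp (l * τ * y * Complex.I))) (𝓝[>] 0)
      (𝓝 (∫ τ in (-1 : ℝ)..1, G (l * τ * Complex.I) *
        (((1 - |τ| : ℝ) : ℂ) * Complex.exp (l * τ * y * Complex.I)))) := by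
    refine intervalIntegral.tendsto_integral_filter_of_dominated_convergence (fun _ => C) ?_ ?_
      intervalIntegrable_const ?_
    · filter_upwards [hIcc] with ε hε
      refine Continuous.aestronglyMeasurable ?_
      exact (continuousOn_univ.mp (hpath ε hε.1.le)).mul (by fun_prop)
    · filter_upwards [hIcc] with ε hε
      refine ae_of_all _ fun τ hτ => ?_
      rw [uIoc_of_le (by norm_num)] at hτ
      have hτ' : τ ∈ Icc (-1 : ℝ) 1 := ⟨hτ.1.le, hτ.2⟩
      rw [norm_mul]
      exact (mul_le_of_le_one_right (norm_nonneg _) (norm_triangle_mul_cexp_le hτ')).trans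
        (hC ε ⟨hε.1.le, hε.2⟩ τ hτ')
    · refine ae_of_all _ fun τ _ => Tendsto.mul_const _ ?_
      have h0 : ContinuousWithinAt G {z | 0 ≤ z.re} (l * τ * Complex.I) := hG _ (by simp)
      refine h0.tendsto.comp (tendsto_nhdsWithin_iff.mpr ⟨?_, ?_⟩)
      · have : Tendsto (fun ε : ℝ => (ε + l * τ * Complex.I : ℂ)) (𝓝 0)
            (𝓝 ((0 : ℝ) + l * τ * Complex.I)) := Continuous.tendsto (by fun_prop) 0
        simpa using this.mono_left nhdsWithin_le_nhds
      · filter_upwards [hIcc] with ε hε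
        simpa using hε.1.le
  have hR : Tendsto (fun ε : ℝ => ((∫ u in Ioi (0 : ℝ), (B u - 1) * Real.exp (-ε * u) *
      fejer (l * (y - u)) : ℝ) : ℂ)) (𝓝[>] 0)
      (𝓝 ((∫ u in Ioi (0 : ℝ), (B u - 1) * fejer (l * (y - u)) : ℝ) : ℂ)) := by
    refine (Complex.continuous_ofReal.tendsto _).comp ?_
    refine tendsto_integral_filter_of_dominated_convergence
      (fun u => (M + 1) * fejer (l * (y - u))) ?_ ?_
      ((integrable_fejer_comp hl y).const_mul _).integrableOn ?_
    · filter_upwards with ε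
      have := measurable_fejer
      exact Measurable.aestronglyMeasurable (by fun_prop)
    · filter_upwards [hIcc] with ε hε
      refine (ae_restrict_mem measurableSet_Ioi).mono fun u hu => ?_
      have hu' : (0:ℝ) < u := hu
      rw [norm_mul, norm_mul, Real.norm_of_nonneg (fejer_nonneg _),
        Real.norm_of_nonneg (Real.exp_nonneg _)]
      refine mul_le_mul_of_nonneg_right ?_ (fejer_nonneg _)
      refine (mul_le_of_le_one_right (norm_nonneg _) (Real.exp_le_one_iff.mpr ?_)).trans ?_
      · nlinarith [hε.1]
      · rw [Real.norm_eq_abs, abs_le]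
        constructor <;> linarith [hM u hu'.le, hB0 u]
    · refine ae_of_all _ fun u => Tendsto.mul_const _ ?_
      have : Tendsto (fun ε : ℝ => (B u - 1) * Real.exp (-ε * u)) (𝓝 0)
          (𝓝 ((B u - 1) * Real.exp (-0 * u))) := Continuous.tendsto (by fun_prop) 0
      simpa using this.mono_left nhdsWithin_le_nhds
  refine tendsto_nhds_unique hL (hR.congr' ?_)
  filter_upwards [hIcc] with ε hε
  exact (integral_laplace_mul_triangle hBm hBi hGe hε.1 hl y).symm

theorem tendsto_integral_triangle_mul_cexp (G : ℂ → ℂ) {l : ℝ} (hl : 0 < l) :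
    Tendsto (fun y : ℝ => ∫ τ in (-1 : ℝ)..1, G (l * τ * Complex.I) *
        (((1 - |τ| : ℝ) : ℂ) * Complex.exp (l * τ * y * Complex.I))) atTop (𝓝 0) := by
  have h := Real.tendsto_integral_exp_smul_cocompact
    ((Ioc (-1 : ℝ) 1).indicator fun τ : ℝ => G (l * τ * Complex.I) * ((1 - |τ| : ℝ) : ℂ))
  have ht : Tendsto (fun y : ℝ => -(l * y / (2 * Real.pi))) atTop (cocompact ℝ) := by
    refine Tendsto.mono_right ?_ atBot_le_cocompact
    refine tendsto_neg_atTop_atBot.comp ?_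
    exact (tendsto_id.const_mul_atTop hl).atTop_div_const (by positivity)
  refine (h.comp ht).congr fun y => ?_
  rw [intervalIntegral.integral_of_le (by norm_num), ← integral_indicator measurableSet_Ioc]
  simp only [Function.comp]
  congr 1
  ext τ
  by_cases hτ : τ ∈ Ioc (-1 : ℝ) 1
  · simp only [indicator_of_mem hτ, Circle.smul_def, Real.fourierChar_apply, smul_eq_mul]
    have : (2 * Real.pi * -(τ * -(l * y / (2 * Real.pi))) : ℝ) = l * τ * y := by
      field_simp
    rw [this]
    push_cast
    ring
  · simp [indicator_of_notMem hτ]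

/-- The Tauberian theorem of Wiener and Ikehara, for Laplace transforms. -/
theorem tendsto_one_of_laplace (hBm : Measurable B) (hB0 : ∀ u, 0 ≤ B u)
    (hmono : ∀ u v, 0 ≤ u → u ≤ v → B u * Real.exp u ≤ B v * Real.exp v)
    (hBi : ∀ ε > 0, IntegrableOn (fun u => B u * Real.exp (-ε * u)) (Ioi 0))
    (hG : ContinuousOn G {z | 0 ≤ z.re})
    (hGe : ∀ z : ℂ, 0 < z.re →
      G z = ∫ u in Ioi (0 : ℝ), ((B u - 1 : ℝ) : ℂ) * Complex.exp (-z * u)) :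
    Tendsto B atTop (𝓝 1) := by
  obtain ⟨M, hM⟩ := exists_bound_of_laplace hBm hB0 hmono hBi hG hGe
  have hM0 : 0 ≤ M := (hB0 0).trans (hM 0 le_rfl)
  set c := ∫ v, fejer v with hc
  have hc0 : 0 < c := integral_fejer_pos
  have hi : ∀ l : ℝ, 0 < l → ∀ y, IntegrableOn (fun u => B u * fejer (l * (y - u))) (Ioi 0) := by
    intro l hl y
    refine ((integrable_fejer_comp hl y).const_mul M).integrableOn.mono' ?_ ?_
    · have := measurable_fejer
      exact Measurable.aestronglyMeasurable (by fun_prop)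
    · refine (ae_restrict_mem measurableSet_Ioi).mono fun u hu => ?_
      rw [norm_mul, Real.norm_of_nonneg (fejer_nonneg _), Real.norm_of_nonneg (hB0 _)]
      exact mul_le_mul_of_nonneg_right (hM u (le_of_lt hu)) (fejer_nonneg _)
  have hJ : ∀ l : ℝ, 0 < l → Tendsto
      (fun y => l * ∫ u in Ioi (0 : ℝ), B u * fejer (l * (y - u))) atTop (𝓝 c) := by
    intro l hl
    have h1 : Tendsto (fun y => ∫ u in Ioi (0 : ℝ), (B u - 1) * fejer (l * (y - u)))
        atTop (𝓝 0) := by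
      have := tendsto_integral_triangle_mul_cexp G hl
      simp_rw [integral_boundary_mul_triangle hBm hB0 hM hBi hG hGe hl] at this
      simpa [Function.comp_def] using (Complex.continuous_re.tendsto _).comp this
    have h2 : Tendsto (fun y => ∫ u in Ioi (0 : ℝ), fejer (l * (y - u))) atTop
        (𝓝 (∫ v, fejer (l * v))) := by
      have : ∀ y : ℝ, ∫ u in Ioi (0 : ℝ), fejer (l * (y - u)) =
          ∫ v in Iio y, fejer (l * v) := by
        intro y
        rw [← integral_indicator measurableSet_Ioi, ← integral_indicator measurableSet_Iio,
          ← integral_sub_left_eq_self _ volume y]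
        congr 1; ext u
        simp [indicator]
      simp_rw [this]
      exact (aecover_Iio tendsto_id).integral_tendsto_of_countably_generated
        (integrable_fejer.comp_mul_left' hl.ne')
    have h3 : l * (0 + ∫ v, fejer (l * v)) = c := by
      rw [Measure.integral_comp_mul_left, abs_of_pos (inv_pos.mpr hl), smul_eq_mul, zero_add,
        mul_inv_cancel_left₀ hl.ne']
    rw [← h3]
    refine ((h1.add h2).const_mul l).congr fun y => ?_
    rw [← integral_add ?_ (integrable_fejer_comp hl y).integrableOn]
    · congr 2; ext u; ring
    · simp_rw [sub_mul, one_mul]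
      exact (hi l hl y).sub (integrable_fejer_comp hl y).integrableOn
  have hW : Tendsto (fun x : ℝ => ∫ v in (-x)..x, fejer v) atTop (𝓝 c) :=
    intervalIntegral_tendsto_integral integrable_fejer tendsto_neg_atTop_atBot tendsto_id
  have hWl : ∀ δ > 0, Tendsto (fun l : ℝ => ∫ v in (-(l * δ))..(l * δ), fejer v) atTop (𝓝 c) :=
    fun δ hδ => hW.comp (tendsto_id.atTop_mul_const hδ)
  have upper : ∀ δ > 0, ∀ l > 0, ∀ y, 0 ≤ y →
      B y * Real.exp (-(2 * δ)) * (∫ v in (-(l * δ))..(l * δ), fejer v) ≤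
      l * ∫ u in Ioi (0 : ℝ), B u * fejer (l * (y + δ - u)) := by
    intro δ hδ l hl y hy
    have := le_integral_mul_fejer hB0 hmono (ε := 0) le_rfl hl hy hδ (by simpa using hi l hl (y + δ))
    simp only [neg_zero, zero_mul, Real.exp_zero, mul_one] at this
    rw [← div_le_iff₀' hl]
    refine le_trans (le_of_eq ?_) this
    rw [div_eq_mul_inv]; ring
  have lower : ∀ δ > 0, ∀ l > 0, ∀ y, 2 * δ ≤ y →
      l * ∫ u in Ioi (0 : ℝ), B u * fejer (l * (y - δ - u)) ≤
      B y * Real.exp (2 * δ) * (∫ v in (-(l * δ))..(l * δ), fejer v) +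
        M * (c - ∫ v in (-(l * δ))..(l * δ), fejer v) := by
    intro δ hδ l hl y hy
    have e1 := integral_fejer_comp_interval hl (y - 2 * δ) δ
    have e2 := integral_fejer_comp hl (y - δ)
    rw [intervalIntegral.integral_of_le (by linarith)] at e1
    simp only [show y - 2 * δ + δ = y - δ by ring, show y - 2 * δ + 2 * δ = y by ring] at e1
    set E := Ioc (y - 2 * δ) y with hE
    have hfi := integrable_fejer_comp hl (y - δ)
    have hsplit : ∫ u in Eᶜ, fejer (l * (y - δ - u)) =
        l⁻¹ * c - l⁻¹ * ∫ v in (-(l * δ))..(l * δ), fejer v := by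
      rw [← e1, ← e2, ← integral_add_compl measurableSet_Ioc hfi]
      ring
    have hb : ∫ u in Ioi (0 : ℝ), B u * fejer (l * (y - δ - u)) ≤
        ∫ u, (E.indicator (fun u => B y * Real.exp (2 * δ) * fejer (l * (y - δ - u))) u +
          Eᶜ.indicator (fun u => M * fejer (l * (y - δ - u))) u) := by
      rw [← integral_indicator measurableSet_Ioi]
      refine integral_mono ((integrable_indicator_iff measurableSet_Ioi).mpr (hi l hl _))
        (((hfi.const_mul _).indicator measurableSet_Ioc).add
          ((hfi.const_mul _).indicator measurableSet_Ioc.compl)) fun u => ?_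
      have hf := fejer_nonneg (l * (y - δ - u))
      by_cases hu0 : u ∈ Ioi (0 : ℝ)
      · have hu0' : 0 < u := hu0
        by_cases hu : u ∈ E
        · simp only [indicator_of_mem hu0, indicator_of_mem hu, mem_compl_iff, hu,
            not_true_eq_false, not_false_eq_true, indicator_of_notMem, add_zero]
          refine mul_le_mul_of_nonneg_right ?_ hf
          have h1 := hmono u y hu0'.le hu.2
          have h2 : B u = B u * Real.exp u * Real.exp (-u) := by
            rw [mul_assoc, ← Real.exp_add]; simp
          rw [h2]
          calc _ ≤ B y * Real.exp y * Real.exp (-u) :=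
                mul_le_mul_of_nonneg_right h1 (Real.exp_nonneg _)
            _ = B y * Real.exp (y - u) := by
                rw [mul_assoc, ← Real.exp_add, sub_eq_add_neg]
            _ ≤ _ := mul_le_mul_of_nonneg_left
                (Real.exp_le_exp.mpr (by linarith [hu.1])) (hB0 y)
        · simp only [indicator_of_mem hu0, hu, mem_compl_iff,
            not_false_eq_true, indicator_of_notMem, indicator_of_mem, zero_add]
          exact mul_le_mul_of_nonneg_right (hM u hu0'.le) hf
      · simp only [hu0, not_false_eq_true, indicator_of_notMem]
        refine add_nonneg (indicator_nonneg (fun _ _ => ?_) _) (indicator_nonneg (fun _ _ => ?_) _)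
        · exact mul_nonneg (mul_nonneg (hB0 y) (Real.exp_nonneg _)) (fejer_nonneg _)
        · exact mul_nonneg hM0 (fejer_nonneg _)
    rw [integral_add ((hfi.const_mul _).indicator measurableSet_Ioc)
        ((hfi.const_mul _).indicator measurableSet_Ioc.compl),
      integral_indicator measurableSet_Ioc, integral_indicator measurableSet_Ioc.compl,
      integral_const_mul, integral_const_mul, e1, hsplit] at hb
    rw [← le_div_iff₀' hl]
    refine hb.trans (le_of_eq ?_)
    rw [div_eq_mul_inv]; ring
  rw [tendsto_order]
  constructor
  · intro a ha
    have hδ : ∃ δ > 0, a * Real.exp (2 * δ) < 1 := by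
      have : Tendsto (fun δ : ℝ => a * Real.exp (2 * δ)) (𝓝[>] 0) (𝓝 (a * Real.exp (2 * 0))) :=
        (Continuous.tendsto (by fun_prop) 0).mono_left nhdsWithin_le_nhds
      simp only [mul_zero, Real.exp_zero, mul_one] at this
      obtain ⟨δ, h1, h2⟩ := ((this.eventually_lt_const ha).and self_mem_nhdsWithin).exists
      exact ⟨δ, h2, h1⟩
    obtain ⟨δ, hδ, hδ1⟩ := hδ
    have hl : ∃ l > 0, a * Real.exp (2 * δ) * (∫ v in (-(l * δ))..(l * δ), fejer v) +
        M * (c - ∫ v in (-(l * δ))..(l * δ), fejer v) < c := by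
      have := ((hWl δ hδ).const_mul (a * Real.exp (2 * δ))).add
        (((hWl δ hδ).const_sub c).const_mul M)
      obtain ⟨l, h1, h2⟩ := ((this.eventually_lt_const (u := c) (by
        rw [sub_self, mul_zero, add_zero]; nlinarith)).and (eventually_gt_atTop 0)).exists
      exact ⟨l, h2, h1⟩
    obtain ⟨l, hl, hl1⟩ := hl
    have hJ' := (hJ l hl).comp (tendsto_atTop_add_const_right atTop (-δ) tendsto_id)
    filter_upwards [hJ'.eventually_const_lt hl1, eventually_ge_atTop (2 * δ)] with y hy1 hy2
    have h := lower δ hδ l hl y hy2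
    have hw := integral_fejer_interval_pos (mul_pos hl hδ)
    simp only [Function.comp, id, ← sub_eq_add_neg] at hy1
    have h4 := lt_of_lt_of_le hy1 h
    have h5 : a * (Real.exp (2 * δ) * ∫ v in (-(l * δ))..(l * δ), fejer v) <
        B y * (Real.exp (2 * δ) * ∫ v in (-(l * δ))..(l * δ), fejer v) := by linarith
    exact lt_of_mul_lt_mul_right h5 (by positivity)
  · intro a ha
    have hδ : ∃ δ > 0, 1 < a * Real.exp (-(2 * δ)) := by
      have : Tendsto (fun δ : ℝ => a * Real.exp (-(2 * δ))) (𝓝[>] 0)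
          (𝓝 (a * Real.exp (-(2 * 0)))) :=
        (Continuous.tendsto (by fun_prop) 0).mono_left nhdsWithin_le_nhds
      simp only [mul_zero, neg_zero, Real.exp_zero, mul_one] at this
      obtain ⟨δ, h1, h2⟩ := ((this.eventually_const_lt ha).and self_mem_nhdsWithin).exists
      exact ⟨δ, h2, h1⟩
    obtain ⟨δ, hδ, hδ1⟩ := hδ
    have hl : ∃ l > 0, c < a * Real.exp (-(2 * δ)) * (∫ v in (-(l * δ))..(l * δ), fejer v) := by
      have := (hWl δ hδ).const_mul (a * Real.exp (-(2 * δ)))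
      obtain ⟨l, h1, h2⟩ := ((this.eventually_const_lt (u := c) (by nlinarith)).and
        (eventually_gt_atTop 0)).exists
      exact ⟨l, h2, h1⟩
    obtain ⟨l, hl, hl1⟩ := hl
    have hJ' := (hJ l hl).comp (tendsto_atTop_add_const_right atTop δ tendsto_id)
    filter_upwards [hJ'.eventually_lt_const hl1, eventually_ge_atTop 0] with y hy1 hy2
    have h := upper δ hδ l hl y hy2
    have hw := integral_fejer_interval_pos (mul_pos hl hδ)
    simp only [Function.comp, id] at hy1
    have h4 := lt_of_le_of_lt h hy1
    have h5 : B y * (Real.exp (-(2 * δ)) * ∫ v in (-(l * δ))..(l * δ), fejer v) <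
        a * (Real.exp (-(2 * δ)) * ∫ v in (-(l * δ))..(l * δ), fejer v) := by linarith
    exact lt_of_mul_lt_mul_right h5 (by positivity)

end

section

open Filter Topology

theorem AnalyticAt.exists_tendsto_mul_deriv_div {H : ℂ → ℂ} {s : ℂ} (hH : AnalyticAt ℂ H s)
    (hne : ¬ ∀ᶠ z in 𝓝 s, H z = 0) :
    ∃ m : ℕ, (H s = 0 → m ≠ 0) ∧ (H s ≠ 0 → m = 0) ∧
      (∀ᶠ ε : ℝ in 𝓝[>] 0, H (s + ε) ≠ 0) ∧
      Tendsto (fun ε : ℝ => (ε : ℂ) * (deriv H (s + ε) / H (s + ε))) (𝓝[>] 0) (𝓝 m) := by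
  have hord : analyticOrderAt H s ≠ ⊤ := by
    rwa [Ne, analyticOrderAt_eq_top]
  obtain ⟨g, hg, hgs, hHg⟩ := hH.analyticOrderAt_ne_top.mp hord
  set m := analyticOrderNatAt H s
  have hto : Tendsto (fun ε : ℝ => s + (ε : ℂ)) (𝓝[>] 0) (𝓝 s) := by
    have : Continuous fun ε : ℝ => s + (ε : ℂ) := by fun_prop
    simpa using (this.tendsto 0).mono_left nhdsWithin_le_nhds
  have hgne : ∀ᶠ z in 𝓝 s, g z ≠ 0 := hg.continuousAt.eventually_ne hgs
  have hgan : ∀ᶠ z in 𝓝 s, AnalyticAt ℂ g z := hg.eventually_analyticAt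
  have hH2 : ∀ᶠ z in 𝓝 s, H =ᶠ[𝓝 z] fun z => (z - s) ^ m • g z := hHg.eventually_nhds
  refine ⟨m, fun h0 hm => ?_, fun h0 => ?_, ?_, ?_⟩
  · have := hHg.self_of_nhds
    simp [hm, h0] at this
    exact hgs this.symm
  · by_contra hm
    have := hHg.self_of_nhds
    simp [hm, h0] at this
  · filter_upwards [hto.eventually hgne, hto.eventually hH2, self_mem_nhdsWithin] with ε h1 h2 h3
    rw [h2.self_of_nhds]
    have : (ε : ℂ) ≠ 0 := by exact_mod_cast (ne_of_gt h3)
    simp [h1, this]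
  · have hlim : Tendsto (fun ε : ℝ => (m : ℂ) + (ε : ℂ) * (deriv g (s + ε) / g (s + ε)))
        (𝓝[>] 0) (𝓝 m) := by
      have h1 : Tendsto (fun ε : ℝ => deriv g (s + ε) / g (s + ε)) (𝓝[>] 0)
          (𝓝 (deriv g s / g s)) :=
        (hg.deriv.continuousAt.tendsto.comp hto).div (hg.continuousAt.tendsto.comp hto) hgs
      have h2 : Tendsto (fun ε : ℝ => (ε : ℂ)) (𝓝[>] 0) (𝓝 0) := by
        have : Continuous fun ε : ℝ => (ε : ℂ) := by fun_prop
        simpa using (this.tendsto 0).mono_left nhdsWithin_le_nhds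
      simpa using tendsto_const_nhds.add (h2.mul h1)
    refine hlim.congr' ?_
    filter_upwards [hto.eventually hgne, hto.eventually hH2, hto.eventually hgan,
      self_mem_nhdsWithin] with ε h1 h2 h4 h3
    have hε : (ε : ℂ) ≠ 0 := by exact_mod_cast (ne_of_gt h3)
    rw [h2.deriv_eq, h2.self_of_nhds]
    have hd : HasDerivAt (fun z => (z - s) ^ m • g z)
        ((m * (s + ε - s) ^ (m - 1) * 1) * g (s + ε) + (s + ε - s) ^ m * deriv g (s + ε))
        (s + ε) := by
      have := (((hasDerivAt_id (s + (ε : ℂ))).sub_const s).pow m).mul h4.differentiableAt.hasDerivAt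
      convert! this using 1
    rw [hd.deriv]
    simp only [add_sub_cancel_left, smul_eq_mul]
    rcases Nat.eq_zero_or_pos m with hm | hm
    · simp [hm]
    · obtain ⟨k, hk⟩ : ∃ k, m = k + 1 := ⟨m - 1, by omega⟩
      rw [hk]
      simp only [Nat.add_sub_cancel]
      field_simp
      ring

theorem ne_zero_of_one_le_re {H F : ℂ → ℂ} {θ : ℝ} (hθ : θ < 1)
    (hH : DifferentiableOn ℂ H {z | θ < z.re}) (hH1 : H 1 ≠ 0)
    (hF : ∀ s : ℂ, 1 < s.re → (s - 1) * deriv H s = H s * (1 - (s - 1) * F s))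
    (hFc : ∀ s : ℂ, 1 < s.re → ContinuousAt F s)
    (hpos : ∀ σ : ℝ, 1 < σ → ∀ t : ℝ,
      0 ≤ (3 * F σ + 4 * F (σ + t * Complex.I) + F (σ + 2 * t * Complex.I)).re)
    (s : ℂ) (hs : 1 ≤ s.re) : H s ≠ 0 := by
  have hopen : IsOpen {z : ℂ | θ < z.re} := isOpen_lt continuous_const Complex.continuous_re
  have han : AnalyticOnNhd ℂ H {z | θ < z.re} := hH.analyticOnNhd hopen
  have hpre : IsPreconnected {z : ℂ | θ < z.re} := (convex_halfSpace_re_gt θ).isPreconnected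
  have hnz : ∀ s : ℂ, 1 ≤ s.re → ¬ ∀ᶠ z in 𝓝 s, H z = 0 := fun s hs h =>
    hH1 (han.eqOn_zero_of_preconnected_of_eventuallyEq_zero hpre
      (show θ < s.re by linarith) h (show θ < (1 : ℂ).re by simpa using hθ))
  have key : ∀ s : ℂ, 1 ≤ s.re → ∃ m : ℕ, (H s = 0 → m ≠ 0) ∧ (H s ≠ 0 → m = 0) ∧
      Tendsto (fun ε : ℝ => (ε : ℂ) * F (s + ε)) (𝓝[>] 0) (𝓝 ((if s = 1 then 1 else 0) - m)) := by
    intro s hs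
    obtain ⟨m, h1, h2, h3, h4⟩ := (han s (show θ < s.re by linarith)).exists_tendsto_mul_deriv_div
      (hnz s hs)
    refine ⟨m, h1, h2, ?_⟩
    have hto0 : Tendsto (fun ε : ℝ => (ε : ℂ)) (𝓝[>] 0) (𝓝 0) := by
      have : Continuous fun ε : ℝ => (ε : ℂ) := by fun_prop
      simpa using (this.tendsto 0).mono_left nhdsWithin_le_nhds
    have h5 : Tendsto (fun ε : ℝ => (ε : ℂ) / (s + ε - 1)) (𝓝[>] 0)
        (𝓝 (if s = 1 then 1 else 0)) := by
      split_ifs with h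
      · refine tendsto_const_nhds.congr' ?_
        filter_upwards [self_mem_nhdsWithin] with ε h3
        have hε : (ε : ℂ) ≠ 0 := by exact_mod_cast (ne_of_gt h3)
        simp [h, hε]
      · have : Tendsto (fun ε : ℝ => (ε : ℂ) / (s + ε - 1)) (𝓝[>] 0) (𝓝 (0 / (s + 0 - 1))) :=
          hto0.div ((tendsto_const_nhds.add hto0).sub tendsto_const_nhds)
            (by simpa using sub_ne_zero.mpr h)
        simpa using this
    refine (h5.sub h4).congr' ?_
    filter_upwards [h3, self_mem_nhdsWithin] with ε h6 h7
    have h7' : (0 : ℝ) < ε := h7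
    have hre : 1 < (s + (ε : ℂ)).re := by simp; linarith
    have hne : s + ε - 1 ≠ 0 := by
      intro h
      have := congrArg Complex.re h
      simp at this
      simp at hre
      linarith
    have := hF _ hre
    field_simp
    linear_combination -(ε : ℂ) * this
  intro h0
  rcases hs.lt_or_eq with hs' | hs'
  · obtain ⟨m, h1, h2, h3⟩ := key s hs
    have hto0 : Tendsto (fun ε : ℝ => (ε : ℂ)) (𝓝[>] 0) (𝓝 0) := by
      have : Continuous fun ε : ℝ => (ε : ℂ) := by fun_prop
      simpa using (this.tendsto 0).mono_left nhdsWithin_le_nhds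
    have h4 : Tendsto (fun ε : ℝ => (ε : ℂ) * F (s + ε)) (𝓝[>] 0) (𝓝 (0 * F (s + 0))) := by
      refine hto0.mul ?_
      have : Tendsto (fun ε : ℝ => s + (ε : ℂ)) (𝓝[>] 0) (𝓝 (s + 0)) :=
        tendsto_const_nhds.add hto0
      exact (ContinuousAt.tendsto (by simpa using hFc s hs')).comp this
    have hs1 : s ≠ 1 := by rintro rfl; simp at hs'
    have := tendsto_nhds_unique h3 h4
    simp [hs1] at this
    exact h1 h0 this
  · obtain ⟨t, ht⟩ : ∃ t : ℝ, s = 1 + t * Complex.I := ⟨s.im, by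
      apply Complex.ext <;> simp [← hs']⟩
    have ht0 : t ≠ 0 := by
      rintro rfl
      simp at ht
      exact hH1 (ht ▸ h0)
    obtain ⟨m0, -, a2, a3⟩ := key 1 (by simp)
    obtain ⟨m1, b1, -, b3⟩ := key (1 + t * Complex.I) (by simp)
    obtain ⟨m2, -, -, c3⟩ := key (1 + 2 * t * Complex.I) (by simp)
    have hm1 := b1 (ht ▸ h0)
    have hm0 := a2 hH1
    have e1 : 1 + t * Complex.I ≠ 1 := by simp [ht0]
    have e2 : 1 + 2 * t * Complex.I ≠ 1 := by simp [ht0]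
    simp only [hm0, e1, e2, if_true, if_false] at a3 b3 c3
    have hl := Complex.continuous_re.continuousAt.tendsto.comp
      (((a3.const_mul 3).add (b3.const_mul 4)).add c3)
    have : 0 ≤ (3 * (1 - ((0 : ℕ) : ℂ)) + 4 * (0 - (m1 : ℂ)) + (0 - (m2 : ℂ))).re := by
      refine ge_of_tendsto hl ?_
      filter_upwards [self_mem_nhdsWithin] with ε hε
      have hε' : (0 : ℝ) < ε := hε
      have := hpos (1 + ε) (by linarith) t
      have e : (3 * ((ε : ℂ) * F (1 + ε)) + 4 * (ε * F (1 + t * Complex.I + ε))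
          + ε * F (1 + 2 * t * Complex.I + ε)) = (ε : ℝ) * (3 * F ((1 + ε : ℝ) : ℂ)
          + 4 * F ((1 + ε : ℝ) + t * Complex.I) + F ((1 + ε : ℝ) + 2 * t * Complex.I)) := by
        push_cast
        rw [show (1 : ℂ) + t * Complex.I + ε = 1 + ε + t * Complex.I by ring,
          show (1 : ℂ) + 2 * t * Complex.I + ε = 1 + ε + 2 * t * Complex.I by ring]
        ring
      simp only [Function.comp]
      rw [e, Complex.re_ofReal_mul]
      positivity
    simp at this
    have h1 : (1 : ℝ) ≤ m1 := by exact_mod_cast Nat.one_le_iff_ne_zero.mpr hm1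
    have h2 : (0 : ℝ) ≤ m2 := by positivity
    linarith

end

section

open Filter Topology MeasureTheory Set Asymptotics

theorem re_three_four_one_nonneg {f : ℕ → ℝ} (hf : ∀ n, 0 ≤ f n)
    (hs : ∀ s : ℂ, 1 < s.re → LSeriesSummable (fun n => (f n : ℂ)) s) {σ : ℝ} (hσ : 1 < σ) (t : ℝ) :
    0 ≤ (3 * LSeries (fun n => (f n : ℂ)) σ +
    4 * LSeries (fun n => (f n : ℂ)) (σ + t * Complex.I)
      + LSeries (fun n => (f n : ℂ)) (σ + 2 * t * Complex.I)).re := by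
  have h0 : LSeriesSummable (fun n => (f n : ℂ)) σ := hs _ (by simpa using hσ)
  have h1 : LSeriesSummable (fun n => (f n : ℂ)) (σ + t * Complex.I) := hs _ (by simpa using hσ)
  have h2 : LSeriesSummable (fun n => (f n : ℂ)) (σ + 2 * t * Complex.I) :=
    hs _ (by simpa using hσ)
  have := (((h0.hasSum.mul_left 3).add (h1.hasSum.mul_left 4)).add h2.hasSum)
  have := (Complex.hasSum_re this)
  change HasSum _ (3 * LSeries (fun n => (f n : ℂ)) σ +
    4 * LSeries (fun n => (f n : ℂ)) (σ + t * Complex.I)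
      + LSeries (fun n => (f n : ℂ)) (σ + 2 * t * Complex.I)).re at this
  rw [← this.tsum_eq]
  refine tsum_nonneg fun n => ?_
  rcases eq_or_ne n 0 with rfl | hn
  · simp
  have hnC : (n : ℂ) ≠ 0 := by exact_mod_cast hn
  set w : ℂ := Complex.exp (((-(t * Real.log n) : ℝ) : ℂ) * Complex.I) with hw
  have e1 : ∀ k : ℂ, (n : ℂ) ^ (-(σ + k * t * Complex.I)) =
      ((n : ℝ) ^ (-σ) : ℝ) * Complex.exp (k * (((-(t * Real.log n) : ℝ) : ℂ) * Complex.I)) := by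
    intro k
    rw [neg_add, Complex.cpow_add _ _ hnC, Complex.ofReal_cpow (by positivity)]
    push_cast
    congr 1
    rw [Complex.cpow_def_of_ne_zero hnC]
    congr 1; ring
  have e2 := e1 0
  have e3 := e1 1
  have e4 := e1 2
  rw [show (2 : ℂ) * (((-(t * Real.log n) : ℝ) : ℂ) * Complex.I) =
      (((-(t * Real.log n) : ℝ) : ℂ) * Complex.I) + (((-(t * Real.log n) : ℝ) : ℂ) * Complex.I) by
      ring, Complex.exp_add, ← hw] at e4
  rw [one_mul, one_mul, ← hw] at e3
  simp only [zero_mul, add_zero, Complex.exp_zero, mul_one] at e2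
  simp only [LSeries.term_of_ne_zero hn, div_eq_mul_inv, ← Complex.cpow_neg, e2, e3, e4]
  have hnorm : w.re * w.re + w.im * w.im = 1 := by
    rw [← Complex.normSq_apply, Complex.normSq_eq_norm_sq, hw, Complex.norm_exp_ofReal_mul_I]
    norm_num
  have : (3 * ((f n : ℂ) * ((n : ℝ) ^ (-σ) : ℝ)) + 4 * ((f n : ℂ) * (((n : ℝ) ^ (-σ) : ℝ) * w)) +
    f n * (((n : ℝ) ^ (-σ) : ℝ) * (w * w))).re = 2 * (f n * (n : ℝ) ^ (-σ)) * (1 + w.re) ^ 2 := by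
    have : (3 * ((f n : ℂ) * ((n : ℝ) ^ (-σ) : ℝ)) + 4 * ((f n : ℂ) * (((n : ℝ) ^ (-σ) : ℝ) * w)) +
      f n * (((n : ℝ) ^ (-σ) : ℝ) * (w * w))) =
        ((f n * (n : ℝ) ^ (-σ) : ℝ) : ℂ) * (3 + 4 * w + w * w) := by
      push_cast; ring
    rw [this, Complex.re_ofReal_mul]
    simp
    linear_combination (- f n * (n : ℝ) ^ (-σ)) * hnorm
  rw [this]
  have := hf n
  positivity

/-- The summatory function of a sequence. -/
noncomputable def summatory (a : ℕ → ℝ) (x : ℝ) : ℝ := ∑ k ∈ Finset.Icc 1 ⌊x⌋₊, a k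

theorem summatory_mono {a : ℕ → ℝ} (ha : ∀ n, 0 ≤ a n) : Monotone (summatory a) := fun _ _ h =>
  Finset.sum_le_sum_of_subset_of_nonneg (Finset.Icc_subset_Icc_right (Nat.floor_mono h))
    fun _ _ _ => ha _

theorem summatory_nonneg {a : ℕ → ℝ} (ha : ∀ n, 0 ≤ a n) (x : ℝ) : 0 ≤ summatory a x :=
  Finset.sum_nonneg fun _ _ => ha _

theorem exists_summatory_le {a : ℕ → ℝ} (ha : ∀ n, 0 ≤ a n) {κ θ : ℝ} (hθ1 : θ < 1)
    (hA : (fun x => summatory a x - κ * x) =O[atTop] fun x : ℝ => x ^ θ) :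
    ∃ C, 0 ≤ C ∧ ∀ x, 1 ≤ x → summatory a x ≤ C * x := by
  have h1 : (fun x : ℝ => x ^ θ) =O[atTop] fun x : ℝ => x := by
    refine IsBigO.of_bound 1 ?_
    filter_upwards [eventually_ge_atTop 1] with x hx
    rw [one_mul, Real.norm_of_nonneg (by positivity), Real.norm_of_nonneg (by positivity)]
    exact (Real.rpow_le_rpow_of_exponent_le hx hθ1.le).trans_eq (Real.rpow_one x)
  have h2 : summatory a =O[atTop] fun x : ℝ => x := by
    have := (hA.trans h1).add ((isBigO_refl (fun x : ℝ => x) atTop).const_mul_left κ)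
    simpa using this
  obtain ⟨C, hC⟩ := h2.bound
  obtain ⟨X, hX⟩ := eventually_atTop.mp hC
  refine ⟨max C (summatory a X), le_max_of_le_right (summatory_nonneg ha X), fun x hx => ?_⟩
  rcases le_total X x with h | h
  · have := hX x h
    rw [Real.norm_of_nonneg (summatory_nonneg ha x), Real.norm_of_nonneg (by linarith)] at this
    exact this.trans (by gcongr; exact le_max_left _ _)
  · refine (summatory_mono ha h).trans ((le_max_right C _).trans ?_)
    exact le_mul_of_one_le_right (le_max_of_le_right (summatory_nonneg ha X)) hx

variable {a Λ : ℕ → ℝ} {κ θ : ℝ}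

theorem le_mul_log_of_convolution (ha : ∀ n, 0 ≤ a n) (ha1 : a 1 = 1) (hΛ : ∀ n, 0 ≤ Λ n)
    (hconv : ∀ n ≠ 0, a n * Real.log n = ∑ x ∈ n.divisorsAntidiagonal, Λ x.1 * a x.2)
    {n : ℕ} (hn : n ≠ 0) : Λ n ≤ a n * Real.log n := by
  rw [hconv n hn]
  have := Finset.single_le_sum (f := fun x : ℕ × ℕ => Λ x.1 * a x.2)
    (fun x _ => mul_nonneg (hΛ _) (ha _)) (show (n, 1) ∈ n.divisorsAntidiagonal by simp [hn])
  simpa [ha1] using this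

theorem exists_summatory_le_rpow (ha : ∀ n, 0 ≤ a n) (ha1 : a 1 = 1) (hΛ : ∀ n, 0 ≤ Λ n)
    (hconv : ∀ n ≠ 0, a n * Real.log n = ∑ x ∈ n.divisorsAntidiagonal, Λ x.1 * a x.2)
    (hθ1 : θ < 1) (hA : (fun x => summatory a x - κ * x) =O[atTop] fun x : ℝ => x ^ θ)
    {η : ℝ} (hη : 0 < η) :
    ∃ C, 0 ≤ C ∧ ∀ x, 1 ≤ x → summatory Λ x ≤ C * x ^ (1 + η) := by
  obtain ⟨C, hC0, hC⟩ := exists_summatory_le ha hθ1 hA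
  refine ⟨C / η, by positivity, fun x hx => ?_⟩
  calc summatory Λ x ≤ ∑ k ∈ Finset.Icc 1 ⌊x⌋₊, a k * Real.log x := by
        refine Finset.sum_le_sum fun k hk => ?_
        rw [Finset.mem_Icc] at hk
        refine (le_mul_log_of_convolution ha ha1 hΛ hconv (by omega)).trans ?_
        have := ha k
        have hk0 : (0 : ℝ) < k := by exact_mod_cast hk.1
        gcongr
        exact (Nat.le_floor_iff (by linarith)).mp hk.2
    _ = summatory a x * Real.log x := by rw [← Finset.sum_mul, summatory]
    _ ≤ (C * x) * (x ^ η / η) := by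
        have := Real.log_nonneg hx
        gcongr
        · exact hC x hx
        · exact Real.log_le_rpow_div (by linarith) hη
    _ = C / η * x ^ (1 + η) := by rw [Real.rpow_add (by linarith), Real.rpow_one]; ring

theorem isBigO_sum_of_summatory (ha : ∀ n, 0 ≤ a n) (hθ1 : θ < 1)
    (hA : (fun x => summatory a x - κ * x) =O[atTop] fun x : ℝ => x ^ θ) :
    (fun n : ℕ => ∑ k ∈ Finset.Icc 1 n, a k) =O[atTop] fun n : ℕ => (n : ℝ) ^ (1 : ℝ) := by
  obtain ⟨C, hC0, hC⟩ := exists_summatory_le ha hθ1 hA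
  refine IsBigO.of_bound C ?_
  filter_upwards [eventually_ge_atTop 1] with n hn
  have := hC n (by exact_mod_cast hn)
  rw [summatory, Nat.floor_natCast] at this
  rwa [Real.norm_of_nonneg (Finset.sum_nonneg fun _ _ => ha _), Real.rpow_one,
    Real.norm_of_nonneg (by positivity)]

theorem lSeriesSummable_of_summatory (ha : ∀ n, 0 ≤ a n) (hθ1 : θ < 1)
    (hA : (fun x => summatory a x - κ * x) =O[atTop] fun x : ℝ => x ^ θ) {s : ℂ} (hs : 1 < s.re) :
    LSeriesSummable (fun n => (a n : ℂ)) s :=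
  LSeriesSummable_of_sum_norm_bigO_and_nonneg (isBigO_sum_of_summatory ha hθ1 hA) ha
    zero_le_one hs

theorem abscissaOfAbsConv_lt_of_summatory (ha : ∀ n, 0 ≤ a n) (hθ1 : θ < 1)
    (hA : (fun x => summatory a x - κ * x) =O[atTop] fun x : ℝ => x ^ θ) {s : ℂ} (hs : 1 < s.re) :
    LSeries.abscissaOfAbsConv (fun n => (a n : ℂ)) < s.re := by
  refine lt_of_le_of_lt (LSeries.abscissaOfAbsConv_le_of_forall_lt_LSeriesSummable (x := 1)
    fun y hy => lSeriesSummable_of_summatory ha hθ1 hA (by simpa using hy)) ?_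
  exact_mod_cast hs

theorem lSeriesSummable_of_convolution (ha : ∀ n, 0 ≤ a n) (ha1 : a 1 = 1) (hΛ : ∀ n, 0 ≤ Λ n)
    (hconv : ∀ n ≠ 0, a n * Real.log n = ∑ x ∈ n.divisorsAntidiagonal, Λ x.1 * a x.2)
    (hθ1 : θ < 1) (hA : (fun x => summatory a x - κ * x) =O[atTop] fun x : ℝ => x ^ θ)
    {s : ℂ} (hs : 1 < s.re) :
    LSeriesSummable (fun n => (Λ n : ℂ)) s := by
  have hf := LSeriesSummable_logMul_of_lt_re (abscissaOfAbsConv_lt_of_summatory ha hθ1 hA hs)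
  rw [LSeriesSummable, ← summable_norm_iff] at hf ⊢
  refine hf.of_nonneg_of_le (fun _ => norm_nonneg _) fun n => ?_
  rcases eq_or_ne n 0 with rfl | hn
  · simp
  refine LSeries.norm_term_le s ?_
  have h1 := le_mul_log_of_convolution ha ha1 hΛ hconv hn
  rw [LSeries.logMul, ← Complex.natCast_log, ← Complex.ofReal_mul, Complex.norm_real,
    Complex.norm_real, Real.norm_of_nonneg (hΛ n), mul_comm]
  exact h1.trans (le_abs_self _)

theorem hasDerivAt_lSeries_of_convolution (ha : ∀ n, 0 ≤ a n) (ha1 : a 1 = 1) (hΛ : ∀ n, 0 ≤ Λ n)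
    (hconv : ∀ n ≠ 0, a n * Real.log n = ∑ x ∈ n.divisorsAntidiagonal, Λ x.1 * a x.2)
    (hθ1 : θ < 1) (hA : (fun x => summatory a x - κ * x) =O[atTop] fun x : ℝ => x ^ θ)
    {s : ℂ} (hs : 1 < s.re) :
    HasDerivAt (LSeries fun n => (a n : ℂ))
      (-(LSeries (fun n => (Λ n : ℂ)) s * LSeries (fun n => (a n : ℂ)) s)) s := by
  convert! LSeries_hasDerivAt (abscissaOfAbsConv_lt_of_summatory ha hθ1 hA hs) using 2
  rw [← LSeries_convolution' (lSeriesSummable_of_convolution ha ha1 hΛ hconv hθ1 hA hs)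
    (lSeriesSummable_of_summatory ha hθ1 hA hs)]
  refine LSeries_congr (fun {n} hn => ?_) s
  rw [LSeries.convolution_def, LSeries.logMul, ← Complex.natCast_log, ← Complex.ofReal_mul,
    mul_comm (Real.log n), hconv n hn]
  push_cast
  rfl

theorem lSeries_eq_integral_of_convolution (ha : ∀ n, 0 ≤ a n) (ha1 : a 1 = 1) (hΛ : ∀ n, 0 ≤ Λ n)
    (hconv : ∀ n ≠ 0, a n * Real.log n = ∑ x ∈ n.divisorsAntidiagonal, Λ x.1 * a x.2)
    (hθ1 : θ < 1) (hA : (fun x => summatory a x - κ * x) =O[atTop] fun x : ℝ => x ^ θ)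
    {s : ℂ} (hs : 1 < s.re) :
    LSeries (fun n => (Λ n : ℂ)) s =
      s * ∫ t in Ioi (1 : ℝ), (summatory Λ t : ℂ) * (t : ℂ) ^ (-(s + 1)) := by
  obtain ⟨C, hC0, hC⟩ := exists_summatory_le_rpow ha ha1 hΛ hconv hθ1 hA
    (show 0 < (s.re - 1) / 2 by linarith)
  have := LSeries_eq_mul_integral_of_nonneg Λ (r := 1 + (s.re - 1) / 2) (by linarith) (s := s)
    (by linarith) ?_ hΛ
  · rw [this]; simp [summatory]
  · refine IsBigO.of_bound C ?_
    filter_upwards [eventually_ge_atTop 1] with n hn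
    have := hC n (by exact_mod_cast hn)
    rw [summatory, Nat.floor_natCast] at this
    rwa [Real.norm_of_nonneg (Finset.sum_nonneg fun _ _ => hΛ _),
      Real.norm_of_nonneg (by positivity)]

end

section

open Filter Topology MeasureTheory Set Asymptotics

variable {a : ℕ → ℝ} {κ θ : ℝ}

/-- The error term in the asymptotics of a summatory function, truncated to `(1, ∞)`. -/
noncomputable def summatoryError (a : ℕ → ℝ) (κ : ℝ) : ℝ → ℂ :=
  indicator (Ioi 1) fun t => ((summatory a t - κ * t : ℝ) : ℂ)

/-- The product of `s - 1` and the analytic continuation of the Dirichlet series of `a`. -/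
noncomputable def continuedLSeries (a : ℕ → ℝ) (κ : ℝ) (s : ℂ) : ℂ :=
  κ * s + (s - 1) * s * mellin (summatoryError a κ) (-s)

theorem locallyIntegrableOn_summatoryError (ha : ∀ n, 0 ≤ a n) :
    LocallyIntegrableOn (summatoryError a κ) (Ioi 0) := by
  have h1 : LocallyIntegrable (fun t => summatory a t - κ * t) :=
    (summatory_mono ha).locallyIntegrable.sub (by fun_prop : Continuous fun t => κ * t).locallyIntegrable
  have h2 : LocallyIntegrable (fun t => ((summatory a t - κ * t : ℝ) : ℂ)) := by
    intro x
    obtain ⟨s, hs, h⟩ := h1 x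
    exact ⟨s, hs, h.ofReal⟩
  exact (h2.indicator measurableSet_Ioi).locallyIntegrableOn _

theorem differentiableAt_mellin_summatoryError (ha : ∀ n, 0 ≤ a n)
    (hA : (fun x => summatory a x - κ * x) =O[atTop] fun x : ℝ => x ^ θ)
    {s : ℂ} (hs : s.re < -θ) :
    DifferentiableAt ℂ (mellin (summatoryError a κ)) s := by
  refine mellin_differentiableAt_of_isBigO_rpow (a := -θ) (b := s.re - 1)
    (locallyIntegrableOn_summatoryError ha) ?_ hs ?_ (by linarith)
  · rw [neg_neg]
    refine IsBigO.congr' (f₁ := fun t => ((summatory a t - κ * t : ℝ) : ℂ)) ?_ ?_ EventuallyEq.rfl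
    · exact (Complex.isBigO_ofReal_left).mpr hA
    · filter_upwards [eventually_gt_atTop 1] with t ht
      rw [summatoryError, indicator_of_mem (show t ∈ Ioi 1 from ht)]
  · refine (isBigO_zero (E' := ℂ) _ _).congr' ?_ EventuallyEq.rfl
    filter_upwards [mem_nhdsWithin_of_mem_nhds (Iio_mem_nhds (show (0 : ℝ) < 1 by norm_num))]
      with t ht
    rw [summatoryError, indicator_of_notMem]
    simpa using (show t < 1 from ht).le

theorem differentiableOn_continuedLSeries (ha : ∀ n, 0 ≤ a n)
    (hA : (fun x => summatory a x - κ * x) =O[atTop] fun x : ℝ => x ^ θ) :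
    DifferentiableOn ℂ (continuedLSeries a κ) {z | θ < z.re} := by
  intro s hs
  have hs' : θ < s.re := hs
  have h : DifferentiableAt ℂ (fun s : ℂ => mellin (summatoryError a κ) (-s)) s :=
    DifferentiableAt.fun_comp' s (f := fun s : ℂ => -s)
      (differentiableAt_mellin_summatoryError ha hA (by simpa using hs')) (by fun_prop)
  refine DifferentiableAt.differentiableWithinAt ?_
  unfold continuedLSeries
  exact ((by fun_prop : DifferentiableAt ℂ (fun s : ℂ => (κ : ℂ) * s) s)).add
    ((by fun_prop : DifferentiableAt ℂ (fun s : ℂ => (s - 1) * s) s).mul h)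

theorem continuedLSeries_eq (ha : ∀ n, 0 ≤ a n) (hθ1 : θ < 1)
    (hA : (fun x => summatory a x - κ * x) =O[atTop] fun x : ℝ => x ^ θ) {s : ℂ} (hs : 1 < s.re) :
    continuedLSeries a κ s = (s - 1) * LSeries (fun n => (a n : ℂ)) s := by
  have h1 : LSeries (fun n => (a n : ℂ)) s =
      s * ∫ t in Ioi (1 : ℝ), (summatory a t : ℂ) * (t : ℂ) ^ (-(s + 1)) := by
    rw [LSeries_eq_mul_integral_of_nonneg a zero_le_one hs (isBigO_sum_of_summatory ha hθ1 hA) ha]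
    simp [summatory]
  have hconv : MellinConvergent (summatoryError a κ) (-s) := by
    refine mellinConvergent_of_isBigO_rpow (a := -θ) (b := (-s).re - 1)
      (locallyIntegrableOn_summatoryError ha) ?_ ?_ ?_ (by linarith)
    · rw [neg_neg]
      refine IsBigO.congr' (f₁ := fun t => ((summatory a t - κ * t : ℝ) : ℂ)) ?_ ?_
        EventuallyEq.rfl
      · exact (Complex.isBigO_ofReal_left).mpr hA
      · filter_upwards [eventually_gt_atTop 1] with t ht
        rw [summatoryError, indicator_of_mem (show t ∈ Ioi 1 from ht)]
    · simp; linarith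
    · refine (isBigO_zero (E' := ℂ) _ _).congr' ?_ EventuallyEq.rfl
      filter_upwards [mem_nhdsWithin_of_mem_nhds (Iio_mem_nhds (show (0 : ℝ) < 1 by norm_num))]
        with t ht
      rw [summatoryError, indicator_of_notMem]
      simpa using (show t < 1 from ht).le
  have hm : mellin (summatoryError a κ) (-s) =
      ∫ t in Ioi (1 : ℝ), (t : ℂ) ^ (-s - 1) * ((summatory a t - κ * t : ℝ) : ℂ) := by
    rw [mellin, ← integral_indicator measurableSet_Ioi, ← integral_indicator measurableSet_Ioi]
    congr 1
    ext t
    by_cases ht : 1 < t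
    · have ht0 : 0 < t := by linarith
      simp [indicator, summatoryError, ht, ht0]
    · simp [indicator, summatoryError, ht]
  have hi1 : IntegrableOn (fun t : ℝ => (t : ℂ) ^ (-s - 1) * ((summatory a t - κ * t : ℝ) : ℂ))
      (Ioi 1) := by
    have := hconv.mono_set (show Ioi (1 : ℝ) ⊆ Ioi 0 from Ioi_subset_Ioi zero_le_one)
    refine this.congr_fun (fun t ht => ?_) measurableSet_Ioi
    simp only [summatoryError, indicator_of_mem ht, smul_eq_mul]
  have hi2 : IntegrableOn (fun t : ℝ => (κ : ℂ) * (t : ℂ) ^ (-s)) (Ioi 1) :=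
    (integrableOn_Ioi_cpow_of_lt (by simpa using hs) zero_lt_one).const_mul _
  have h2 : ∫ t in Ioi (1 : ℝ), (summatory a t : ℂ) * (t : ℂ) ^ (-(s + 1)) =
      mellin (summatoryError a κ) (-s) + κ / (s - 1) := by
    rw [hm]
    have h3 : ∫ t in Ioi (1 : ℝ), (κ : ℂ) * (t : ℂ) ^ (-s) = κ / (s - 1) := by
      rw [integral_const_mul, integral_Ioi_cpow_of_lt (by simpa using hs) zero_lt_one]
      rw [Complex.ofReal_one, Complex.one_cpow, show -s + 1 = -(s - 1) by ring, neg_div_neg_eq]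
      ring
    rw [← h3, ← integral_add hi1 hi2]
    refine setIntegral_congr_fun measurableSet_Ioi fun t ht => ?_
    have ht0 : (t : ℂ) ≠ 0 := by
      have : (1 : ℝ) < t := ht
      exact_mod_cast (by linarith : t ≠ 0)
    rw [show -(s + 1) = -s - 1 by ring, Complex.cpow_sub _ _ ht0, Complex.cpow_one]
    push_cast
    field_simp
    ring
  have hs1 : s - 1 ≠ 0 := by
    intro h
    have := congrArg Complex.re h
    simp at this
    linarith
  rw [h1, h2, continuedLSeries]
  field_simp
  ring

end

section

open Filter Topology MeasureTheory Set Asymptotics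

theorem tendsto_summatory_div_of_convolution {a Λ : ℕ → ℝ} (ha : ∀ n, 0 ≤ a n) (ha1 : a 1 = 1)
    (hΛ : ∀ n, 0 ≤ Λ n)
    (hconv : ∀ n ≠ 0, a n * Real.log n = ∑ x ∈ n.divisorsAntidiagonal, Λ x.1 * a x.2)
    {κ θ : ℝ} (hκ : κ ≠ 0) (hθ1 : θ < 1)
    (hA : (fun x => summatory a x - κ * x) =O[atTop] fun x : ℝ => x ^ θ) :
    Tendsto (fun x => summatory Λ x / x) atTop (𝓝 1) := by
  set H := continuedLSeries a κ
  set F := LSeries (fun n => (Λ n : ℂ))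
  set Z := LSeries (fun n => (a n : ℂ))
  have hopen : IsOpen {z : ℂ | θ < z.re} := isOpen_lt continuous_const Complex.continuous_re
  have hHd : DifferentiableOn ℂ H {z | θ < z.re} := differentiableOn_continuedLSeries ha hA
  have hH1 : H 1 ≠ 0 := by simp [H, continuedLSeries, hκ]
  have hF : ∀ s : ℂ, 1 < s.re → (s - 1) * deriv H s = H s * (1 - (s - 1) * F s) := by
    intro s hs
    have h1 : H =ᶠ[𝓝 s] fun s => (s - 1) * Z s := by
      filter_upwards [(isOpen_lt continuous_const Complex.continuous_re).mem_nhds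
        (show s ∈ {z : ℂ | 1 < z.re} from hs)] with z hz
      exact continuedLSeries_eq ha hθ1 hA hz
    have h2 := ((hasDerivAt_id s).sub_const 1).mul
      (hasDerivAt_lSeries_of_convolution ha ha1 hΛ hconv hθ1 hA hs)
    rw [h1.deriv_eq, h1.self_of_nhds]
    have h3 : deriv (fun s => (s - 1) * Z s) s = _ := h2.deriv
    rw [h3]
    simp only [id, F, Z]
    ring
  have hsumm : ∀ s : ℂ, 1 < s.re → LSeriesSummable (fun n => (Λ n : ℂ)) s := fun s hs =>
    lSeriesSummable_of_convolution ha ha1 hΛ hconv hθ1 hA hs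
  have hFc : ∀ s : ℂ, 1 < s.re → ContinuousAt F s := by
    intro s hs
    refine (LSeries_hasDerivAt ?_).continuousAt
    refine lt_of_le_of_lt (LSeries.abscissaOfAbsConv_le_of_forall_lt_LSeriesSummable (x := 1)
      fun y hy => hsumm y (by simpa using hy)) ?_
    exact_mod_cast hs
  have hne : ∀ s : ℂ, 1 ≤ s.re → H s ≠ 0 := ne_zero_of_one_le_re hθ1 hHd hH1 hF hFc
    fun σ hσ t => re_three_four_one_nonneg hΛ hsumm hσ t
  set B : ℝ → ℝ := fun u => summatory Λ (Real.exp u) * Real.exp (-u) with hB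
  have hmono : Monotone fun u => summatory Λ (Real.exp u) :=
    (summatory_mono hΛ).comp Real.exp_monotone
  have hBm : Measurable B := hmono.measurable.mul (by fun_prop)
  have hB0 : ∀ u, 0 ≤ B u := fun u => mul_nonneg (summatory_nonneg hΛ _) (Real.exp_pos _).le
  have hBe : ∀ u, B u * Real.exp u = summatory Λ (Real.exp u) := by
    intro u
    rw [hB]
    simp only
    rw [mul_assoc, ← Real.exp_add]
    simp
  have hBi : ∀ ε > 0, IntegrableOn (fun u => B u * Real.exp (-ε * u)) (Ioi 0) := by
    intro ε hε
    obtain ⟨C, hC0, hC⟩ := exists_summatory_le_rpow ha ha1 hΛ hconv hθ1 hA (half_pos hε)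
    have h1 : IntegrableOn (fun u => C * Real.exp (-(ε / 2) * u)) (Ioi 0) :=
      (integrableOn_exp_mul_Ioi (by linarith) 0).const_mul C
    refine Integrable.mono' h1 (hBm.mul (by fun_prop)).aestronglyMeasurable ?_
    refine (ae_restrict_iff' measurableSet_Ioi).mpr (Eventually.of_forall fun u hu => ?_)
    have hu0 : (0 : ℝ) < u := hu
    rw [Real.norm_of_nonneg (mul_nonneg (hB0 u) (Real.exp_pos _).le)]
    have := hC (Real.exp u) (by simpa using hu0.le)
    rw [← Real.exp_mul] at this
    calc B u * Real.exp (-ε * u)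
        ≤ (C * Real.exp (u * (1 + ε / 2))) * Real.exp (-u) * Real.exp (-ε * u) := by
          simp only [hB]; gcongr
      _ = C * Real.exp (-(ε / 2) * u) := by
          rw [mul_assoc, mul_assoc, ← Real.exp_add, ← Real.exp_add]
          congr 2; ring
  set G : ℂ → ℂ := fun z => -(1 + deriv H (1 + z) / H (1 + z)) / (1 + z) with hG
  have hGc : ContinuousOn G {z | 0 ≤ z.re} := by
    intro z hz
    have hz' : 0 ≤ z.re := hz
    have hmem : (1 + z) ∈ {z : ℂ | θ < z.re} := by simp; linarith
    have han := hHd.analyticOnNhd hopen (1 + z) hmem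
    have hz1 : 1 + z ≠ 0 := by
      intro h
      have := congrArg Complex.re h
      simp at this
      linarith
    have hadd : ContinuousAt (fun z : ℂ => 1 + z) z := by fun_prop
    have c1 : ContinuousAt (fun z => H (1 + z)) z :=
      ContinuousAt.comp (f := fun z : ℂ => 1 + z) han.continuousAt hadd
    have c2 : ContinuousAt (fun z => deriv H (1 + z)) z :=
      ContinuousAt.comp (f := fun z : ℂ => 1 + z) han.deriv.continuousAt hadd
    exact (((continuousAt_const.add (c2.div c1 (hne _ (by simpa using hz')))).neg).div hadd
      hz1).continuousWithinAt
  have hGe : ∀ z : ℂ, 0 < z.re →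
      G z = ∫ u in Ioi (0 : ℝ), ((B u - 1 : ℝ) : ℂ) * Complex.exp (-z * u) := by
    intro z hz
    have i1 : IntegrableOn (fun u : ℝ => (B u : ℂ) * Complex.exp (-z * u)) (Ioi 0) := by
      refine Integrable.mono' (hBi z.re hz) ?_ ?_
      · exact (Complex.measurable_ofReal.comp hBm).aestronglyMeasurable.mul
          (by fun_prop : Continuous fun u : ℝ => Complex.exp (-z * u)).aestronglyMeasurable
      · refine Eventually.of_forall fun u => ?_
        rw [norm_mul, Complex.norm_real, Real.norm_of_nonneg (hB0 u), Complex.norm_exp]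
        simp
    have i2 : IntegrableOn (fun u : ℝ => Complex.exp (-z * u)) (Ioi 0) :=
      integrableOn_exp_mul_complex_Ioi (by simpa using hz) 0
    have e2 : ∫ u in Ioi (0 : ℝ), Complex.exp (-z * u) = 1 / z := by
      rw [integral_exp_mul_complex_Ioi (by simpa using hz) 0]
      simp
    have hs : 1 < (1 + z).re := by simpa using hz
    have e1 : F (1 + z) = (1 + z) * ∫ u in Ioi (0 : ℝ), (B u : ℂ) * Complex.exp (-z * u) := by
      have h1 := lSeries_eq_integral_of_convolution ha ha1 hΛ hconv hθ1 hA hs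
      have h2 := integral_comp_exp_Ioi (fun t : ℝ => (summatory Λ t : ℂ) * (t : ℂ) ^ (-((1 + z) + 1))) 0
      rw [Real.exp_zero] at h2
      rw [← h2] at h1
      simp only [F]
      rw [h1]
      congr 1
      refine setIntegral_congr_fun measurableSet_Ioi fun u _ => ?_
      simp only [hB, Complex.real_smul]
      rw [Complex.cpow_def_of_ne_zero (by exact_mod_cast (Real.exp_pos u).ne'),
        ← Complex.ofReal_log (Real.exp_pos u).le, Real.log_exp]
      push_cast
      rw [mul_left_comm, mul_assoc, ← Complex.exp_add, ← Complex.exp_add]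
      congr 2
      ring
    have e3 : ∫ u in Ioi (0 : ℝ), ((B u - 1 : ℝ) : ℂ) * Complex.exp (-z * u) =
        (∫ u in Ioi (0 : ℝ), (B u : ℂ) * Complex.exp (-z * u)) - 1 / z := by
      rw [← e2, ← integral_sub i1 i2]
      congr 1; ext u; push_cast; ring
    have hz0 : z ≠ 0 := by rintro rfl; simp at hz
    have hz1 : 1 + z ≠ 0 := by
      intro h
      have := congrArg Complex.re h
      simp at this
      linarith
    have hHz := hne (1 + z) hs.le
    have h4 := hF (1 + z) hs
    rw [e3, eq_sub_iff_add_eq, ← mul_right_inj' hz1, ← e1, hG]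
    simp only [add_sub_cancel_left] at h4
    field_simp
    linear_combination -h4
  have hlim := tendsto_one_of_laplace hBm hB0
    (fun u v _ huv => by rw [hBe, hBe]; exact hmono huv) hBi hGc hGe
  refine (hlim.comp Real.tendsto_log_atTop).congr' ?_
  filter_upwards [eventually_gt_atTop 0] with x hx
  simp only [Function.comp, hB]
  rw [Real.exp_neg, Real.exp_log hx, div_eq_mul_inv]

end

section

open NumberField UniqueFactorizationMonoid

variable (K : Type*) [Field K] [NumberField K]

/-- The ideals of norm `n`. -/
noncomputable def idealsOfNorm (n : ℕ) : Finset (Ideal (𝓞 K)) :=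
  (Ideal.finite_setOfPred_absNorm_eq (S := 𝓞 K) n).toFinset

/-- The nonzero prime ideals of norm at most `n`. -/
noncomputable def primesOfNormLe (n : ℕ) : Finset (Ideal (𝓞 K)) :=
  ((Ideal.finite_setOfPred_absNorm_le (S := 𝓞 K) n).inter_of_right
    {p | p.IsPrime ∧ p ≠ ⊥}).toFinset

/-- The von Mangoldt function of the number field `K`. -/
noncomputable def idealMangoldt (n : ℕ) : ℝ :=
  ∑ p ∈ primesOfNormLe K n, ∑ k ∈ Finset.Icc 1 n,
    if Ideal.absNorm p ^ k = n then Real.log (Ideal.absNorm p) else 0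

variable {K}

@[simp] theorem mem_idealsOfNorm {n : ℕ} {I : Ideal (𝓞 K)} :
    I ∈ idealsOfNorm K n ↔ Ideal.absNorm I = n := by
  simp [idealsOfNorm]

@[simp] theorem mem_primesOfNormLe {n : ℕ} {p : Ideal (𝓞 K)} :
    p ∈ primesOfNormLe K n ↔ (p.IsPrime ∧ p ≠ ⊥) ∧ Ideal.absNorm p ≤ n := by
  simp [primesOfNormLe]

theorem one_lt_absNorm {p : Ideal (𝓞 K)} (hp : p.IsPrime) (hp0 : p ≠ ⊥) :
    1 < Ideal.absNorm p := by
  have h1 : Ideal.absNorm p ≠ 0 := mt Ideal.absNorm_eq_zero_iff.mp hp0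
  have h2 : Ideal.absNorm p ≠ 1 := by simpa using hp.ne_top
  omega

theorem idealMangoldt_eq {n N : ℕ} (hN : n ≤ N) :
    idealMangoldt K n = ∑ p ∈ primesOfNormLe K N, ∑ k ∈ Finset.Icc 1 N,
      if Ideal.absNorm p ^ k = n then Real.log (Ideal.absNorm p) else 0 := by
  have key : ∀ p ∈ primesOfNormLe K N, ∀ k ∈ Finset.Icc 1 N, Ideal.absNorm p ^ k = n →
      Ideal.absNorm p ≤ n ∧ k ≤ n := by
    intro p hp k hk h
    rw [mem_primesOfNormLe] at hp
    rw [Finset.mem_Icc] at hk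
    have h1 := one_lt_absNorm hp.1.1 hp.1.2
    rw [← h]
    exact ⟨Nat.le_self_pow (by omega) _, (Nat.lt_pow_self h1).le⟩
  have hsub : primesOfNormLe K n ⊆ primesOfNormLe K N := fun p hp => by
    rw [mem_primesOfNormLe] at hp ⊢
    exact ⟨hp.1, hp.2.trans hN⟩
  rw [idealMangoldt, ← Finset.sum_subset hsub]
  · refine Finset.sum_congr rfl fun p hp => ?_
    refine Finset.sum_subset (Finset.Icc_subset_Icc_right hN) fun k hk hk' => ?_
    rw [if_neg]
    intro h
    have := key p (hsub hp) k hk h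
    rw [Finset.mem_Icc] at hk hk'
    omega
  · intro p hp hp'
    refine Finset.sum_eq_zero fun k hk => ?_
    rw [if_neg]
    intro h
    refine hp' ?_
    rw [mem_primesOfNormLe] at hp ⊢
    exact ⟨hp.1, (key p (mem_primesOfNormLe.mpr hp) k hk h).1⟩

theorem idealMangoldt_nonneg (n : ℕ) : 0 ≤ idealMangoldt K n := by
  refine Finset.sum_nonneg fun p _ => Finset.sum_nonneg fun k _ => ?_
  split_ifs
  · exact Real.log_natCast_nonneg _
  · rfl

theorem sum_idealMangoldt (N : ℕ) :
    ∑ n ∈ Finset.Icc 1 N, idealMangoldt K n = ∑ p ∈ primesOfNormLe K N, ∑ k ∈ Finset.Icc 1 N,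
      if Ideal.absNorm p ^ k ≤ N then Real.log (Ideal.absNorm p) else 0 := by
  rw [Finset.sum_congr rfl fun n hn =>
    idealMangoldt_eq (K := K) (Finset.mem_Icc.mp hn).2, Finset.sum_comm]
  refine Finset.sum_congr rfl fun p hp => ?_
  rw [Finset.sum_comm]
  refine Finset.sum_congr rfl fun k _ => ?_
  rw [mem_primesOfNormLe] at hp
  have : 1 ≤ Ideal.absNorm p ^ k := Nat.one_le_pow _ _ (by have := one_lt_absNorm hp.1.1 hp.1.2; omega)
  rw [Finset.sum_ite_eq]
  simp [this]

theorem card_idealsOfNorm_one : (idealsOfNorm K 1).card = 1 := by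
  rw [Finset.card_eq_one]
  exact ⟨⊤, by ext I; simp⟩

open Classical in
theorem log_absNorm_eq_sum {I : Ideal (𝓞 K)} (hI : I ≠ ⊥) :
    Real.log (Ideal.absNorm I) = ∑ p ∈ primesOfNormLe K (Ideal.absNorm I),
      ∑ k ∈ Finset.Icc 1 (Ideal.absNorm I), if p ^ k ∣ I then Real.log (Ideal.absNorm p) else 0 := by
  have hI0 : Ideal.absNorm I ≠ 0 := mt Ideal.absNorm_eq_zero_iff.mp hI
  have h1 : Real.log (Ideal.absNorm I) =
      ((normalizedFactors I).map fun p => Real.log (Ideal.absNorm p)).sum := by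
    have : ∀ s : Multiset (Ideal (𝓞 K)), s.prod ≠ ⊥ → Real.log (Ideal.absNorm s.prod) =
        (s.map fun p => Real.log (Ideal.absNorm p)).sum := by
      intro s
      induction s using Multiset.induction_on with
      | empty => simp
      | cons p s ih =>
        intro h
        rw [Multiset.prod_cons, ← Ideal.zero_eq_bot] at h
        have hp := left_ne_zero_of_mul h
        have hs := right_ne_zero_of_mul h
        rw [Multiset.prod_cons, map_mul, Nat.cast_mul, Real.log_mul
          (Nat.cast_ne_zero.mpr (mt Ideal.absNorm_eq_zero_iff.mp hp))
          (Nat.cast_ne_zero.mpr (mt Ideal.absNorm_eq_zero_iff.mp hs)), Multiset.map_cons,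
        Multiset.sum_cons, ih hs]
    conv_lhs => rw [← Ideal.prod_normalizedFactors_eq_self hI]
    exact this _ (by rwa [Ideal.prod_normalizedFactors_eq_self hI])
  have hsub : (normalizedFactors I).toFinset ⊆ primesOfNormLe K (Ideal.absNorm I) := by
    intro p hp
    rw [Multiset.mem_toFinset] at hp
    have hp' := prime_of_normalized_factor p hp
    rw [mem_primesOfNormLe]
    exact ⟨⟨Ideal.isPrime_of_prime hp', hp'.ne_zero⟩, Nat.le_of_dvd (Nat.pos_of_ne_zero hI0)
      (map_dvd Ideal.absNorm (dvd_of_mem_normalizedFactors hp))⟩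
  rw [h1, Finset.sum_multiset_map_count, Finset.sum_subset hsub]
  · refine Finset.sum_congr rfl fun p hp => ?_
    rw [mem_primesOfNormLe] at hp
    have hpp : Prime p := Ideal.prime_of_isPrime hp.1.2 hp.1.1
    rw [← Finset.sum_filter, Finset.sum_const]
    congr 1
    have hdvd : ∀ k, p ^ k ∣ I ↔ k ≤ (normalizedFactors I).count p := fun k => by
      rw [pow_dvd_iff_le_emultiplicity, emultiplicity_eq_count_normalizedFactors hpp.irreducible hI,
        normalize_eq, Nat.cast_le]
    have : (Finset.Icc 1 (Ideal.absNorm I)).filter (fun k => p ^ k ∣ I) =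
        Finset.Icc 1 ((normalizedFactors I).count p) := by
      ext k
      simp only [Finset.mem_filter, Finset.mem_Icc, hdvd]
      refine ⟨fun h => ⟨h.1.1, h.2⟩, fun h => ⟨⟨h.1, ?_⟩, h.2⟩⟩
      have := Nat.le_of_dvd (Nat.pos_of_ne_zero hI0) (map_dvd Ideal.absNorm ((hdvd k).mpr h.2))
      rw [map_pow] at this
      exact (Nat.lt_pow_self (one_lt_absNorm hp.1.1 hp.1.2)).le.trans this
    rw [this]
    simp
  · intro p _ hp
    rw [Multiset.mem_toFinset] at hp
    rw [Multiset.count_eq_zero_of_notMem hp, zero_smul]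

open Classical in
theorem card_idealsOfNorm_filter_dvd {n : ℕ} (hn : n ≠ 0) {J : Ideal (𝓞 K)} :
    ((idealsOfNorm K n).filter (J ∣ ·)).card =
      ∑ x ∈ n.divisorsAntidiagonal, if Ideal.absNorm J = x.1 then (idealsOfNorm K x.2).card else 0 := by
  by_cases hd : Ideal.absNorm J ∣ n
  · obtain ⟨e, he⟩ := hd
    have hJ : J ≠ 0 := by
      rintro rfl
      simp [he] at hn
    have h1 : 0 < Ideal.absNorm J := Nat.pos_of_ne_zero (mt Ideal.absNorm_eq_zero_iff.mp hJ)
    rw [Finset.sum_eq_single (Ideal.absNorm J, e)]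
    · rw [if_pos rfl]
      symm
      refine Finset.card_bij (fun I _ => J * I) ?_ ?_ ?_
      · intro I hI
        rw [mem_idealsOfNorm] at hI
        simp [he, hI]
      · intro I _ I' _ h
        exact mul_left_cancel₀ hJ h
      · intro I hI
        rw [Finset.mem_filter, mem_idealsOfNorm] at hI
        obtain ⟨I', rfl⟩ := hI.2
        refine ⟨I', ?_, rfl⟩
        rw [mem_idealsOfNorm]
        have := hI.1
        rw [map_mul, he] at this
        exact Nat.eq_of_mul_eq_mul_left h1 this
    · rintro ⟨d', e'⟩ hx hne
      rw [Nat.mem_divisorsAntidiagonal] at hx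
      rw [if_neg]
      rintro rfl
      refine hne ?_
      rw [Prod.mk.injEq]
      exact ⟨rfl, Nat.eq_of_mul_eq_mul_left h1 (hx.1.trans he)⟩
    · intro h
      exact absurd (Nat.mem_divisorsAntidiagonal.mpr ⟨he.symm, hn⟩) h
  · rw [Finset.sum_eq_zero, Finset.card_eq_zero, Finset.filter_eq_empty_iff]
    · intro I hI h
      rw [mem_idealsOfNorm] at hI
      exact hd (hI ▸ map_dvd Ideal.absNorm h)
    · rintro ⟨d', e'⟩ hx
      rw [Nat.mem_divisorsAntidiagonal] at hx
      rw [if_neg]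
      rintro rfl
      exact hd ⟨_, hx.1.symm⟩

theorem card_idealsOfNorm_mul_log {n : ℕ} (hn : n ≠ 0) :
    ((idealsOfNorm K n).card : ℝ) * Real.log n =
      ∑ x ∈ n.divisorsAntidiagonal, idealMangoldt K x.1 * ((idealsOfNorm K x.2).card : ℝ) := by
  classical
  have h1 : ((idealsOfNorm K n).card : ℝ) * Real.log n = ∑ I ∈ idealsOfNorm K n,
      ∑ p ∈ primesOfNormLe K n,
      ∑ k ∈ Finset.Icc 1 n, if p ^ k ∣ I then Real.log (Ideal.absNorm p) else 0 := by
    rw [← nsmul_eq_mul, ← Finset.sum_const]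
    refine Finset.sum_congr rfl fun I hI => ?_
    rw [mem_idealsOfNorm] at hI
    have := log_absNorm_eq_sum (I := I) (by rintro rfl; simp at hI; exact hn hI.symm)
    rwa [hI] at this
  have h2 : ∑ x ∈ n.divisorsAntidiagonal, idealMangoldt K x.1 * ((idealsOfNorm K x.2).card : ℝ) =
      ∑ x ∈ n.divisorsAntidiagonal, ∑ p ∈ primesOfNormLe K n, ∑ k ∈ Finset.Icc 1 n,
      Real.log (Ideal.absNorm p) *
        if Ideal.absNorm (p ^ k) = x.1 then ((idealsOfNorm K x.2).card : ℝ) else 0 := by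
    refine Finset.sum_congr rfl fun x hx => ?_
    rw [Nat.mem_divisorsAntidiagonal] at hx
    rw [idealMangoldt_eq (Nat.le_of_dvd (Nat.pos_of_ne_zero hn) ⟨_, hx.1.symm⟩),
      Finset.sum_mul]
    refine Finset.sum_congr rfl fun p _ => ?_
    rw [Finset.sum_mul]
    refine Finset.sum_congr rfl fun k _ => ?_
    rw [map_pow]
    split_ifs <;> simp
  rw [h1, h2, Finset.sum_comm, Finset.sum_comm (s := n.divisorsAntidiagonal)]
  refine Finset.sum_congr rfl fun p _ => ?_
  rw [Finset.sum_comm, Finset.sum_comm (s := n.divisorsAntidiagonal)]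
  refine Finset.sum_congr rfl fun k _ => ?_
  rw [← Finset.mul_sum, ← Finset.sum_filter, Finset.sum_const, card_idealsOfNorm_filter_dvd hn,
    nsmul_eq_mul, mul_comm]
  push_cast
  rfl

end

section

open NumberField Filter Topology

variable {K : Type*} [Field K] [NumberField K]

theorem sum_idealMangoldt_le (N : ℕ) :
    ∑ n ∈ Finset.Icc 1 N, idealMangoldt K n ≤ (primesOfNormLe K N).card * Real.log N := by
  rw [sum_idealMangoldt, ← nsmul_eq_mul, ← Finset.sum_const]
  refine Finset.sum_le_sum fun p hp => ?_
  rw [mem_primesOfNormLe] at hp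
  have h1 := one_lt_absNorm hp.1.1 hp.1.2
  set q := Ideal.absNorm p
  have hN : N ≠ 0 := by omega
  rw [← Finset.sum_filter, Finset.sum_const, nsmul_eq_mul]
  have hsub : (Finset.Icc 1 N).filter (fun k => q ^ k ≤ N) ⊆ Finset.Icc 1 (Nat.log q N) := by
    intro k hk
    rw [Finset.mem_filter, Finset.mem_Icc] at hk
    exact Finset.mem_Icc.mpr ⟨hk.1.1, Nat.le_log_of_pow_le h1 hk.2⟩
  have hcard := Finset.card_le_card hsub
  rw [Nat.card_Icc, Nat.add_sub_cancel] at hcard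
  have hlog : 0 ≤ Real.log q := Real.log_natCast_nonneg _
  calc _ ≤ (Nat.log q N : ℝ) * Real.log q := by gcongr
    _ = Real.log ((q ^ Nat.log q N : ℕ) : ℝ) := by push_cast; rw [Real.log_pow]
    _ ≤ Real.log N := by
      have h2 := Nat.pow_log_le_self q hN
      have h3 : 0 < q ^ Nat.log q N := by positivity
      exact Real.log_le_log (by exact_mod_cast h3) (by exact_mod_cast h2)

theorem card_primesOfNormLe_le (N : ℕ) :
    ((primesOfNormLe K N).card : ℝ) ≤ ∑ n ∈ Finset.Icc 1 N, ((idealsOfNorm K n).card : ℝ) := by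
  classical
  have hsub : primesOfNormLe K N ⊆ (Finset.Icc 1 N).biUnion fun n => idealsOfNorm K n := by
    intro p hp
    rw [mem_primesOfNormLe] at hp
    have h1 := one_lt_absNorm hp.1.1 hp.1.2
    simp only [Finset.mem_biUnion, Finset.mem_Icc, mem_idealsOfNorm]
    exact ⟨_, ⟨by omega, hp.2⟩, rfl⟩
  have := (Finset.card_le_card hsub).trans Finset.card_biUnion_le
  exact_mod_cast this

theorem card_primesOfNormLe_mul_log_le (N : ℕ) {y : ℝ} (hy : 1 < y) :
    ((primesOfNormLe K N).card : ℝ) * Real.log y ≤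
      (primesOfNormLe K ⌊y⌋₊).card * Real.log y + ∑ n ∈ Finset.Icc 1 N, idealMangoldt K n := by
  classical
  have hlogy : 0 < Real.log y := Real.log_pos hy
  have h1 : (primesOfNormLe K N).card ≤ (primesOfNormLe K ⌊y⌋₊).card +
      (primesOfNormLe K N \ primesOfNormLe K ⌊y⌋₊).card := by
    have := Finset.le_card_sdiff (primesOfNormLe K ⌊y⌋₊) (primesOfNormLe K N)
    omega
  have h2 : ((primesOfNormLe K N \ primesOfNormLe K ⌊y⌋₊).card : ℝ) * Real.log y ≤
      ∑ n ∈ Finset.Icc 1 N, idealMangoldt K n := by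
    rw [sum_idealMangoldt, ← nsmul_eq_mul, ← Finset.sum_const]
    refine (Finset.sum_le_sum fun p hp => ?_).trans
      (Finset.sum_le_sum_of_subset_of_nonneg Finset.sdiff_subset fun p _ _ => ?_)
    · rw [Finset.mem_sdiff, mem_primesOfNormLe, mem_primesOfNormLe] at hp
      have hyp : y < Ideal.absNorm p := by
        exact (Nat.floor_lt (by linarith)).mp (not_le.mp fun h => hp.2 ⟨hp.1.1, h⟩)
      have hlt := one_lt_absNorm hp.1.1.1 hp.1.1.2
      have h0 : (if Ideal.absNorm p ^ 1 ≤ N then Real.log (Ideal.absNorm p) else 0) =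
          Real.log (Ideal.absNorm p) := by rw [pow_one, if_pos hp.1.2]
      refine le_trans ?_ (Finset.single_le_sum (f := fun k =>
        if Ideal.absNorm p ^ k ≤ N then Real.log (Ideal.absNorm p) else 0) (fun k _ => ?_)
        (Finset.mem_Icc.mpr ⟨le_refl 1, by omega⟩))
      · simp only [h0]
        exact Real.log_le_log (by linarith) hyp.le
      · split_ifs
        · exact Real.log_natCast_nonneg _
        · rfl
    · refine Finset.sum_nonneg fun k _ => ?_
      split_ifs
      · exact Real.log_natCast_nonneg _
      · rfl
  have h3 : ((primesOfNormLe K N).card : ℝ) ≤ (primesOfNormLe K ⌊y⌋₊).card +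
      (primesOfNormLe K N \ primesOfNormLe K ⌊y⌋₊).card := by exact_mod_cast h1
  nlinarith

theorem tendsto_card_primesOfNormLe {κ θ : ℝ} (hκ : κ ≠ 0) (hθ1 : θ < 1)
    (hA : (fun x => summatory (fun n => ((idealsOfNorm K n).card : ℝ)) x - κ * x)
      =O[atTop] fun x : ℝ => x ^ θ) :
    Tendsto (fun N : ℕ => ((primesOfNormLe K N).card : ℝ) * Real.log N / N) atTop (𝓝 1) := by
  have ha : ∀ n, 0 ≤ ((idealsOfNorm K n).card : ℝ) := fun n => by positivity
  obtain ⟨C, hC0, hC⟩ := exists_summatory_le ha hθ1 hA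
  have hψ := tendsto_summatory_div_of_convolution ha (by simp [card_idealsOfNorm_one])
    (idealMangoldt_nonneg (K := K)) (fun n hn => card_idealsOfNorm_mul_log hn) hκ hθ1 hA
  have hψN := hψ.comp tendsto_natCast_atTop_atTop
  have hlog : Tendsto (fun N : ℕ => Real.log N) atTop atTop :=
    Real.tendsto_log_atTop.comp tendsto_natCast_atTop_atTop
  have hu : Tendsto (fun u : ℝ => 2 * (Real.log u / u)) atTop (𝓝 (2 * 0)) :=
    (Real.isLittleO_log_id_atTop.tendsto_div_nhds_zero).const_mul 2
  have hu' : Tendsto (fun N : ℕ => 2 * (Real.log (Real.log N) / Real.log N)) atTop (𝓝 (2 * 0)) :=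
    hu.comp hlog
  have hup : Tendsto (fun N : ℕ => C * (Real.log N)⁻¹ + (summatory (idealMangoldt K) N / N) *
      (1 - 2 * (Real.log (Real.log N) / Real.log N))⁻¹) atTop (𝓝 (C * 0 + 1 * (1 - 2 * 0)⁻¹)) :=
    (hlog.inv_tendsto_atTop.const_mul C).add
      (hψN.mul ((tendsto_const_nhds.sub hu').inv₀ (by norm_num)))
  simp only [mul_zero, sub_zero, inv_one, mul_one, zero_add] at hup
  refine tendsto_of_tendsto_of_tendsto_of_le_of_le' hψN hup ?_ ?_
  · filter_upwards with N
    have := sum_idealMangoldt_le (K := K) N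
    simp only [Function.comp, summatory, Nat.floor_natCast]
    gcongr
  · have hsmall : ∀ᶠ N : ℕ in atTop, 2 * (Real.log (Real.log N) / Real.log N) < 1 / 2 :=
      hu'.eventually_lt_const (by norm_num)
    filter_upwards [hsmall, hlog.eventually_gt_atTop 3, eventually_ge_atTop 1] with N h1 h2 hN
    set u := Real.log N
    have hN0 : (0 : ℝ) < N := by exact_mod_cast hN
    set y : ℝ := N / u ^ 2 with hy
    have hlogy : Real.log y = u * (1 - 2 * (Real.log u / u)) := by
      rw [hy, Real.log_div hN0.ne' (by positivity), Real.log_pow]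
      push_cast
      field_simp
      rfl
    have hpos : 0 < 1 - 2 * (Real.log u / u) := by linarith
    have hlogy0 : 0 < Real.log y := by rw [hlogy]; positivity
    have hy1 : 1 < y := (Real.log_pos_iff (by positivity)).mp hlogy0
    have h3 := card_primesOfNormLe_mul_log_le (K := K) N hy1
    have h4 : ((primesOfNormLe K ⌊y⌋₊).card : ℝ) ≤ C * y :=
      (card_primesOfNormLe_le _).trans (hC y hy1.le)
    have h5 : summatory (idealMangoldt K) N = ∑ n ∈ Finset.Icc 1 N, idealMangoldt K n := by
      simp [summatory]
    rw [← h5] at h3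
    set S := summatory (idealMangoldt K) N
    set P : ℝ := ((primesOfNormLe K N).card : ℝ)
    have h6 : P ≤ C * y + S / Real.log y := by
      rw [← sub_le_iff_le_add', le_div_iff₀ hlogy0, sub_mul]
      nlinarith
    have h0u : 0 < u := by linarith
    calc P * u / N ≤ (C * y + S / Real.log y) * u / N := by gcongr
      _ = C * u⁻¹ + S / N * (1 - 2 * (Real.log u / u))⁻¹ := by
        rw [hlogy, hy]
        have hne := hpos.ne'
        generalize 1 - 2 * (Real.log u / u) = v at *
        field_simp

end

section

open Filter Topology MeasureTheory Set Pointwise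

/-- The points within distance `δ` of which membership in `D` changes. -/
def crossingSet {E : Type*} [PseudoMetricSpace E] (D : Set E) (δ : ℝ) : Set E :=
  {x | ∃ y, dist x y ≤ δ ∧ ¬(x ∈ D ↔ y ∈ D)}

theorem isBounded_crossingSet {E : Type*} [PseudoMetricSpace E] {D : Set E}
    (hD : Bornology.IsBounded D) (δ : ℝ) :
    Bornology.IsBounded (crossingSet D δ) := by
  refine (hD.union (hD.cthickening (δ := δ))).subset fun x ⟨y, hxy, h⟩ => ?_
  by_cases hx : x ∈ D
  · exact Or.inl hx
  · have hy : y ∈ D := by tauto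
    exact Or.inr (Metric.mem_cthickening_of_dist_le x y δ D hy hxy)

variable {E : Type*} [NormedAddCommGroup E] [NormedSpace ℝ E]

theorem crossingSet_smul (D : Set E) {t : ℝ} (ht : 0 < t) (δ : ℝ) :
    crossingSet (t • D) δ = t • crossingSet D (δ / t) := by
  ext x
  rw [mem_smul_set_iff_inv_smul_mem₀ ht.ne']
  constructor
  · rintro ⟨y, hxy, h⟩
    refine ⟨t⁻¹ • y, ?_, ?_⟩
    · rw [dist_smul₀, Real.norm_of_nonneg (by positivity), div_eq_inv_mul]
      gcongr
    · rwa [← mem_smul_set_iff_inv_smul_mem₀ ht.ne', ← mem_smul_set_iff_inv_smul_mem₀ ht.ne']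
  · rintro ⟨y, hxy, h⟩
    refine ⟨t • y, ?_, ?_⟩
    · have := mul_le_mul_of_nonneg_left hxy ht.le
      rw [mul_div_cancel₀ _ ht.ne'] at this
      calc dist x (t • y) = dist (t • t⁻¹ • x) (t • y) := by rw [smul_inv_smul₀ ht.ne']
        _ = t * dist (t⁻¹ • x) y := by rw [dist_smul₀, Real.norm_of_nonneg ht.le]
        _ ≤ δ := this
    · rwa [mem_smul_set_iff_inv_smul_mem₀ ht.ne', mem_smul_set_iff_inv_smul_mem₀ ht.ne',
        inv_smul_smul₀ ht.ne']

variable [FiniteDimensional ℝ E] [MeasurableSpace E] [BorelSpace E]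
  (Λ : Submodule ℤ E) [DiscreteTopology Λ] [IsZLattice ℝ Λ] (μ : Measure E) [μ.IsAddHaarMeasure]

/-- The number of points of a lattice in a bounded set is its volume divided by the covolume, up to
the volume of a neighbourhood of the boundary. -/
theorem exists_abs_card_mul_covolume_sub_le :
    ∃ R > 0, ∀ D : Set E, Bornology.IsBounded D →
      |(Nat.card (D ∩ Λ : Set E) : ℝ) * ZLattice.covolume Λ μ - μ.real D| ≤
        μ.real (crossingSet D R) := by
  classical
  have : ProperSpace E := FiniteDimensional.proper ℝ E
  let b := Module.Free.chooseBasis ℤ Λ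
  let B := b.ofZLatticeBasis ℝ Λ
  have hspan : Submodule.span ℤ (Set.range B) = Λ := b.ofZLatticeBasis_span ℝ Λ
  let F := ZSpan.fundamentalDomain B
  have hFm : MeasurableSet F := ZSpan.fundamentalDomain_measurableSet B
  have hcov : ZLattice.covolume Λ μ = μ.real F :=
    ZLattice.covolume_eq_measure_fundamentalDomain Λ μ (ZLattice.isAddFundamentalDomain b μ)
  obtain ⟨R, hR0, hR⟩ : ∃ R > 0, ∀ x, ‖ZSpan.fract B x‖ ≤ R :=
    ⟨∑ i, ‖B i‖ + 1, by positivity, fun x => (ZSpan.norm_fract_le B x).trans (by linarith)⟩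
  refine ⟨R, hR0, fun D hD => ?_⟩
  have hfin : (D ∩ Λ : Set E).Finite := by
    have := ZSpan.setFinite_inter B hD
    rwa [hspan] at this
  have hfract : ∀ v ∈ Λ, ∀ x ∈ v +ᵥ F, (ZSpan.floor B x : E) = v := by
    rintro v hv _ ⟨y, hy, rfl⟩
    have h1 : ZSpan.fract B (v + y) = y := by
      rw [ZSpan.fract_zSpan_add _ _ (by rwa [hspan]), ZSpan.fract_eq_self.mpr hy]
    rw [ZSpan.fract_apply, sub_eq_iff_eq_add'] at h1
    simpa using add_right_cancel h1.symm
  set U : Set E := ⋃ v ∈ hfin.toFinset, (v +ᵥ F) with hU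
  have hUmem : ∀ x, x ∈ U ↔ (ZSpan.floor B x : E) ∈ D := by
    intro x
    simp only [hU, mem_iUnion, Finite.mem_toFinset, exists_prop]
    constructor
    · rintro ⟨v, hv, hx⟩
      rw [hfract v hv.2 x hx]
      exact hv.1
    · intro h
      refine ⟨_, ⟨h, ?_⟩, ?_⟩
      · exact hspan.le (ZSpan.floor B x).2
      · exact ⟨ZSpan.fract B x, ZSpan.fract_mem_fundamentalDomain B x, by
          simp [ZSpan.fract_apply]⟩
  have hUvol : μ.real U = (Nat.card (D ∩ Λ : Set E) : ℝ) * ZLattice.covolume Λ μ := by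
    have hFtop : ∀ v ∈ hfin.toFinset, μ (v +ᵥ F) ≠ ⊤ := fun v _ => by
      rw [measure_vadd]
      exact (ZSpan.fundamentalDomain_isBounded B).measure_lt_top.ne
    rw [hU, measureReal_biUnion_finset _ _ hFtop]
    · simp only [measureReal_def, measure_vadd]
      rw [Finset.sum_const, hcov, nsmul_eq_mul, measureReal_def, Nat.card_eq_card_finite_toFinset hfin]
    · intro v hv w hw hvw
      refine Set.disjoint_left.mpr fun x hx hx' => hvw ?_
      simp only [Finite.coe_toFinset] at hv hw
      rw [← hfract v hv.2 x hx, ← hfract w hw.2 x hx']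
    · exact fun v _ => hFm.const_vadd v
  have hdist : ∀ x, dist x (ZSpan.floor B x : E) ≤ R := by
    intro x
    rw [dist_eq_norm, ← ZSpan.fract_apply]
    exact hR x
  have hUb : Bornology.IsBounded U := by
    refine (hD.cthickening (δ := R)).subset fun x hx => ?_
    exact Metric.mem_cthickening_of_dist_le x _ R D ((hUmem x).mp hx) (hdist x)
  have hEb := isBounded_crossingSet hD R
  rw [← hUvol, abs_sub_le_iff]
  constructor
  · rw [sub_le_iff_le_add]
    refine (measureReal_mono (fun x hx => ?_) ((hEb.union hD).measure_lt_top.ne)).trans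
      (measureReal_union_le _ _)
    by_cases h : x ∈ D
    · exact Or.inr h
    · exact Or.inl ⟨_, hdist x, by have := (hUmem x).mp hx; tauto⟩
  · rw [sub_le_iff_le_add]
    refine (measureReal_mono (fun x hx => ?_) ((hEb.union hUb).measure_lt_top.ne)).trans
      (measureReal_union_le _ _)
    by_cases h : x ∈ U
    · exact Or.inr h
    · exact Or.inl ⟨_, hdist x, by have := (hUmem x).not.mp h; tauto⟩

/-- Counting lattice points in the dilates of a bounded set whose boundary is not too big. -/
theorem exists_abs_card_smul_inter_sub_le {D : Set E} (hD : Bornology.IsBounded D) {C : ℝ}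
    (hC : ∀ δ, 0 < δ → δ ≤ 1 → μ.real (crossingSet D δ) ≤ C * δ) :
    ∃ R > 0, ∀ t ≥ R, |(Nat.card (t • D ∩ Λ : Set E) : ℝ) -
      μ.real D / ZLattice.covolume Λ μ * t ^ Module.finrank ℝ E| ≤
        C * R / ZLattice.covolume Λ μ * t ^ ((Module.finrank ℝ E : ℝ) - 1) := by
  obtain ⟨R, hR, h⟩ := exists_abs_card_mul_covolume_sub_le Λ μ
  refine ⟨R, hR, fun t ht => ?_⟩
  have ht0 : 0 < t := hR.trans_le ht
  have hc := ZLattice.covolume_pos Λ μ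
  have h1 := h (t • D) (hD.smul₀ t)
  have hvol : ∀ S : Set E, μ.real (t • S) = t ^ Module.finrank ℝ E * μ.real S := by
    intro S
    rw [measureReal_def, Measure.addHaar_smul, ENNReal.toReal_mul,
      ENNReal.toReal_ofReal (abs_nonneg _), abs_of_pos (by positivity), measureReal_def]
  rw [crossingSet_smul D ht0, hvol, hvol] at h1
  have h2 := hC (R / t) (by positivity) ((div_le_one ht0).mpr ht)
  have h3 : t ^ ((Module.finrank ℝ E : ℝ) - 1) = t ^ Module.finrank ℝ E / t := by
    rw [Real.rpow_sub ht0, Real.rpow_natCast, Real.rpow_one]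
  rw [h3]
  have h4 : (Nat.card (t • D ∩ Λ : Set E) : ℝ) -
      μ.real D / ZLattice.covolume Λ μ * t ^ Module.finrank ℝ E =
      ((Nat.card (t • D ∩ Λ : Set E) : ℝ) * ZLattice.covolume Λ μ -
        t ^ Module.finrank ℝ E * μ.real D) / ZLattice.covolume Λ μ := by
    field_simp
  rw [h4, abs_div, abs_of_pos hc, div_le_iff₀ hc]
  refine h1.trans ((mul_le_mul_of_nonneg_left h2 (by positivity)).trans_eq ?_)
  field_simp

end

section

open Filter Topology MeasureTheory Set

theorem exists_mem_frontier_of_mem_crossingSet {X E : Type*} [TopologicalSpace X] [T2Space X]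
    [NormedAddCommGroup E] [NormedSpace ℝ E] {G : X → E} {Q : Set X} (hQ : IsCompact Q)
    (hG : Continuous G) (ho : IsOpen (G '' interior Q)) {D : Set E} (h1 : G '' interior Q ⊆ D)
    (h2 : D ⊆ G '' Q) {x : E} {δ : ℝ} (hx : x ∈ crossingSet D δ) :
    ∃ c ∈ frontier Q, dist x (G c) ≤ δ := by
  obtain ⟨y, hxy, hD⟩ := hx
  suffices h : ∃ c ∈ frontier Q, G c ∈ segment ℝ x y by
    obtain ⟨c, hc, hs⟩ := h
    refine ⟨c, hc, le_trans ?_ hxy⟩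
    have := dist_add_dist_of_mem_segment hs
    linarith [dist_nonneg (x := G c) (y := y)]
  by_contra! hno
  have hpre : IsPreconnected (segment ℝ x y) := (convex_segment x y).isPreconnected
  have hcl : IsOpen (G '' Q)ᶜ := (hQ.image hG).isClosed.isOpen_compl
  have hcov : ∀ z ∈ segment ℝ x y, z ∈ G '' Q → z ∈ G '' interior Q := by
    rintro z hz ⟨c, hc, rfl⟩
    refine ⟨c, ?_, rfl⟩
    by_contra hci
    exact hno c (by rw [hQ.isClosed.frontier_eq]; exact ⟨hc, hci⟩) hz
  have hxs := left_mem_segment ℝ x y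
  have hys := right_mem_segment ℝ x y
  have hkey : ∀ a ∈ segment ℝ x y, ∀ b ∈ segment ℝ x y, a ∈ D → b ∉ D → False := by
    intro a ha b hb haD hbD
    obtain ⟨z, -, hz1, hz2⟩ := hpre (G '' interior Q) (G '' Q)ᶜ ho hcl
      (fun z hz => or_iff_not_imp_right.mpr fun h => hcov z hz (not_not.mp h))
      ⟨a, ha, hcov a ha (h2 haD)⟩ ⟨b, hb, fun h => hbD (h1 (hcov b hb h))⟩
    exact hz2 (image_mono interior_subset hz1)
  by_cases hxD : x ∈ D
  · exact hkey x hxs y hys hxD (by tauto)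
  · exact hkey y hys x hxs (by tauto) hxD

/-- The boundary of the unit cube is covered by few small balls. -/
theorem exists_finset_cover_frontier_cube (ι : Type*) [Fintype ι] {N : ℕ} (hN : 0 < N) :
    ∃ P : Finset (ι → ℝ), (P : Set (ι → ℝ)) ⊆ univ.pi (fun _ => Icc 0 1) ∧
      P.card ≤ 2 * Fintype.card ι * (N + 1) ^ (Fintype.card ι - 1) ∧
      ∀ c ∈ frontier (univ.pi fun _ : ι => Icc (0 : ℝ) 1), ∃ p ∈ P, dist c p ≤ 1 / N := by
  classical
  have hN' : (0 : ℝ) < N := by exact_mod_cast hN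
  let A : Finset ℝ := (Finset.range (N + 1)).image fun k : ℕ => (k : ℝ) / N
  have hA : ∀ a ∈ A, a ∈ Icc (0 : ℝ) 1 := by
    intro a ha
    obtain ⟨k, hk, rfl⟩ := Finset.mem_image.mp ha
    refine ⟨by positivity, (div_le_one hN').mpr ?_⟩
    exact_mod_cast Nat.lt_succ_iff.mp (Finset.mem_range.mp hk)
  have hAc : A.card ≤ N + 1 := Finset.card_image_le.trans (Finset.card_range _).le
  let F : ι × Bool → Finset (ι → ℝ) := fun q =>
    Fintype.piFinset fun j => if j = q.1 then {if q.2 then 1 else 0} else A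
  refine ⟨Finset.univ.biUnion F, ?_, ?_, ?_⟩
  · intro p hp j _
    simp only [Finset.coe_biUnion, Finset.coe_univ, mem_univ, iUnion_true, mem_iUnion,
      Finset.mem_coe, F, Fintype.mem_piFinset] at hp
    obtain ⟨q, hq⟩ := hp
    have hj := hq j
    split_ifs at hj with h1 h2
    · rw [Finset.mem_singleton.mp hj]; simp
    · rw [Finset.mem_singleton.mp hj]; simp
    · exact hA _ hj
  · refine (Finset.card_biUnion_le_card_mul _ _ ((N + 1) ^ (Fintype.card ι - 1)) ?_).trans_eq ?_
    · intro q _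
      rw [Fintype.card_piFinset, ← Finset.mul_prod_erase _ _ (Finset.mem_univ q.1)]
      simp only [if_true, Finset.card_singleton, one_mul]
      refine (Finset.prod_le_pow_card _ _ (N + 1) fun j hj => ?_).trans_eq ?_
      · rw [if_neg (Finset.ne_of_mem_erase hj)]; exact hAc
      · rw [Finset.card_erase_of_mem (Finset.mem_univ _), Finset.card_univ]
    · rw [Finset.card_univ, Fintype.card_prod, Fintype.card_bool, mul_comm (Fintype.card ι)]
  · intro c hc
    have hcl : IsClosed (univ.pi fun _ : ι => Icc (0 : ℝ) 1) :=
      isClosed_set_pi fun _ _ => isClosed_Icc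
    rw [hcl.frontier_eq, interior_pi_set finite_univ] at hc
    obtain ⟨hc, hci⟩ := hc
    simp only [interior_Icc, Set.mem_pi, mem_univ, forall_const, not_forall] at hci hc
    obtain ⟨i, hi⟩ := hci
    have hci' : c i = 0 ∨ c i = 1 := by
      rcases (hc i).1.eq_or_lt with h | h
      · exact Or.inl h.symm
      · rcases (hc i).2.eq_or_lt with h' | h'
        · exact Or.inr h'
        · exact absurd ⟨h, h'⟩ hi
    refine ⟨fun j => if j = i then c i else (⌊c j * N⌋₊ : ℝ) / N, ?_, ?_⟩
    · rw [Finset.mem_biUnion]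
      refine ⟨(i, decide (c i = 1)), Finset.mem_univ _, ?_⟩
      rw [Fintype.mem_piFinset]
      intro j
      by_cases hj : j = i
      · simp only [hj, if_true, Finset.mem_singleton]
        rcases hci' with h | h <;> simp [h]
      · simp only [hj, if_false]
        refine Finset.mem_image.mpr ⟨_, Finset.mem_range.mpr (Nat.lt_succ_of_le ?_), rfl⟩
        refine Nat.floor_le_of_le ?_
        have := mul_le_mul_of_nonneg_right (hc j).2 hN'.le
        simpa using this
    · refine (dist_pi_le_iff (by positivity)).mpr fun j => ?_
      by_cases hj : j = i
      · simp [hj]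
      · simp only [hj, if_false, Real.dist_eq]
        have h0 : 0 ≤ c j * N := mul_nonneg (hc j).1 hN'.le
        have h1 := Nat.floor_le h0
        have h2 := Nat.lt_floor_add_one (c j * N)
        have h3 : c j - (⌊c j * N⌋₊ : ℝ) / N = (c j * N - ⌊c j * N⌋₊) / N := by field_simp
        rw [h3, abs_of_nonneg (by apply div_nonneg <;> linarith)]
        gcongr
        linarith

theorem volume_setOf_abs_norm_sub_le_real (a ρ : ℝ) :
    volume {x : ℝ | |‖x‖ - a| ≤ ρ} ≤ ENNReal.ofReal (4 * ρ) := by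
  have hsub : {x : ℝ | |‖x‖ - a| ≤ ρ} ⊆ Metric.closedBall a ρ ∪ Metric.closedBall (-a) ρ := by
    intro x hx
    rw [mem_ofPred_eq, Real.norm_eq_abs] at hx
    rcases abs_cases x with ⟨h, -⟩ | ⟨h, -⟩
    · left; rwa [Metric.mem_closedBall, Real.dist_eq, ← h]
    · right
      rw [h] at hx
      rwa [Metric.mem_closedBall, Real.dist_eq, ← abs_neg, neg_sub, sub_eq_add_neg, add_comm,
        add_comm, ← sub_eq_add_neg, show -a - x = -x - a by ring]
  rcases le_or_gt 0 ρ with h | h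
  · refine (measure_mono hsub).trans ((measure_union_le _ _).trans_eq ?_)
    rw [Real.volume_closedBall, Real.volume_closedBall, ← ENNReal.ofReal_add (by positivity)
      (by positivity)]
    congr 1; ring
  · have : {x : ℝ | |‖x‖ - a| ≤ ρ} = ∅ := by
      ext x; simpa using h.trans_le (abs_nonneg _)
    rw [this, measure_empty]; exact zero_le

theorem volume_setOf_abs_norm_sub_le_complex {a ρ M : ℝ} (ha : a ≤ M) (hρ0 : 0 ≤ ρ) (hρ : ρ ≤ M) :
    volume {x : ℂ | |‖x‖ - a| ≤ ρ} ≤ ENNReal.ofReal (4 * Real.pi * M * ρ) := by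
  have hM : 0 ≤ M := hρ0.trans hρ
  have hb : ∀ r : ℝ, 0 ≤ r → volume (Metric.closedBall (0 : ℂ) r) = ENNReal.ofReal (Real.pi * r ^ 2) := by
    intro r hr
    rw [Complex.volume_closedBall, ENNReal.ofReal_mul Real.pi_pos.le, ENNReal.ofReal_pow hr, mul_comm,
      ← NNReal.coe_real_pi, ENNReal.ofReal_coe_nnreal]
  have hb' : ∀ r : ℝ, 0 ≤ r → volume (Metric.ball (0 : ℂ) r) = ENNReal.ofReal (Real.pi * r ^ 2) := by
    intro r hr
    rw [Complex.volume_ball, ENNReal.ofReal_mul Real.pi_pos.le, ENNReal.ofReal_pow hr, mul_comm,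
      ← NNReal.coe_real_pi, ENNReal.ofReal_coe_nnreal]
  rcases le_or_gt ρ a with h | h
  · have hsub : {x : ℂ | |‖x‖ - a| ≤ ρ} ⊆
        Metric.closedBall 0 (a + ρ) \ Metric.ball 0 (a - ρ) := by
      intro x hx
      rw [mem_ofPred_eq, abs_le] at hx
      simp only [Set.mem_sdiff, mem_closedBall_zero_iff, mem_ball_zero_iff, not_lt]
      constructor <;> linarith
    refine (measure_mono hsub).trans ?_
    rw [measure_sdiff (Metric.ball_subset_closedBall.trans
      (Metric.closedBall_subset_closedBall (by linarith)))
      measurableSet_ball.nullMeasurableSet measure_ball_lt_top.ne, hb _ (by linarith),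
      hb' _ (by linarith), ← ENNReal.ofReal_sub _ (by positivity)]
    refine ENNReal.ofReal_le_ofReal ?_
    have : Real.pi * (a + ρ) ^ 2 - Real.pi * (a - ρ) ^ 2 = 4 * Real.pi * a * ρ := by ring
    rw [this]
    gcongr
  · have hsub : {x : ℂ | |‖x‖ - a| ≤ ρ} ⊆ Metric.closedBall 0 (2 * ρ) := by
      intro x hx
      rw [mem_ofPred_eq, abs_le] at hx
      rw [mem_closedBall_zero_iff]
      linarith
    refine (measure_mono hsub).trans ?_
    rw [hb _ (by linarith)]
    refine ENNReal.ofReal_le_ofReal ?_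
    have : Real.pi * (2 * ρ) ^ 2 = 4 * Real.pi * ρ * ρ := by ring
    rw [this]
    gcongr

end

section

open Filter Topology MeasureTheory Set NumberField NumberField.InfinitePlace
  NumberField.mixedEmbedding NumberField.mixedEmbedding.fundamentalCone NumberField.Units
  NumberField.Units.dirichletUnitTheorem

/-- The closed unit cube of `realSpace K`. -/
def unitCube (K : Type*) [Field K] : Set (realSpace K) := univ.pi fun _ => Icc 0 1

theorem isCompact_unitCube {K : Type*} [Field K] : IsCompact (unitCube K) :=
  isCompact_univ_pi fun _ => isCompact_Icc

variable {K : Type*} [Field K] [NumberField K]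

open Classical in
theorem dist_normAtAllPlaces_le (x y : mixedSpace K) :
    dist (normAtAllPlaces x) (normAtAllPlaces y) ≤ dist x y := by
  refine (dist_pi_le_iff dist_nonneg).mpr fun w => ?_
  rw [normAtAllPlaces_apply, normAtAllPlaces_apply, Real.dist_eq]
  rcases isReal_or_isComplex w with hw | hw
  · rw [normAtPlace_apply_of_isReal hw, normAtPlace_apply_of_isReal hw]
    refine (abs_norm_sub_norm_le _ _).trans ?_
    rw [← dist_eq_norm]
    exact (dist_le_pi_dist x.1 y.1 ⟨w, hw⟩).trans (le_max_left _ _)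
  · rw [normAtPlace_apply_of_isComplex hw, normAtPlace_apply_of_isComplex hw]
    refine (abs_norm_sub_norm_le _ _).trans ?_
    rw [← dist_eq_norm]
    exact (dist_le_pi_dist x.2 y.2 ⟨w, hw⟩).trans (le_max_right _ _)

open Classical in
theorem volume_preimage_closedBall_le (z : realSpace K) {M ρ : ℝ} (hz : ∀ w, z w ≤ M)
    (hρ0 : 0 ≤ ρ) (hρ : ρ ≤ M) :
    volume (normAtAllPlaces ⁻¹' Metric.closedBall z ρ : Set (mixedSpace K)) ≤
      ENNReal.ofReal (((4 + 4 * Real.pi * M) * ρ) ^ Fintype.card (InfinitePlace K)) := by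
  classical
  have hM : 0 ≤ M := hρ0.trans hρ
  have hsub : (normAtAllPlaces ⁻¹' Metric.closedBall z ρ : Set (mixedSpace K)) ⊆
      (univ.pi fun w : {w : InfinitePlace K // IsReal w} => {x : ℝ | |‖x‖ - z w| ≤ ρ}) ×ˢ
      (univ.pi fun w : {w : InfinitePlace K // IsComplex w} => {x : ℂ | |‖x‖ - z w| ≤ ρ}) := by
    intro x hx
    have hx' : ∀ w, |normAtPlace w x - z w| ≤ ρ := fun w => by
      have := (dist_le_pi_dist _ _ w).trans (Metric.mem_closedBall.mp hx)
      rwa [normAtAllPlaces_apply, Real.dist_eq] at this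
    refine ⟨fun w _ => ?_, fun w _ => ?_⟩
    · have := hx' w
      rwa [normAtPlace_apply_of_isReal w.2] at this
    · have := hx' w
      rwa [normAtPlace_apply_of_isComplex w.2] at this
  refine (measure_mono hsub).trans ?_
  rw [Measure.volume_eq_prod, Measure.prod_prod, volume_pi_pi, volume_pi_pi]
  have h1 : ∏ w : {w : InfinitePlace K // IsReal w}, volume {x : ℝ | |‖x‖ - z w| ≤ ρ} ≤
      ENNReal.ofReal ((4 + 4 * Real.pi * M) * ρ) ^ nrRealPlaces K := by
    refine Finset.prod_le_pow_card _ _ _ fun w _ => ?_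
    refine (volume_setOf_abs_norm_sub_le_real _ _).trans (ENNReal.ofReal_le_ofReal ?_)
    gcongr
    linarith [mul_nonneg (mul_nonneg zero_le_four Real.pi_pos.le) hM]
  have h2 : ∏ w : {w : InfinitePlace K // IsComplex w}, volume {x : ℂ | |‖x‖ - z w| ≤ ρ} ≤
      ENNReal.ofReal ((4 + 4 * Real.pi * M) * ρ) ^ nrComplexPlaces K := by
    refine Finset.prod_le_pow_card _ _ _ fun w _ => ?_
    refine (volume_setOf_abs_norm_sub_le_complex (hz w) hρ0 hρ).trans (ENNReal.ofReal_le_ofReal ?_)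
    gcongr
    linarith
  refine (mul_le_mul' h1 h2).trans_eq ?_
  rw [← pow_add, ENNReal.ofReal_pow (by positivity), card_eq_nrRealPlaces_add_nrComplexPlaces]

variable (K) in
open Classical in
/-- The map `expMapBasis`, reparametrized so that the coordinate at `w₀` is the exponential of the
original one. It extends smoothly to the whole space. -/
noncomputable def mulMapBasis (c : realSpace K) : realSpace K :=
  c w₀ • fun w : InfinitePlace K =>
    ∏ i : {w // w ≠ w₀}, w (fundSystem K (equivFinRank.symm i)) ^ c i

open Classical in
theorem mulMapBasis_update_exp (c : realSpace K) :
    mulMapBasis K (Function.update c w₀ (Real.exp (c w₀))) = expMapBasis c := by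
  rw [expMapBasis_apply', mulMapBasis, Function.update_self]
  congr 1
  ext w
  refine Finset.prod_congr rfl fun i _ => ?_
  rw [Function.update_of_ne i.2]

theorem contDiff_mulMapBasis : ContDiff ℝ 1 (mulMapBasis K) := by
  classical
  unfold mulMapBasis
  refine contDiff_pi.mpr fun w => ?_
  simp only [Pi.smul_apply, smul_eq_mul]
  refine (contDiff_apply ℝ ℝ _).mul (contDiff_prod fun i _ => ?_)
  have h : 0 < w (fundSystem K (equivFinRank.symm i) : K) := by
    simp [InfinitePlace.pos_iff]
  simp_rw [Real.rpow_def_of_pos h]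
  exact Real.contDiff_exp.comp (contDiff_const.mul (contDiff_apply ℝ ℝ _))

theorem interior_unitCube : interior (unitCube K) = univ.pi fun _ => Ioo 0 1 := by
  rw [unitCube, interior_pi_set finite_univ]
  simp

theorem mulMapBasis_image_interior_unitCube :
    mulMapBasis K '' interior (unitCube K) = expMapBasis '' interior (paramSet K) := by
  classical
  rw [interior_unitCube, interior_paramSet]
  ext x
  constructor
  · rintro ⟨c, hc, rfl⟩
    refine ⟨Function.update c w₀ (Real.log (c w₀)), fun w _ => ?_, ?_⟩
    · by_cases hw : w = w₀
      · subst hw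
        have := hc w₀ trivial
        simpa using Real.log_neg this.1 this.2
      · simpa [hw] using hc w trivial
    · rw [← mulMapBasis_update_exp]
      simp [Real.exp_log (hc w₀ trivial).1]
  · rintro ⟨c, hc, rfl⟩
    refine ⟨_, fun w _ => ?_, mulMapBasis_update_exp c⟩
    have := hc w trivial
    by_cases hw : w = w₀
    · subst hw
      simp only [if_true, mem_Iio] at this
      simpa using ⟨Real.exp_pos _, this⟩
    · simpa [hw] using this

theorem expMapBasis_image_paramSet_subset :
    expMapBasis '' (paramSet K) ⊆ mulMapBasis K '' unitCube K := by
  classical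
  rintro _ ⟨c, hc, rfl⟩
  refine ⟨_, fun w _ => ?_, mulMapBasis_update_exp c⟩
  have := hc w trivial
  by_cases hw : w = w₀
  · subst hw
    simp only [if_true, mem_Iic] at this
    simpa using ⟨(Real.exp_pos _).le, this⟩
  · simp only [hw, if_false] at this
    simpa [hw] using ⟨this.1, this.2.le⟩

variable (K) in
open Classical in
/-- The neighbourhoods of the boundary of `normLeOne K` have volume at most proportional to their
width. -/
theorem exists_measureReal_crossingSet_normLeOne_le :
    ∃ C, ∀ δ, 0 < δ → δ ≤ 1 → volume.real (crossingSet (normLeOne K) δ) ≤ C * δ := by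
  classical
  set m := Fintype.card (InfinitePlace K) with hm
  have hm0 : 0 < m := Fintype.card_pos
  obtain ⟨L, hL⟩ := contDiff_mulMapBasis (K := K).contDiffOn.exists_lipschitzOnWith one_ne_zero
    (convex_pi fun _ _ => convex_Icc 0 1 : Convex ℝ (unitCube K)) (isCompact_unitCube (K := K))
  obtain ⟨M₀, hM₀⟩ := ((isCompact_unitCube (K := K)).image
    (contDiff_mulMapBasis (K := K)).continuous).isBounded.exists_norm_le
  set M := max M₀ (L + 1) with hM
  have hM0 : 0 ≤ M := le_max_of_le_right (by positivity)
  set B := 4 + 4 * Real.pi * M with hB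
  have hB0 : 0 ≤ B := by positivity
  refine ⟨2 * m * 3 ^ (m - 1) * (B * (L + 1)) ^ m, fun δ hδ hδ1 => ?_⟩
  set N := ⌈1 / δ⌉₊ with hN
  have hN0 : 0 < N := Nat.ceil_pos.mpr (by positivity)
  have hN0' : (0 : ℝ) < N := by exact_mod_cast hN0
  have hNδ : 1 / (N : ℝ) ≤ δ := by
    rw [one_div_le hN0' hδ]
    exact Nat.le_ceil _
  have hN3 : (N : ℝ) + 1 ≤ 3 / δ := by
    have h1 := (Nat.ceil_lt_add_one (by positivity : 0 ≤ 1 / δ)).le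
    have h2 : 1 ≤ 1 / δ := (one_le_div hδ).mpr hδ1
    have h3 : 3 / δ = 1 / δ + 1 / δ + 1 / δ := by ring
    rw [h3]; linarith
  obtain ⟨P, hPsub, hPcard, hP⟩ := exists_finset_cover_frontier_cube (InfinitePlace K) hN0
  set ρ := (L + 1) * δ with hρ
  have hcov : crossingSet (normLeOne K) δ ⊆
      ⋃ p ∈ P, (normAtAllPlaces ⁻¹' Metric.closedBall (mulMapBasis K p) ρ : Set (mixedSpace K)) := by
    rintro x ⟨y, hxy, hD⟩
    rw [normLeOne_eq_preimage] at hD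
    obtain ⟨c, hc, hxc⟩ := exists_mem_frontier_of_mem_crossingSet isCompact_unitCube
      contDiff_mulMapBasis.continuous
      (by
        rw [mulMapBasis_image_interior_unitCube]
        exact expMapBasis.isOpen_image_of_subset_source isOpen_interior
          (by rw [expMapBasis_source]; exact subset_univ _))
      (by
        rw [mulMapBasis_image_interior_unitCube]
        exact image_mono interior_subset)
      expMapBasis_image_paramSet_subset
      (⟨_, (dist_normAtAllPlaces_le x y).trans hxy, hD⟩ :
        normAtAllPlaces x ∈ crossingSet (expMapBasis '' paramSet K) δ)
    obtain ⟨p, hp, hcp⟩ := hP c hc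
    simp only [mem_iUnion, exists_prop]
    refine ⟨p, hp, ?_⟩
    rw [mem_preimage, Metric.mem_closedBall]
    have h1 := hL.dist_le_mul c (isCompact_unitCube.isClosed.frontier_subset hc) p (hPsub hp)
    calc _ ≤ dist (normAtAllPlaces x) (mulMapBasis K c) +
          dist (mulMapBasis K c) (mulMapBasis K p) := dist_triangle _ _ _
      _ ≤ δ + L * δ := add_le_add hxc (h1.trans (by gcongr; exact hcp.trans hNδ))
      _ = ρ := by rw [hρ]; ring
  have hρM : ρ ≤ M := by
    refine le_trans ?_ (le_max_right _ _)
    rw [hρ]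
    exact mul_le_of_le_one_right (by positivity) hδ1
  have hvol : volume (crossingSet (normLeOne K) δ) ≤ ENNReal.ofReal (P.card * (B * ρ) ^ m) := by
    refine (measure_mono hcov).trans ((measure_biUnion_finset_le _ _).trans ?_)
    refine (Finset.sum_le_card_nsmul _ _ _ fun p hp =>
      volume_preimage_closedBall_le (M := M) _ (fun w => ?_) (by positivity) hρM).trans_eq ?_
    · refine (le_abs_self _).trans ((norm_le_pi_norm (mulMapBasis K p) w).trans ?_)
      exact (hM₀ _ ⟨p, hPsub hp, rfl⟩).trans (le_max_left _ _)
    · rw [nsmul_eq_mul, ENNReal.ofReal_mul (by positivity), ENNReal.ofReal_natCast]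
  refine (ENNReal.toReal_mono ENNReal.ofReal_ne_top hvol).trans ?_
  rw [ENNReal.toReal_ofReal (by positivity)]
  have hPc : (P.card : ℝ) ≤ 2 * m * (3 / δ) ^ (m - 1) := by
    have : (P.card : ℝ) ≤ 2 * m * ((N : ℝ) + 1) ^ (m - 1) := by exact_mod_cast hPcard
    refine this.trans ?_
    gcongr
  calc (P.card : ℝ) * (B * ρ) ^ m ≤ 2 * m * (3 / δ) ^ (m - 1) * (B * ρ) ^ m := by gcongr
    _ = 2 * m * 3 ^ (m - 1) * (B * (L + 1)) ^ m * (δ ^ m / δ ^ (m - 1)) := by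
      rw [hρ, ← mul_assoc, mul_pow _ δ, div_pow]; ring
    _ = _ := by
      obtain ⟨k, hk⟩ : ∃ k, m = k + 1 := ⟨m - 1, by omega⟩
      have : δ ^ m / δ ^ (m - 1) = δ := by
        rw [hk, Nat.add_sub_cancel, pow_succ, mul_div_cancel_left₀ _ (by positivity)]
      rw [this]

end

section

open Filter Topology MeasureTheory Set NumberField NumberField.InfinitePlace Asymptotics
  NumberField.mixedEmbedding NumberField.mixedEmbedding.fundamentalCone NumberField.Units
  Pointwise nonZeroDivisors

variable (K : Type*) [Field K] [NumberField K]

theorem card_absNorm_le_and_mk_eq {C : ClassGroup (𝓞 K)} {J : (Ideal (𝓞 K))⁰}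
    (hJ : ClassGroup.mk0 J = C⁻¹) (s : ℝ) :
    Nat.card {I : (Ideal (𝓞 K))⁰ // Ideal.absNorm (I : Ideal (𝓞 K)) ≤ s ∧ ClassGroup.mk0 I = C} =
      Nat.card {I : (Ideal (𝓞 K))⁰ // (J : Ideal (𝓞 K)) ∣ I ∧
        Submodule.IsPrincipal (I : Ideal (𝓞 K)) ∧
        Ideal.absNorm (I : Ideal (𝓞 K)) ≤ s * Ideal.absNorm (J : Ideal (𝓞 K))} := by
  simp_rw [← nonZeroDivisors_dvd_iff_dvd_coe]
  refine Nat.card_congr ?_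
  refine ((Equiv.dvd J).subtypeEquiv fun I => ?_).trans
    (Equiv.subtypeSubtypeEquivSubtypeInter (fun I : (Ideal (𝓞 K))⁰ => J ∣ I) _)
  rw [← ClassGroup.mk0_eq_one_iff (SetLike.coe_mem _)]
  simp_rw [Equiv.dvd_apply, Submonoid.coe_mul, ← Submonoid.mul_def, _root_.map_mul, hJ,
    inv_mul_eq_one, Nat.cast_mul, mul_comm s, eq_comm, and_comm, and_congr_left_iff]
  exact fun _ =>
    (mul_le_mul_iff_of_pos_left (Nat.cast_pos.mpr (Ideal.absNorm_pos_of_nonZeroDivisors J))).symm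

variable {K} in
theorem card_idealSet_norm_le (J : (Ideal (𝓞 K))⁰) {t : ℝ} (ht : 0 < t) :
    Nat.card {a : idealSet K J // mixedEmbedding.norm (a : mixedSpace K) ≤
      t ^ Module.finrank ℚ K} =
    Nat.card (t • normLeOne K ∩ idealLattice K (FractionalIdeal.mk0 K J) : Set (mixedSpace K)) := by
  refine Nat.card_congr ((Equiv.subtypeSubtypeEquivSubtypeInter (· ∈ idealSet K J)
    (mixedEmbedding.norm · ≤ t ^ Module.finrank ℚ K)).trans (Equiv.subtypeEquivProp ?_))
  ext x
  have h : mixedEmbedding.norm (t⁻¹ • x) ≤ 1 ↔ mixedEmbedding.norm x ≤ t ^ Module.finrank ℚ K := by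
    rw [mixedEmbedding.norm_smul, abs_of_pos (inv_pos.mpr ht), inv_pow,
      inv_mul_le_one₀ (by positivity)]
  simp only [idealSet, mem_inter_iff, mem_smul_set_iff_inv_smul_mem₀ ht.ne',
    smul_mem_iff_mem (inv_ne_zero ht.ne')]
  change (_ ∧ _) ∧ _ ↔ (_ ∧ _) ∧ _
  tauto

/-- The number of ideals of norm at most `s` in a fixed class, with a power-saving error term. -/
theorem exists_card_absNorm_le_and_mk_eq_sub_isBigO (C : ClassGroup (𝓞 K)) :
    ∃ κ : ℝ, (fun s : ℝ => (Nat.card {I : (Ideal (𝓞 K))⁰ //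
      Ideal.absNorm (I : Ideal (𝓞 K)) ≤ s ∧ ClassGroup.mk0 I = C} : ℝ) - κ * s) =O[atTop]
        fun s : ℝ => s ^ (1 - 1 / (Module.finrank ℚ K : ℝ)) := by
  classical
  set n := Module.finrank ℚ K with hn
  have hn0 : (n : ℝ) ≠ 0 := Nat.cast_ne_zero.mpr Module.finrank_pos.ne'
  obtain ⟨J, hJ⟩ := ClassGroup.mk0_surjective C⁻¹
  obtain ⟨A, hA⟩ := exists_measureReal_crossingSet_normLeOne_le K
  obtain ⟨R, hR, h⟩ := exists_abs_card_smul_inter_sub_le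
    (idealLattice K (FractionalIdeal.mk0 K J)) volume (isBounded_normLeOne K) hA
  set v := volume.real (normLeOne K) /
    ZLattice.covolume (idealLattice K (FractionalIdeal.mk0 K J)) volume with hv
  set B := A * R / ZLattice.covolume (idealLattice K (FractionalIdeal.mk0 K J)) volume with hB
  rw [mixedEmbedding.finrank, ← hn] at h
  set j : ℝ := ((Ideal.absNorm (J : Ideal (𝓞 K)) : ℕ) : ℝ) with hj
  have hj0 : 0 < j := Nat.cast_pos.mpr (Ideal.absNorm_pos_of_nonZeroDivisors J)
  set w : ℝ := ((torsionOrder K : ℕ) : ℝ) with hw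
  have hw0 : 0 < w := Nat.cast_pos.mpr (torsionOrder_pos K)
  refine ⟨v * j / w, IsBigO.of_bound (B * j ^ (1 - 1 / (n : ℝ)) / w) ?_⟩
  have htend : Tendsto (fun s : ℝ => (s * j) ^ (1 / (n : ℝ))) atTop atTop :=
    (tendsto_rpow_atTop (by positivity)).comp (tendsto_id.atTop_mul_const hj0)
  filter_upwards [htend.eventually_ge_atTop R, eventually_gt_atTop 0] with s hs hs0
  have hsj : 0 < s * j := by positivity
  set t := (s * j) ^ (1 / (n : ℝ)) with ht
  have ht0 : 0 < t := hR.trans_le hs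
  have htn : t ^ n = s * j := by
    rw [ht, ← Real.rpow_mul_natCast hsj.le, one_div_mul_cancel hn0, Real.rpow_one]
  have h1 := h t hs
  have hcard : (Nat.card {I : (Ideal (𝓞 K))⁰ //
      Ideal.absNorm (I : Ideal (𝓞 K)) ≤ s ∧ ClassGroup.mk0 I = C} : ℝ) * w =
      Nat.card (t • normLeOne K ∩ idealLattice K (FractionalIdeal.mk0 K J) : Set (mixedSpace K)) := by
    rw [card_absNorm_le_and_mk_eq K hJ, hw, ← Nat.cast_mul, card_isPrincipal_dvd_norm_le,
      ← card_idealSet_norm_le J ht0, ← hn, htn]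
  rw [← hcard, htn] at h1
  have h2 : t ^ ((n : ℝ) - 1) = j ^ (1 - 1 / (n : ℝ)) * s ^ (1 - 1 / (n : ℝ)) := by
    rw [ht, ← Real.rpow_mul hsj.le, mul_comm s, Real.mul_rpow hj0.le hs0.le]
    congr 2 <;> field_simp
  rw [h2] at h1
  rw [Real.norm_eq_abs, Real.norm_of_nonneg (by positivity)]
  have h3 : ∀ N : ℝ, N - v * j / w * s = (N * w - v * (s * j)) / w := fun N => by field_simp
  rw [h3, abs_div, abs_of_pos hw0, div_le_iff₀ hw0]
  refine h1.trans_eq ?_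
  field_simp

theorem card_absNorm_le_eq_sum (s : ℝ) (hs : 0 ≤ s) :
    Nat.card {I : (Ideal (𝓞 K))⁰ // Ideal.absNorm (I : Ideal (𝓞 K)) ≤ s} =
      ∑ C : ClassGroup (𝓞 K), Nat.card {I : (Ideal (𝓞 K))⁰ //
        Ideal.absNorm (I : Ideal (𝓞 K)) ≤ s ∧ ClassGroup.mk0 I = C} := by
  classical
  have : Fintype {I : (Ideal (𝓞 K))⁰ // Ideal.absNorm (I : Ideal (𝓞 K)) ≤ s} := by
    simp_rw [← Nat.le_floor_iff hs]
    exact @Fintype.ofFinite _ (Ideal.finite_setOfPred_absNorm_le₀ ⌊s⌋₊)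
  let e := fun C : ClassGroup (𝓞 K) => Equiv.subtypeSubtypeEquivSubtypeInter
    (fun I : (Ideal (𝓞 K))⁰ => Ideal.absNorm I.1 ≤ s) (fun I => ClassGroup.mk0 I = C)
  simp_rw [← Nat.card_congr (e _), Nat.card_eq_fintype_card, Fintype.subtype_card]
  rw [Fintype.card, Finset.card_eq_sum_card_fiberwise (f := fun I => ClassGroup.mk0 I.1)
    (t := Finset.univ) (fun _ _ => Finset.mem_univ _)]

theorem summatory_card_idealsOfNorm (s : ℝ) (hs : 0 ≤ s) :
    summatory (fun n => ((idealsOfNorm K n).card : ℝ)) s =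
      Nat.card {I : (Ideal (𝓞 K))⁰ // Ideal.absNorm (I : Ideal (𝓞 K)) ≤ s} := by
  classical
  rw [summatory, ← Nat.cast_sum, ← Finset.card_biUnion]
  · congr 1
    symm
    rw [← Nat.subtype_card (p := (· ∈ (Finset.Icc 1 ⌊s⌋₊).biUnion (idealsOfNorm K))) _
      fun _ => Iff.rfl]
    have hmem : ∀ I : Ideal (𝓞 K), I ∈ (Finset.Icc 1 ⌊s⌋₊).biUnion (idealsOfNorm K) ↔
        I ∈ (Ideal (𝓞 K))⁰ ∧ Ideal.absNorm I ≤ s := by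
      intro I
      rw [mem_nonZeroDivisors_iff_ne_zero, ← Nat.le_floor_iff hs, ne_eq, Submodule.zero_eq_bot,
        ← Ideal.absNorm_eq_zero_iff]
      simp [Nat.one_le_iff_ne_zero]
    simp_rw [hmem]
    exact Nat.card_congr (Equiv.subtypeSubtypeEquivSubtypeInter (· ∈ (Ideal (𝓞 K))⁰)
      (fun I => Ideal.absNorm I ≤ s))
  · intro a _ b _ hab
    refine Finset.disjoint_left.mpr fun I hI hI' => hab ?_
    rw [← mem_idealsOfNorm.mp hI, mem_idealsOfNorm.mp hI']

/-- The number of ideals of norm at most `x`, with a power-saving error term. -/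
theorem exists_summatory_card_idealsOfNorm_sub_isBigO :
    ∃ κ : ℝ, κ ≠ 0 ∧ ∃ θ : ℝ, θ < 1 ∧
      (fun x : ℝ => summatory (fun n => ((idealsOfNorm K n).card : ℝ)) x - κ * x) =O[atTop]
        fun x : ℝ => x ^ θ := by
  choose κ hκ using exists_card_absNorm_le_and_mk_eq_sub_isBigO K
  have hn0 : 0 < (Module.finrank ℚ K : ℝ) := Nat.cast_pos.mpr Module.finrank_pos
  set θ := 1 - 1 / (Module.finrank ℚ K : ℝ) with hθ
  have hθ1 : θ < 1 := by rw [hθ]; linarith [one_div_pos.mpr hn0]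
  have hsum : (fun x => summatory (fun n => ((idealsOfNorm K n).card : ℝ)) x - (∑ C, κ C) * x)
      =O[atTop] fun x : ℝ => x ^ θ := by
    refine (IsBigO.sum (s := Finset.univ) fun C _ => hκ C).congr' ?_ EventuallyEq.rfl
    filter_upwards [eventually_ge_atTop 0] with s hs
    try simp only [Finset.sum_apply]
    rw [summatory_card_idealsOfNorm K s hs, card_absNorm_le_eq_sum K s hs, Finset.sum_mul,
      Nat.cast_sum, ← Finset.sum_sub_distrib]
  refine ⟨∑ C, κ C, ?_, θ, hθ1, hsum⟩
  have hlim := NumberField.Ideal.tendsto_norm_le_div_atTop₀ K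
  have hlim' : Tendsto (fun s : ℝ => (Nat.card {I : (Ideal (𝓞 K))⁰ //
      Ideal.absNorm (I : Ideal (𝓞 K)) ≤ s} : ℝ) / s) atTop (𝓝 (∑ C, κ C)) := by
    have h1 : (fun x : ℝ => x ^ θ) =o[atTop] fun x : ℝ => x := by
      refine (isLittleO_iff_tendsto' ?_).mpr ?_
      · filter_upwards [eventually_gt_atTop 0] with x hx h0
        exact absurd h0 hx.ne'
      · refine (tendsto_rpow_neg_atTop (y := 1 - θ) (by linarith)).congr' ?_
        filter_upwards [eventually_gt_atTop 0] with x hx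
        rw [neg_sub, Real.rpow_sub_one hx.ne']
    have h2 := (hsum.trans_isLittleO h1).tendsto_div_nhds_zero.add_const (∑ C, κ C)
    rw [zero_add] at h2
    refine h2.congr' ?_
    filter_upwards [eventually_gt_atTop 0] with s hs
    rw [summatory_card_idealsOfNorm K s hs.le]
    field_simp
    ring
  rw [tendsto_nhds_unique hlim' hlim]
  have := regulator_pos K
  have h1 : 0 < classNumber K := Fintype.card_pos
  have h2 : (0 : ℝ) < |(discr K : ℝ)| := abs_pos.mpr (Int.cast_ne_zero.mpr (discr_ne_zero K))
  have h3 := torsionOrder_pos K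
  positivity

/-- The prime ideal theorem. -/
theorem tendsto_card_primesOfNormLe_mul_log_div :
    Tendsto (fun N : ℕ => ((primesOfNormLe K N).card : ℝ) * Real.log N / N) atTop (𝓝 1) := by
  obtain ⟨κ, hκ, θ, hθ, h⟩ := exists_summatory_card_idealsOfNorm_sub_isBigO K
  exact tendsto_card_primesOfNormLe hκ hθ h

end

section

open NumberField Filter Topology

section
variable {K : Type*} [Field K] [NumberField K]

open Classical in
/-- The finite places in `S` of norm at most `N`, as ideals. -/
noncomputable def placesFinset (S : Set (FinitePlaceIdeal K)) (N : ℕ) : Finset (Ideal (𝓞 K)) :=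
  (primesOfNormLe K N).filter fun p => ∃ h, (⟨p, h⟩ : FinitePlaceIdeal K) ∈ S

theorem mem_placesFinset {S : Set (FinitePlaceIdeal K)} {N : ℕ} {p : Ideal (𝓞 K)} :
    p ∈ placesFinset S N ↔
      Ideal.absNorm p ≤ N ∧ ∃ h, (⟨p, h⟩ : FinitePlaceIdeal K) ∈ S := by
  classical
  rw [placesFinset, Finset.mem_filter, mem_primesOfNormLe]
  exact ⟨fun h => ⟨h.1.2, h.2⟩, fun h => ⟨⟨h.2.1, h.1⟩, h.2⟩⟩

theorem placesCount_eq_card (S : Set (FinitePlaceIdeal K)) (N : ℕ) :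
    placesCount K S N = (placesFinset S N).card := by
  classical
  rw [placesCount, ← Nat.subtype_card (p := (· ∈ placesFinset S N)) (placesFinset S N) fun _ => Iff.rfl]
  refine Nat.card_congr
    { toFun := fun p => ⟨p.1.1, mem_placesFinset.mpr ⟨p.2.2, p.1.2, p.2.1⟩⟩
      invFun := fun p => ⟨⟨p.1, (mem_placesFinset.mp p.2).2.1⟩,
        (mem_placesFinset.mp p.2).2.2, (mem_placesFinset.mp p.2).1⟩
      left_inv := fun _ => rfl
      right_inv := fun _ => rfl }

theorem placesCount_univ (N : ℕ) :
    placesCount K Set.univ N = (primesOfNormLe K N).card := by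
  rw [placesCount_eq_card]
  congr 1
  ext p
  rw [mem_placesFinset, mem_primesOfNormLe]
  exact ⟨fun h => ⟨h.2.1, h.1⟩, fun h => ⟨h.2, h.1, trivial⟩⟩

theorem placesCount_add_compl (S : Set (FinitePlaceIdeal K)) (N : ℕ) :
    placesCount K S N + placesCount K Sᶜ N = placesCount K Set.univ N := by
  classical
  rw [placesCount_univ, placesCount_eq_card, placesCount_eq_card,
    ← Finset.card_filter_add_card_filter_not (s := primesOfNormLe K N)
      (fun p => ∃ h, (⟨p, h⟩ : FinitePlaceIdeal K) ∈ S)]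
  congr 2
  · ext p
    simp only [placesFinset, Finset.mem_filter, mem_primesOfNormLe,
      not_exists]
    exact ⟨fun h => ⟨h.1, fun _ => h.2.2⟩, fun h => ⟨h.1, h.1.1, h.2 h.1.1⟩⟩

variable {L : Type*} [Field L] [NumberField L] [Algebra K L]

theorem absNorm_comap_le {q : Ideal (𝓞 L)} (hq : q ≠ ⊥) :
    Ideal.absNorm (q.comap (algebraMap (𝓞 K) (𝓞 L))) ≤ Ideal.absNorm q := by
  have : Finite (𝓞 L ⧸ q) := Ideal.finiteQuotientOfFreeOfNeBot q hq
  rw [Ideal.absNorm_apply, Ideal.absNorm_apply, Submodule.cardQuot_apply,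
    Submodule.cardQuot_apply]
  exact Nat.card_le_card_of_injective (β := 𝓞 L ⧸ q) _
    (Ideal.quotientMap_injective (I := q) (f := algebraMap (𝓞 K) (𝓞 L)))

theorem placesCount_compl_above_le (T : Set (FinitePlaceIdeal K)) (N : ℕ) :
    placesCount L {q | ∃ p ∈ T, Ideal.map (algebraMap (𝓞 K) (𝓞 L)) p.1 ≤ q.1}ᶜ N ≤
      Module.finrank K L * placesCount K Tᶜ N := by
  classical
  rw [placesCount_eq_card, placesCount_eq_card]
  refine Finset.card_le_mul_card_image_of_maps_to
    (f := fun q => q.comap (algebraMap (𝓞 K) (𝓞 L))) ?_ _ ?_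
  · intro q hq
    rw [mem_placesFinset] at hq ⊢
    obtain ⟨hN, ⟨hp, h0⟩, hT⟩ := hq
    refine ⟨(absNorm_comap_le h0).trans hN,
      ⟨Ideal.comap_isPrime _ q, fun h => h0 (Ideal.eq_bot_of_comap_eq_bot h)⟩, ?_⟩
    intro h
    exact hT ⟨_, h, Ideal.map_comap_le⟩
  · intro p hp
    rw [mem_placesFinset] at hp
    obtain ⟨-, ⟨hp, h0⟩, -⟩ := hp
    have : p.IsMaximal := hp.isMaximal h0
    have : NoZeroSMulDivisors (𝓞 K) (𝓞 L) := ⟨fun h => smul_eq_zero.mp h⟩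
    refine le_trans (Finset.card_le_card fun q hq => ?_)
      (Ideal.card_primesOverFinset_le_finrank (𝓞 L) K L h0)
    rw [Finset.mem_filter, mem_placesFinset] at hq
    rw [IsDedekindDomain.mem_primesOverFinset_iff h0]
    exact ⟨hq.1.2.1.1, ⟨hq.2.symm⟩⟩

end

theorem upperDensity_above_of_tendsto (K L : Type*) [Field K] [NumberField K]
    [Field L] [NumberField L] [Algebra K L]
    (hK : Tendsto (fun N : ℕ => ((primesOfNormLe K N).card : ℝ) * Real.log N / N) atTop (𝓝 1))
    (hL : Tendsto (fun N : ℕ => ((primesOfNormLe L N).card : ℝ) * Real.log N / N) atTop (𝓝 1))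
    (T : Set (FinitePlaceIdeal K)) :
    1 - Module.finrank K L * (1 - upperDensity K T) ≤ upperDensity L
      {q | ∃ p ∈ T, Ideal.map (algebraMap (𝓞 K) (𝓞 L)) p.1 ≤ q.1} := by
  set T' : Set (FinitePlaceIdeal L) :=
    {q | ∃ p ∈ T, Ideal.map (algebraMap (𝓞 K) (𝓞 L)) p.1 ≤ q.1}
  set d : ℝ := (Module.finrank K L : ℝ) with hd'
  set π : ℕ → ℝ := fun N => (placesCount K Set.univ N : ℝ) with hπ
  set π' : ℕ → ℝ := fun N => (placesCount L Set.univ N : ℝ) with hπ'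
  have hKpos : ∀ᶠ N in atTop, 0 < π N := by
    filter_upwards [hK.eventually_const_lt zero_lt_one] with N h
    rw [hπ]
    simp only [placesCount_univ]
    by_contra! h0
    have : ((primesOfNormLe K N).card : ℝ) = 0 := le_antisymm h0 (Nat.cast_nonneg _)
    simp [this] at h
  have hLpos : ∀ᶠ N in atTop, 0 < π' N := by
    filter_upwards [hL.eventually_const_lt zero_lt_one] with N h
    rw [hπ']
    simp only [placesCount_univ]
    by_contra! h0
    have : ((primesOfNormLe L N).card : ℝ) = 0 := le_antisymm h0 (Nat.cast_nonneg _)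
    simp [this] at h
  have hr : Tendsto (fun N => π N / π' N) atTop (𝓝 1) := by
    have := hK.div hL one_ne_zero
    rw [div_one] at this
    refine this.congr' ?_
    filter_upwards [eventually_ge_atTop 2] with N hN
    simp only [hπ, hπ', placesCount_univ, Pi.div_apply]
    have h1 : Real.log N ≠ 0 := (Real.log_pos (by exact_mod_cast hN)).ne'
    have h2 : (N : ℝ) ≠ 0 := by positivity
    field_simp
  have hcount : ∀ N, (placesCount L T' N : ℝ) ≥ π' N - d * (π N - placesCount K T N) := by
    intro N
    have h1 : (placesCount L T'ᶜ N : ℝ) ≤ d * placesCount K Tᶜ N := by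
      rw [hd']
      exact_mod_cast placesCount_compl_above_le (L := L) T N
    have h2 : (placesCount L T' N : ℝ) + placesCount L T'ᶜ N = π' N := by
      simp only [hπ']
      exact_mod_cast placesCount_add_compl T' N
    have h3 : (placesCount K T N : ℝ) + placesCount K Tᶜ N = π N := by
      simp only [hπ]
      exact_mod_cast placesCount_add_compl T N
    have h4 : (placesCount K Tᶜ N : ℝ) = π N - placesCount K T N := by linarith
    rw [h4] at h1
    linarith
  refine le_of_forall_pos_sub_le fun ε hε => ?_
  have hd : 0 ≤ d := Nat.cast_nonneg _
  obtain ⟨η, hη, hη2⟩ : ∃ η > 0, d * η < ε / 2 := by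
    refine ⟨ε / (4 * (d + 1)), by positivity, ?_⟩
    rw [mul_div_assoc', div_lt_iff₀ (by positivity)]
    nlinarith
  have hfreq : ∃ᶠ N in atTop, upperDensity K T - η <
      (placesCount K T N : ℝ) / (placesCount K Set.univ N : ℝ) := by
    refine frequently_lt_of_lt_limsup ?_ (by unfold upperDensity; linarith)
    exact (isBoundedUnder_of ⟨0, fun N => by positivity⟩ : IsBoundedUnder (· ≥ ·) atTop
      fun N => (placesCount K T N : ℝ) / (placesCount K Set.univ N : ℝ)).isCoboundedUnder_le
  have hev : ∀ᶠ N in atTop, 1 - d * (1 - upperDensity K T) - ε <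
      1 - d * (π N / π' N) * (1 - (upperDensity K T - η)) := by
    have : Tendsto (fun N => 1 - d * (π N / π' N) * (1 - (upperDensity K T - η))) atTop
        (𝓝 (1 - d * 1 * (1 - (upperDensity K T - η)))) :=
      tendsto_const_nhds.sub ((hr.const_mul d).mul_const _)
    refine this.eventually_const_lt ?_
    nlinarith
  refine le_limsup_of_frequently_le ?_ ?_
  · refine (hfreq.and_eventually (hev.and (hKpos.and hLpos))).mono ?_
    rintro N ⟨h1, h2, h3, h4⟩
    refine h2.le.trans ?_
    change _ ≤ (placesCount L T' N : ℝ) / π' N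
    change _ < (placesCount K T N : ℝ) / π N at h1
    rw [lt_div_iff₀ h3] at h1
    rw [le_div_iff₀ h4]
    have h5 := hcount N
    have h6 : (1 - d * (π N / π' N) * (1 - (upperDensity K T - η))) * π' N =
        π' N - d * (π N - (upperDensity K T - η) * π N) := by
      field_simp
    rw [h6]
    nlinarith
  · refine isBoundedUnder_of ⟨1, fun N => ?_⟩
    refine div_le_one_of_le₀ ?_ (by positivity)
    have := placesCount_add_compl T' N
    exact_mod_cast (by omega : placesCount L T' N ≤ placesCount L Set.univ N)

end

/-- If `L / K` is a Galois extension of number fields of degree `d` and `T` is a set of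
finite places of `K` of upper density `δ > 1 - 1/d`, then the set `T'` of finite places
of `L` lying above some place of `T` has upper density at least `d·(δ - (1 - 1/d)) > 0`;
in particular `T'` has positive upper density. -/
theorem upperDensity_places_above_pos (K L : Type*) [Field K] [NumberField K]
    [Field L] [NumberField L] [Algebra K L] [IsGalois K L]
    (d : ℕ) (hd : 0 < d) (hdeg : Module.finrank K L = d)
    (T : Set (FinitePlaceIdeal K))
    (hT : upperDensity K T > 1 - 1 / (d : ℝ)) :
    letI T' : Set (FinitePlaceIdeal L) :=
      {q | ∃ p ∈ T, Ideal.map (algebraMap (𝓞 K) (𝓞 L)) p.1 ≤ q.1}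
    (d : ℝ) * (upperDensity K T - (1 - 1 / (d : ℝ))) ≤ upperDensity L T' ∧
      0 < upperDensity L T' := by
  have hd0 : (0 : ℝ) < d := Nat.cast_pos.mpr hd
  have heq : (d : ℝ) * (upperDensity K T - (1 - 1 / (d : ℝ))) =
      1 - Module.finrank K L * (1 - upperDensity K T) := by
    rw [hdeg]
    field_simp
    ring
  have hle := upperDensity_above_of_tendsto K L (tendsto_card_primesOfNormLe_mul_log_div K)
    (tendsto_card_primesOfNormLe_mul_log_div L) T
  rw [← heq] at hle
  exact ⟨hle, (mul_pos hd0 (sub_pos.mpr hT)).trans_le hle⟩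
end
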